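/- arXiv:2503.20561 — 2 statements merged into one kernel-verified Lean document; each statement's English description precedes it below -/
import Mathlib

section
/- Fix p,β∈ℕ+ and d ≥ 17·β^{p+1}·3^p·p + 1. Let Θ be any transformer parameters with the emulation property. Then for every T ≥ 2d(108β²+3p), setting L = ⌊T/(2d)⌋: sup_{f∈C_u^β([0,1]^p)} inf_{S>0, H^P∈Q_{ℝ^d}(T,L,S)} ‖f̂_{Θ,H^P,L,p} − f‖_{L^∞([0,1]^p)} ≤ C_1·((d−1)/(C_2·log(8d)))^{−2β/p}·((L−3p)/(C_3·log(4L)))^{−2β/p}, where C_1=85(β+1)^p·8^β, C_2=68β^{p+1}·3^p·p, C_3=72β²; in particular the left-hand side is at most a constant (depending on p, β, d) times (log T / T)^{2β/p} up to logarithmic factors. -/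
open scoped BigOperators
open Matrix

noncomputable section

namespace PromptTF

/-- The ReLU activation function. -/
def relu (x : ℝ) : ℝ := max x 0

/-- The elementary universal activation function (EUAF). -/
def euaf (x : ℝ) : ℝ :=
  if 0 ≤ x then |x - 2 * (⌊(x + 1) / 2⌋ : ℝ)| else x / (1 + |x|)

/-- Parameters of one transformer layer (attention heads and a feed-forward net). -/
structure TFLayer (D : ℕ) where
  M : ℕ
  Q : Fin M → Matrix (Fin D) (Fin D) ℝ
  K : Fin M → Matrix (Fin D) (Fin D) ℝ
  V : Fin M → Matrix (Fin D) (Fin D) ℝ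
  width : ℕ
  W1 : Matrix (Fin width) (Fin D) ℝ
  W2 : Matrix (Fin D) (Fin width) ℝ

/-- Self-attention layer applied to a list of tokens. -/
def attnOut {D : ℕ} (θ : TFLayer D) (H : List (Fin D → ℝ)) : List (Fin D → ℝ) :=
  H.map fun h => fun i =>
    h i + ∑ m : Fin θ.M,
      (H.map fun h' =>
        relu (dotProduct ((θ.Q m).mulVec h) ((θ.K m).mulVec h')) * ((θ.V m).mulVec h') i).sum

/-- One transformer layer `FFN ∘ Attn`, with feed-forward activation `act`. -/
def layerMap {D : ℕ} (act : ℝ → ℝ) (θ : TFLayer D) (H : List (Fin D → ℝ)) :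
    List (Fin D → ℝ) :=
  (attnOut θ H).map fun h => fun i =>
    h i + (θ.W2.mulVec fun k => act ((θ.W1.mulVec h) k)) i

/-- Multi-layer transformer, all activations ReLU. -/
def tfForward {D : ℕ} (Θ : List (TFLayer D)) (H : List (Fin D → ℝ)) : List (Fin D → ℝ) :=
  Θ.foldl (fun H' θ => layerMap relu θ H') H

/-- Multi-layer transformer whose first feed-forward layer uses the EUAF activation. -/
def tfForwardEUAF {D : ℕ} (Θ : List (TFLayer D)) (H : List (Fin D → ℝ)) :
    List (Fin D → ℝ) :=
  match Θ with
  | [] => H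
  | θ :: rest => rest.foldl (fun H' θ' => layerMap relu θ' H') (layerMap euaf θ H)

/-- Sequential (autoregressive) generation: append the last output column repeatedly. -/
def genTokens {D : ℕ} (forward : List (Fin D → ℝ) → List (Fin D → ℝ))
    (H : List (Fin D → ℝ)) : ℕ → List (Fin D → ℝ)
  | 0 => H
  | v + 1 =>
      genTokens forward H v ++ [(forward (genTokens forward H v)).getLastD (fun _ => 0)]

/-- The token at one-based position `m` in the generated sequence. -/
def tokenAt {D : ℕ} (forward : List (Fin D → ℝ) → List (Fin D → ℝ))
    (H : List (Fin D → ℝ)) (m : ℕ) : Fin D → ℝ :=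
  (genTokens forward H (m - H.length)).getD (m - 1) (fun _ => 0)

/-- A token with word embedding `u`, layer index `w`, position `j` and scale `S`:
`(uᵀ, 0_{3d+4}ᵀ, 1, S, S·w, S·j)ᵀ ∈ ℝ^{4d+8}`. -/
def promptToken (d : ℕ) (u : Fin d → ℝ) (w : ℤ) (j : ℕ) (S : ℝ) : Fin (4 * d + 8) → ℝ :=
  fun i =>
    if h : (i : ℕ) < d then u ⟨i, h⟩
    else if (i : ℕ) = 4 * d + 4 then 1
    else if (i : ℕ) = 4 * d + 5 then S
    else if (i : ℕ) = 4 * d + 6 then S * w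
    else if (i : ℕ) = 4 * d + 7 then S * j
    else 0

/-- First `d` coordinates of a token. -/
def firstd (d : ℕ) (h : Fin (4 * d + 8) → ℝ) : Fin d → ℝ :=
  fun k => h (Fin.castLE (by omega) k)

/-- Initial input: `T` prompt tokens followed by `N` data tokens. -/
def initialInput (d T N : ℕ) (u : Fin T → Fin d → ℝ) (w : Fin T → ℕ) (S : ℝ)
    (z : Fin N → Fin d → ℝ) : List (Fin (4 * d + 8) → ℝ) :=
  ((List.finRange T).map fun j => promptToken d (u j) (w j) ((j : ℕ) + 1) S)
    ++ ((List.finRange N).map fun i => promptToken d (z i) 0 (T + (i : ℕ) + 1) S)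

/-- The closed Euclidean ball of radius `B` in `ℝ^d`. -/
def eball (d : ℕ) (B : ℝ) : Set (Fin d → ℝ) :=
  {v | Real.sqrt (∑ k, v k ^ 2) ≤ B}

/-- Data of a valid prompt in `P_U(T, L, S)`: word embeddings in `U`,
layer indices in `{1, …, 2L}`. -/
def ValidPrompt {d : ℕ} (U : Set (Fin d → ℝ)) (T L : ℕ)
    (u : Fin T → Fin d → ℝ) (w : Fin T → ℕ) : Prop :=
  (∀ j, u j ∈ U) ∧ ∀ j, 1 ≤ w j ∧ w j ≤ 2 * L

/-- The virtual weight matrix `W^P_ℓ` (without the first-layer correction term). -/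
def WPmat {d T : ℕ} (u : Fin T → Fin d → ℝ) (w : Fin T → ℕ) (ℓ : ℕ) :
    Matrix (Fin d) (Fin d) ℝ :=
  ∑ j : Fin T,
    if h : (j : ℕ) + 1 < T then
      (if w j = 2 * ℓ - 1 ∧ w ⟨(j : ℕ) + 1, h⟩ = 2 * ℓ then
        vecMulVec (u j) (u ⟨(j : ℕ) + 1, h⟩) else 0)
    else 0

/-- The first-layer correction term `(h_T)_{1:d} 1{w_T=1} Σ_{j'} (h_{j'})_{1:d}ᵀ 1{w_{j'}=1}`. -/
def WPcorr {d T : ℕ} (u : Fin T → Fin d → ℝ) (w : Fin T → ℕ) :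
    Matrix (Fin d) (Fin d) ℝ :=
  if hT : 0 < T then
    (if w ⟨T - 1, by omega⟩ = 1 then
      vecMulVec (u ⟨T - 1, by omega⟩) (∑ j : Fin T, if w j = 1 then u j else 0)
    else 0)
  else 0

/-- The virtual first-layer weight matrix `W^P_{1,i}`; `first` indicates `i = 1`. -/
def WPone {d T : ℕ} (u : Fin T → Fin d → ℝ) (w : Fin T → ℕ) (first : Bool) :
    Matrix (Fin d) (Fin d) ℝ :=
  WPmat u w 1 + if first then WPcorr u w else 0

/-- The family of virtual weight matrices of a prompt, for the data token with
zero-based index `i`. -/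
def WPfam {d T : ℕ} (u : Fin T → Fin d → ℝ) (w : Fin T → ℕ) (i : ℕ) :
    ℕ → Matrix (Fin d) (Fin d) ℝ :=
  fun ℓ => if ℓ = 1 then WPone u w (i == 0) else WPmat u w ℓ

/-- Output of the virtual network after `ℓ` layers:
`vnetOut … ℓ = W_ℓ act(W_{ℓ-1} act( ⋯ act(W_1 z) ⋯ ))`. -/
def vnetOut (d : ℕ) (act : ℝ → ℝ) (Ws : ℕ → Matrix (Fin d) (Fin d) ℝ)
    (z : Fin d → ℝ) : ℕ → Fin d → ℝ
  | 0 => z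
  | ℓ + 1 =>
      (Ws (ℓ + 1)).mulVec fun k =>
        if ℓ = 0 then vnetOut d act Ws z ℓ k else act (vnetOut d act Ws z ℓ k)

/-- The emulation property: for every admissible prompt and data tokens, the sequentially
generated tokens realize the virtual neural network encoded by the prompt
(with activation `act`). -/
def EmulatesWith (d : ℕ)
    (forward : List (Fin (4 * d + 8) → ℝ) → List (Fin (4 * d + 8) → ℝ))
    (act : ℝ → ℝ) : Prop :=
  ∀ B : ℝ, 1 ≤ B → ∀ T L : ℕ, 0 < T → 0 < L →
  ∀ U : Set (Fin d → ℝ), U ⊆ eball d B →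
  ∀ S : ℝ, max ((d : ℝ) * B ^ (4 * L) * (T : ℝ) ^ (2 * L)) (2 * (L : ℝ)) ≤ S →
  ∀ (u : Fin T → Fin d → ℝ) (w : Fin T → ℕ), ValidPrompt U T L u w →
  ∀ N : ℕ, 0 < N → ∀ z : Fin N → Fin d → ℝ, (∀ i k, z i k ∈ Set.Icc (0 : ℝ) 1) →
  ∀ (i : Fin N) (ℓ : ℕ), 1 ≤ ℓ → ℓ ≤ L →
    tokenAt forward (initialInput d T N u w S z) (T + N * ℓ + (i : ℕ) + 1)
      = promptToken d (vnetOut d act (WPfam u w (i : ℕ)) (z i) ℓ) (-(ℓ : ℤ))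
          (T + N * ℓ + (i : ℕ) + 1) S

/-- The embedding `x ↦ (xᵀ, 1, 0_{d-p-1}ᵀ)ᵀ ∈ ℝ^d` of an input `x ∈ ℝ^p`. -/
def embed (d p : ℕ) (x : Fin p → ℝ) : Fin d → ℝ :=
  fun k => if h : (k : ℕ) < p then x ⟨k, h⟩ else if (k : ℕ) = p then 1 else 0

/-- The function approximator `f̂_{Θ,H^P,L,p}`: first coordinate of the token at
position `T+1+L` generated from the prompt followed by the single data token. -/
def fhat {d : ℕ} (forward : List (Fin (4 * d + 8) → ℝ) → List (Fin (4 * d + 8) → ℝ))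
    {T : ℕ} (u : Fin T → Fin d → ℝ) (w : Fin T → ℕ) (S : ℝ) (L p : ℕ)
    (x : Fin p → ℝ) : ℝ :=
  tokenAt forward (initialInput d T 1 u w S fun _ => embed d p x) (T + 1 + L)
    ⟨0, by omega⟩

/-- The unit cube `[0,1]^p`. -/
def unitCube (p : ℕ) : Set (Fin p → ℝ) := Set.Icc 0 1

/-- The sup-distance `‖f - g‖_{L^∞([0,1]^p)}`. -/
def supDist (p : ℕ) (f g : (Fin p → ℝ) → ℝ) : ℝ :=
  ⨆ x : unitCube p, |f x.1 - g x.1|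

/-- Partial derivative (within the unit cube) in coordinate direction `i`. -/
def pderivW (p : ℕ) (i : Fin p) (f : (Fin p → ℝ) → ℝ) : (Fin p → ℝ) → ℝ :=
  fun x => fderivWithin ℝ f (unitCube p) x (Pi.single i 1)

/-- Iterated partial derivative along a list of coordinate directions. -/
def pderivList (p : ℕ) : List (Fin p) → ((Fin p → ℝ) → ℝ) → (Fin p → ℝ) → ℝ
  | [], f => f
  | i :: is, f => pderivList p is (pderivW p i f)

/-- The unit ball `C_u^β([0,1]^p)` of `β`-times continuously differentiable functions with
all partial derivatives of order `≤ β` bounded by `1` on the cube. -/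
def Hclass (p β : ℕ) : Set ((Fin p → ℝ) → ℝ) :=
  {f | ContDiffOn ℝ β f (unitCube p) ∧
    ∀ ls : List (Fin p), ls.length ≤ β →
      ∀ x ∈ unitCube p, |pderivList p ls f x| ≤ 1}

/-- `U_{d,r}` : the span of the first `r` standard basis vectors of `ℝ^d`. -/
def spanFirst (d r : ℕ) : Set (Fin d → ℝ) :=
  {v | ∀ k : Fin d, r ≤ (k : ℕ) → v k = 0}

/-- Hidden layers of a standard ReLU network of width `r` (with biases). -/
def nnHidden {p r : ℕ} (W0 : Matrix (Fin r) (Fin p) ℝ) (b0 : Fin r → ℝ)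
    (Wm : ℕ → Matrix (Fin r) (Fin r) ℝ) (bm : ℕ → Fin r → ℝ) (x : Fin p → ℝ) :
    ℕ → Fin r → ℝ
  | 0 => fun i => W0.mulVec x i + b0 i
  | k + 1 => fun i =>
      (Wm k).mulVec (fun j => relu (nnHidden W0 b0 Wm bm x k j)) i + bm k i

/-- The class `N(r,p,L)` of ReLU networks `ℝ^p → ℝ` of width `r` and depth `L`
(`L` affine maps with ReLU in between). -/
def NNclass (r p L : ℕ) : Set ((Fin p → ℝ) → ℝ) :=
  {f | if L = 1 then ∃ (a : Fin p → ℝ) (b : ℝ), f = fun x => (∑ i, a i * x i) + b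
    else ∃ (W0 : Matrix (Fin r) (Fin p) ℝ) (b0 : Fin r → ℝ)
      (Wm : ℕ → Matrix (Fin r) (Fin r) ℝ) (bm : ℕ → Fin r → ℝ)
      (wL : Fin r → ℝ) (bL : ℝ),
      f = fun x => (∑ j, wL j * relu (nnHidden W0 b0 Wm bm x (L - 2) j)) + bL}

/-- Operator norm (w.r.t. the Euclidean norm) of a `d × d` matrix. -/
def opNorm {d : ℕ} (W : Matrix (Fin d) (Fin d) ℝ) : ℝ :=
  ‖LinearMap.toContinuousLinearMap (Matrix.toEuclideanLin W)‖

/-- The class `W(r,d,U,B)` of coarse weight matrices. -/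
def coarseW (d r : ℕ) (U : Set (Fin d → ℝ)) (B : ℝ) :
    Set (Matrix (Fin d) (Fin d) ℝ) :=
  {W | (∃ ut uu : Fin r → Fin d → ℝ,
        (∀ k, ut k ∈ U) ∧ (∀ k, uu k ∈ U) ∧ W = ∑ k, vecMulVec (ut k) (uu k)) ∧
    opNorm W ≤ B ^ 2}

open Classical in
/-- Number of nonzero parameter entries of one transformer layer. -/
def layerNonzero {D : ℕ} (θ : TFLayer D) : ℕ :=
  (Finset.univ.filter fun p : Fin θ.M × Fin D × Fin D => θ.Q p.1 p.2.1 p.2.2 ≠ 0).card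
  + (Finset.univ.filter fun p : Fin θ.M × Fin D × Fin D => θ.K p.1 p.2.1 p.2.2 ≠ 0).card
  + (Finset.univ.filter fun p : Fin θ.M × Fin D × Fin D => θ.V p.1 p.2.1 p.2.2 ≠ 0).card
  + (Finset.univ.filter fun p : Fin θ.width × Fin D => θ.W1 p.1 p.2 ≠ 0).card
  + (Finset.univ.filter fun p : Fin D × Fin θ.width => θ.W2 p.1 p.2 ≠ 0).card

/-- Total number of nonzero parameter entries of a transformer. -/
def tfNonzero {D : ℕ} (Θ : List (TFLayer D)) : ℕ := (Θ.map layerNonzero).sum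

/-- All parameter entries of one layer bounded in absolute value by `c`. -/
def layerEntriesBounded {D : ℕ} (θ : TFLayer D) (c : ℝ) : Prop :=
  (∀ m i j, |θ.Q m i j| ≤ c) ∧ (∀ m i j, |θ.K m i j| ≤ c) ∧ (∀ m i j, |θ.V m i j| ≤ c)
  ∧ (∀ i j, |θ.W1 i j| ≤ c) ∧ ∀ i j, |θ.W2 i j| ≤ c

end PromptTF
end

open PromptTF Matrix

namespace ReluNet

section Layers

variable {X : Type}

/-- The affine span of a set of real functions. -/
def sp (A : Set (X → ℝ)) : Submodule ℝ (X → ℝ) := Submodule.span ℝ (insert 1 A)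

/-- Pointwise application of the ReLU. -/
noncomputable def act (f : X → ℝ) : X → ℝ := fun x => relu (f x)

/-- One hidden layer with at most `w` neurons, each reading affine combinations of `A`, makes
the functions in `B` available as affine combinations of the neurons. -/
def Step (w : ℕ) (A B : Set (X → ℝ)) : Prop :=
  ∃ s : Finset (X → ℝ), s.card ≤ w ∧ (s : Set (X → ℝ)) ⊆ sp A ∧
    B ⊆ (sp (act '' (s : Set (X → ℝ))) : Set (X → ℝ))

/-- `Net w k A B`: the functions in `B` are affine combinations of the last hidden layer of a
ReLU network of width `w` with `k` hidden layers that reads affine combinations of `A`. -/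
inductive Net (w : ℕ) : ℕ → Set (X → ℝ) → Set (X → ℝ) → Prop
  | nil {A B : Set (X → ℝ)} : B ⊆ sp A → Net w 0 A B
  | cons {k : ℕ} {A B C : Set (X → ℝ)} : Net w k A B → Step w B C → Net w (k + 1) A C

lemma relu_of_nonneg {a : ℝ} (h : 0 ≤ a) : relu a = a := max_eq_left h

lemma relu_of_nonpos {a : ℝ} (h : a ≤ 0) : relu a = 0 := max_eq_right h

lemma relu_nonneg (a : ℝ) : 0 ≤ relu a := le_max_right _ _

lemma relu_sub_relu_neg (a : ℝ) : relu a - relu (-a) = a := by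
  rcases le_total 0 a with h | h
  · rw [relu_of_nonneg h, relu_of_nonpos (by linarith), sub_zero]
  · rw [relu_of_nonpos h, relu_of_nonneg (by linarith)]; ring

section Span

variable {A B : Set (X → ℝ)}

lemma one_mem_sp : (1 : X → ℝ) ∈ sp A := Submodule.subset_span (Set.mem_insert _ _)

lemma subset_sp : A ⊆ sp A := fun _ h => Submodule.subset_span (Set.mem_insert_of_mem _ h)

lemma const_mem_sp (c : ℝ) : (fun _ => c : X → ℝ) ∈ sp A := by
  convert (sp A).smul_mem c one_mem_sp using 1
  ext x; simp

lemma sp_le (h : A ⊆ sp B) : sp A ≤ sp B :=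
  Submodule.span_le.2 (Set.insert_subset one_mem_sp h)

lemma sp_mono (h : A ⊆ B) : sp A ≤ sp B := sp_le (h.trans subset_sp)

lemma add_mem_sp {f g : X → ℝ} (hf : f ∈ sp A) (hg : g ∈ sp A) :
    (fun x => f x + g x) ∈ sp A := (sp A).add_mem hf hg

lemma sub_mem_sp {f g : X → ℝ} (hf : f ∈ sp A) (hg : g ∈ sp A) :
    (fun x => f x - g x) ∈ sp A := (sp A).sub_mem hf hg

lemma mul_mem_sp (c : ℝ) {f : X → ℝ} (hf : f ∈ sp A) :
    (fun x => c * f x) ∈ sp A := (sp A).smul_mem c hf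

lemma sum_mem_sp {ι : Type*} {s : Finset ι} {f : ι → X → ℝ} (hf : ∀ i ∈ s, f i ∈ sp A) :
    (fun x => ∑ i ∈ s, f i x) ∈ sp A := by
  convert (sp A).sum_mem hf using 1
  ext x; simp

end Span

lemma Step.mono {w w' : ℕ} {A A' B B' : Set (X → ℝ)} (h : Step w A B) (hw : w ≤ w')
    (hA : A ⊆ sp A') (hB : B' ⊆ sp B) : Step w' A' B' := by
  obtain ⟨s, h1, h2, h3⟩ := h
  exact ⟨s, h1.trans hw, h2.trans (sp_le hA), hB.trans (sp_le h3)⟩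

lemma Step.of_family {ι : Type*} [Fintype ι] {A : Set (X → ℝ)} (u : ι → X → ℝ)
    (hu : ∀ i, u i ∈ sp A) : Step (Fintype.card ι) A (Set.range fun i => act (u i)) := by
  classical
  refine ⟨Finset.univ.image u, Finset.card_image_le, ?_, ?_⟩
  · intro f hf
    simp only [Finset.coe_image, Finset.coe_univ, Set.image_univ, Set.mem_range] at hf
    obtain ⟨i, rfl⟩ := hf
    exact hu i
  · rintro _ ⟨i, rfl⟩
    exact subset_sp ⟨u i, by simp, rfl⟩

lemma Step.union {w w' : ℕ} {A A' B B' : Set (X → ℝ)} (h : Step w A B) (h' : Step w' A' B') :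
    Step (w + w') (A ∪ A') (B ∪ B') := by
  classical
  obtain ⟨s, h1, h2, h3⟩ := h
  obtain ⟨s', h1', h2', h3'⟩ := h'
  refine ⟨s ∪ s', (Finset.card_union_le _ _).trans (add_le_add h1 h1'), ?_, ?_⟩
  · rw [Finset.coe_union]
    exact Set.union_subset (h2.trans (sp_mono Set.subset_union_left))
      (h2'.trans (sp_mono Set.subset_union_right))
  · rw [Finset.coe_union]
    exact Set.union_subset
      (h3.trans (sp_mono (Set.image_mono Set.subset_union_left)))
      (h3'.trans (sp_mono (Set.image_mono Set.subset_union_right)))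

namespace Net

variable {w w' k k' : ℕ} {A A' B B' C : Set (X → ℝ)}

lemma mono_right (h : Net w k A B) (hB : B' ⊆ sp B) : Net w k A B' := by
  cases h with
  | nil h => exact .nil (hB.trans (sp_le h))
  | cons h hs => exact .cons h (hs.mono le_rfl subset_sp hB)

lemma mono_left (h : Net w k A B) (hA : A ⊆ sp A') : Net w k A' B := by
  induction h with
  | nil h => exact .nil (h.trans (sp_le hA))
  | cons _ hs ih => exact .cons (ih hA) hs

lemma mono_width (h : Net w k A B) (hw : w ≤ w') : Net w' k A B := by
  induction h with
  | nil h => exact .nil h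
  | cons _ hs ih => exact .cons ih (hs.mono hw subset_sp subset_sp)

lemma single (h : Step w A B) : Net w 1 A B := .cons (.nil subset_sp) h

lemma of_family {ι : Type*} [Fintype ι] (u : ι → X → ℝ) (hw : Fintype.card ι ≤ w)
    (hu : ∀ i, u i ∈ sp A) (hB : B ⊆ sp (Set.range fun i => act (u i))) : Net w 1 A B :=
  single ((Step.of_family u hu).mono hw subset_sp hB)

lemma trans (h : Net w k A B) (h' : Net w k' B C) : Net w (k + k') A C := by
  induction h' with
  | nil hs => exact h.mono_right hs
  | cons _ hs ih => exact .cons (ih h) hs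

lemma trans_of_subset (h : Net w k A B) (hB : A' ⊆ sp B) (h' : Net w k' A' C) :
    Net w (k + k') A C := (h.mono_right hB).trans h'

lemma union (h : Net w k A B) (h' : Net w' k A' B') :
    Net (w + w') k (A ∪ A') (B ∪ B') := by
  induction h generalizing A' B' with
  | nil h =>
    cases h' with
    | nil h' =>
      exact .nil (Set.union_subset (h.trans (sp_mono Set.subset_union_left))
        (h'.trans (sp_mono Set.subset_union_right)))
  | cons _ hs ih =>
    cases h' with
    | cons h' hs' => exact .cons (ih h') (hs.union hs')

lemma union_same (h : Net w k A B) (h' : Net w' k A B') : Net (w + w') k A (B ∪ B') := by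
  simpa using h.union h'

lemma empty (k : ℕ) : Net 0 k A (∅ : Set (X → ℝ)) := by
  induction k with
  | zero => exact .nil (Set.empty_subset _)
  | succ k ih => exact .cons ih ⟨∅, by simp, by simp, Set.empty_subset _⟩

lemma biUnion {ι : Type*} (s : Finset ι) {A B : ι → Set (X → ℝ)}
    (h : ∀ i ∈ s, Net w k (A i) (B i)) :
    Net (s.card * w) k (⋃ i ∈ s, A i) (⋃ i ∈ s, B i) := by
  classical
  induction s using Finset.induction_on with
  | empty => simpa using empty k
  | insert i s hi ih =>
    rw [Finset.set_biUnion_insert, Finset.set_biUnion_insert, Finset.card_insert_of_notMem hi]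
    have := (h i (Finset.mem_insert_self _ _)).union
      (ih fun j hj => h j (Finset.mem_insert_of_mem hj))
    exact this.mono_width (by linarith)

lemma iUnion {ι : Type*} [Fintype ι] {A B : ι → Set (X → ℝ)} (h : ∀ i, Net w k (A i) (B i)) :
    Net (Fintype.card ι * w) k (⋃ i, A i) (⋃ i, B i) := by
  simpa using biUnion (Finset.univ : Finset ι) (fun i _ => h i)

lemma sum_mem {ι : Type*} (s : Finset ι) {f : ι → X → ℝ} (c : ι → ℝ)
    (h : ∀ i ∈ s, Net w k A {f i}) :
    Net (s.card * w) k A {fun x => ∑ i ∈ s, c i * f i x} := by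
  refine ((biUnion s h).mono_left ?_).mono_right ?_
  · exact (Set.iUnion₂_subset fun _ _ => subset_rfl).trans subset_sp
  · rintro _ rfl
    refine sum_mem_sp fun i hi => mul_mem_sp _ (subset_sp ?_)
    exact Set.mem_biUnion hi rfl

lemma pass_range {ι : Type*} [Fintype ι] (v : ι → X → ℝ) (hv : ∀ i x, 0 ≤ v i x) (k : ℕ) :
    Net (Fintype.card ι) k (Set.range v) (Set.range v) := by
  induction k with
  | zero => exact .nil subset_sp
  | succ k ih =>
    refine .cons ih ((Step.of_family v fun i => subset_sp (Set.mem_range_self i)).mono le_rfl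
      subset_sp ?_)
    rintro _ ⟨i, rfl⟩
    refine subset_sp ⟨i, ?_⟩
    ext x
    exact relu_of_nonneg (hv i x)

lemma pass {f : X → ℝ} (hf : ∀ x, 0 ≤ f x) (k : ℕ) : Net 1 k {f} {f} := by
  simpa using pass_range (fun _ : Unit => f) (fun _ => hf) k

lemma pass_signed (f : X → ℝ) (k : ℕ) : Net 2 k {f} {f} := by
  induction k with
  | zero => exact .nil subset_sp
  | succ k ih =>
    refine .cons ih ((Step.of_family (fun b : Bool => if b then f else -f) ?_).mono
      (by simp) subset_sp ?_)
    · rintro (_ | _)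
      · exact (sp {f}).neg_mem (subset_sp (Set.mem_singleton f))
      · exact subset_sp (Set.mem_singleton f)
    · rw [Set.singleton_subset_iff]
      have hm (b : Bool) : act (if b then f else -f) ∈
          sp (Set.range fun b : Bool => act (if b then f else -f)) :=
        subset_sp (Set.mem_range_self b)
      change f ∈ sp _
      convert sub_mem_sp (hm true) (hm false) using 1
      ext x
      simp [act, relu_sub_relu_neg]

lemma loop (S : ℕ → Set (X → ℝ)) (n : ℕ) (h : ∀ t < n, Net w k (S t) (S (t + 1))) :
    Net w (k * n) (S 0) (S n) := by
  induction n with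
  | zero => exact .nil subset_sp
  | succ n ih =>
    rw [Nat.mul_succ]
    exact (ih fun t ht => h t (by omega)).trans (h n (by omega))

/-- Networks may be precomposed with an arbitrary map of the domains. -/
lemma comp {Y : Type} (h : Net w k A B) (σ : Y → X) :
    Net w k ((fun f => f ∘ σ) '' A) ((fun f => f ∘ σ) '' B) := by
  classical
  have key : ∀ (A : Set (X → ℝ)) f, f ∈ sp A → f ∘ σ ∈ sp ((fun f => f ∘ σ) '' A) := by
    intro A f hf
    have := Submodule.mem_map_of_mem (f := LinearMap.funLeft ℝ ℝ σ) hf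
    rw [sp, Submodule.map_span, Set.image_insert_eq] at this
    exact this
  induction h with
  | nil h =>
    refine .nil ?_
    rintro _ ⟨f, hf, rfl⟩
    exact key _ _ (h hf)
  | cons _ hs ih =>
    obtain ⟨s, h1, h2, h3⟩ := hs
    refine .cons ih ⟨s.image fun f => f ∘ σ, Finset.card_image_le.trans h1, ?_, ?_⟩
    · rw [Finset.coe_image]
      rintro _ ⟨f, hf, rfl⟩
      exact key _ _ (h2 hf)
    · rintro _ ⟨f, hf, rfl⟩
      have := key _ _ (h3 hf)
      refine sp_mono ?_ this
      rw [Finset.coe_image]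
      rintro _ ⟨_, ⟨g, hg, rfl⟩, rfl⟩
      exact ⟨g ∘ σ, ⟨g, hg, rfl⟩, rfl⟩

/-- A network that reads the restrictions of `A` along `σ` extends to one that reads `A`. -/
lemma lift {Y : Type} {σ : Y → X} {A' B' : Set (Y → ℝ)} (h : Net w k A' B')
    (hA : A' = (fun f => f ∘ σ) '' A) :
    ∃ B : Set (X → ℝ), Net w k A B ∧ B' ⊆ (fun f => f ∘ σ) '' B := by
  classical
  have key : ∀ (A : Set (X → ℝ)) (B : Set (Y → ℝ)), B ⊆ (fun f => f ∘ σ) '' A →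
      ∀ f ∈ sp B, ∃ g ∈ sp A, g ∘ σ = f := by
    intro A B hB f hf
    have h1 : sp B ≤ (sp A).map (LinearMap.funLeft ℝ ℝ σ) := by
      rw [sp, sp, Submodule.map_span, Set.image_insert_eq]
      exact Submodule.span_mono (Set.insert_subset_insert hB)
    exact h1 hf
  induction h with
  | nil h =>
    refine ⟨sp A, .nil subset_rfl, fun f hf => key A _ hA.subset f (h hf)⟩
  | cons _ hs ih =>
    obtain ⟨B, hB, hB'⟩ := ih hA
    obtain ⟨s, h1, h2, h3⟩ := hs
    have hex : ∀ f : s, ∃ g ∈ sp B, g ∘ σ = f.1 := fun f => key B _ hB' _ (h2 f.2)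
    choose g hg hgf using hex
    refine ⟨(sp (act '' ((Finset.univ.image g : Finset (X → ℝ)) : Set (X → ℝ))) : Set (X → ℝ)),
      .cons hB ⟨Finset.univ.image g, ?_, ?_, fun _ hf => hf⟩, fun f hf => key _ _ ?_ f (h3 hf)⟩
    · exact Finset.card_image_le.trans (by simpa using h1)
    · intro f hf
      simp only [Finset.coe_image, Finset.coe_univ, Set.image_univ, Set.mem_range] at hf
      obtain ⟨i, rfl⟩ := hf
      exact hg i
    · rintro _ ⟨f, hf, rfl⟩
      refine ⟨act (g ⟨f, hf⟩), ⟨g ⟨f, hf⟩, by simp, rfl⟩, ?_⟩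
      have := hgf ⟨f, hf⟩
      ext x
      exact congrArg relu (congrFun this x)

end Net

end Layers

section Selection

variable {X : Type}

/-- The thermometer code of a digit `dg x < r`. -/
def thermo (r : ℕ) (dg : X → ℕ) (i : Fin (r - 1)) (x : X) : ℝ := if (i : ℕ) < dg x then 1 else 0

lemma sum_thermo {r : ℕ} {dg : X → ℕ} {x : X} (h : dg x < r) :
    ∑ i, thermo r dg i x = dg x := by
  unfold thermo
  rw [Fin.sum_univ_eq_sum_range (fun i => if i < dg x then (1 : ℝ) else 0) (r - 1),
    Finset.sum_boole]
  congr 1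
  have : (Finset.range (r - 1)).filter (fun i => i < dg x) = Finset.range (dg x) := by
    ext i; simp; omega
  rw [this, Finset.card_range]

/-- Hinge functions of an integer-valued function `J`. -/
noncomputable def code (J : X → ℕ) (n : ℕ) : Set (X → ℝ) :=
  Set.range fun (i : Fin n) x => relu ((J x : ℝ) - (i : ℕ))

lemma comp_mem_sp_code {J : X → ℕ} {n : ℕ} (hJ : ∀ x, J x < n) (F : ℕ → ℝ) :
    (fun x => F (J x)) ∈ sp (code J n) := by
  have hstep : ∀ i ∈ Finset.range n,
      (fun x => (F (i + 1) - F i) * if i < J x then (1 : ℝ) else 0) ∈ sp (code J n) := by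
    intro i hi
    refine mul_mem_sp _ ?_
    have hi' := Finset.mem_range.1 hi
    have h1 : (fun x => relu ((J x : ℝ) - i)) ∈ sp (code J n) := subset_sp ⟨⟨i, hi'⟩, rfl⟩
    by_cases hn : i + 1 < n
    · have h2 : (fun x => relu ((J x : ℝ) - (i + 1 : ℕ))) ∈ sp (code J n) :=
        subset_sp ⟨⟨i + 1, hn⟩, rfl⟩
      convert sub_mem_sp h1 h2 using 1
      ext x
      split_ifs with h
      · have : (i : ℝ) + 1 ≤ J x := by exact_mod_cast h
        rw [relu_of_nonneg (by linarith), relu_of_nonneg (by push_cast; linarith)]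
        push_cast; ring
      · have : (J x : ℝ) ≤ i := by exact_mod_cast not_lt.1 h
        rw [relu_of_nonpos (by linarith), relu_of_nonpos (by push_cast; linarith)]
        ring
    · convert const_mem_sp (A := code J n) 0 using 1
      ext x
      have := hJ x
      rw [if_neg (by omega)]
  convert add_mem_sp (const_mem_sp (F 0)) (sum_mem_sp hstep) using 1
  ext x
  have : ∑ i ∈ Finset.range n, (F (i + 1) - F i) * (if i < J x then (1 : ℝ) else 0)
      = ∑ i ∈ Finset.range (J x), (F (i + 1) - F i) := by
    rw [← Finset.sum_subset (s₁ := Finset.range (J x))]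
    · refine Finset.sum_congr rfl fun i hi => ?_
      rw [if_pos (Finset.mem_range.1 hi), mul_one]
    · exact Finset.range_mono (hJ x).le
    · intro i _ hi
      rw [if_neg (by simpa using hi), mul_zero]
  rw [this, Finset.sum_range_sub]
  ring

/-- The two one-sided distances of an integer-valued function to `t`. -/
noncomputable def sides (L : X → ℕ) (t : ℕ) : Set (X → ℝ) :=
  {(fun x => relu ((L x : ℝ) - t)), (fun x => relu ((t : ℝ) - L x))}

lemma cast_mem_sp_sides (L : X → ℕ) (t : ℕ) : (fun x => (L x : ℝ)) ∈ sp (sides L t) := by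
  have h1 : (fun x => relu ((L x : ℝ) - t)) ∈ sp (sides L t) := subset_sp (by simp [sides])
  have h2 : (fun x => relu ((t : ℝ) - L x)) ∈ sp (sides L t) := subset_sp (by simp [sides])
  convert add_mem_sp (const_mem_sp (t : ℝ)) (sub_mem_sp h1 h2) using 1
  ext x
  have := relu_sub_relu_neg ((L x : ℝ) - t)
  rw [neg_sub] at this
  linarith

lemma abs_sub_mem_sp_sides (L : X → ℕ) (t : ℕ) :
    (fun x => |(L x : ℝ) - t|) ∈ sp (sides L t) := by
  have h1 : (fun x => relu ((L x : ℝ) - t)) ∈ sp (sides L t) := subset_sp (by simp [sides])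
  have h2 : (fun x => relu ((t : ℝ) - L x)) ∈ sp (sides L t) := subset_sp (by simp [sides])
  convert add_mem_sp h1 h2 using 1
  ext x
  rcases le_total (L x : ℝ) t with h | h
  · rw [abs_of_nonpos (by linarith), relu_of_nonpos (by linarith), relu_of_nonneg (by linarith)]
    ring
  · rw [abs_of_nonneg (by linarith), relu_of_nonneg (by linarith), relu_of_nonpos (by linarith)]
    ring

lemma one_le_abs_sub_of_ne {a b : ℕ} (h : a ≠ b) : (1 : ℝ) ≤ |(a : ℝ) - b| := by
  have : (1 : ℤ) ≤ |(a : ℤ) - b| := Int.one_le_abs (by omega)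
  exact_mod_cast this

namespace Net

variable {w k : ℕ} {A B : Set (X → ℝ)}

lemma keep {f : X → ℝ} (hf : f ∈ sp A) (h0 : ∀ x, 0 ≤ f x) (k : ℕ) : Net 1 k A {f} :=
  (pass h0 k).mono_left (Set.singleton_subset_iff.2 hf)

lemma sides (L : X → ℕ) (t : ℕ) (hL : (fun x => (L x : ℝ)) ∈ sp A) :
    Net 2 1 A (sides L t) := by
  refine of_family (fun b : Bool => if b then (fun x => (L x : ℝ) - t) else
    (fun x => (t : ℝ) - L x)) (by simp) ?_ ?_
  · rintro (_ | _)
    · exact sub_mem_sp (const_mem_sp _) hL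
    · exact sub_mem_sp hL (const_mem_sp _)
  · rintro _ (rfl | rfl)
    · exact subset_sp ⟨true, rfl⟩
    · exact subset_sp ⟨false, rfl⟩

lemma code {J : X → ℕ} (n : ℕ) (hJ : (fun x => (J x : ℝ)) ∈ sp A) : Net n 1 A (code J n) :=
  of_family (fun (i : Fin n) x => (J x : ℝ) - (i : ℕ)) (by simp)
    (fun _ => sub_mem_sp hJ (const_mem_sp _)) subset_sp

lemma pass_code (J : X → ℕ) (n k : ℕ) :
    Net n k (ReluNet.code J n) (ReluNet.code J n) := by
  have := pass_range (fun (i : Fin n) x => relu ((J x : ℝ) - (i : ℕ)))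
    (fun _ _ => relu_nonneg _) k
  rwa [Fintype.card_fin] at this

/-- Extraction of one base `r` digit. -/
lemma digit (r : ℕ) {κ : ℝ} (hκ : 0 < κ) {y y' : X → ℝ} {dg : X → ℕ}
    (h : ∀ x, (r : ℝ) * y x = dg x + y' x) (hy : ∀ x, 0 ≤ y x) (h0 : ∀ x, 0 ≤ y' x)
    (h1 : ∀ x, y' x ≤ 1 - κ) (hd : ∀ x, dg x < r) :
    Net (2 * (r - 1) + 1) 1 {y} ({y'} ∪ Set.range (thermo r dg)) := by
  let u : Option (Fin (r - 1) × Bool) → X → ℝ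
    | none => y
    | some (i, b) => fun x => (r * y x - ((i : ℕ) + 1)) / κ + if b then 1 else 0
  have hu : ∀ i, u i ∈ sp {y} := by
    have hy : y ∈ sp {y} := subset_sp rfl
    rintro (_ | ⟨i, b⟩)
    · exact hy
    · convert add_mem_sp (mul_mem_sp κ⁻¹ (sub_mem_sp (mul_mem_sp r hy)
        (const_mem_sp (((i : ℕ) : ℝ) + 1)))) (const_mem_sp (if b then (1 : ℝ) else 0)) using 1
      ext x
      simp only [u]
      ring
  have hmem : ∀ i, act (u i) ∈ sp (Set.range fun i => act (u i)) := fun i => subset_sp ⟨i, rfl⟩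
  have hT : ∀ i, thermo r dg i ∈ sp (Set.range fun i => act (u i)) := by
    intro i
    convert sub_mem_sp (hmem (some (i, true))) (hmem (some (i, false))) using 1
    ext x
    simp only [act, u, thermo]
    by_cases hlt : (i : ℕ) < dg x
    · rw [if_pos hlt]
      have h2 : ((i : ℕ) : ℝ) + 1 ≤ dg x := by exact_mod_cast hlt
      have h3 : 0 ≤ (r * y x - ((i : ℕ) + 1)) / κ :=
        div_nonneg (by rw [h]; linarith [h0 x]) hκ.le
      rw [relu_of_nonneg (by simp; linarith), relu_of_nonneg (by simpa using h3)]
      simp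
    · rw [if_neg hlt]
      have h2 : (dg x : ℝ) ≤ (i : ℕ) := by exact_mod_cast not_lt.1 hlt
      have h3 : (r * y x - ((i : ℕ) + 1)) / κ ≤ -1 := by
        rw [div_le_iff₀ hκ, h]
        linarith [h1 x]
      rw [relu_of_nonpos (by simp; linarith), relu_of_nonpos (by simp; linarith)]
      simp
  refine of_family u (by simp; omega) hu (Set.union_subset ?_ ?_)
  · rw [Set.singleton_subset_iff]
    change y' ∈ sp _
    convert sub_mem_sp (mul_mem_sp r (hmem none)) (sum_mem_sp (s := Finset.univ)
      fun i _ => hT i) using 1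
    ext x
    rw [sum_thermo (hd x)]
    simp only [act, u, relu_of_nonneg (hy x)]
    linarith [h x]
  · rintro _ ⟨i, rfl⟩
    exact hT i

end Net

lemma cast_digit_mem_sp {r : ℕ} {dg : X → ℕ} (hd : ∀ x, dg x < r) :
    (fun x => (dg x : ℝ)) ∈ sp (Set.range (thermo r dg)) := by
  convert sum_mem_sp (A := Set.range (thermo r dg)) (s := Finset.univ)
    (fun i _ => subset_sp (Set.mem_range_self i)) using 1
  ext x
  rw [sum_thermo (hd x)]

namespace Net

/-- One digit of each coordinate is extracted and added to four linear statistics. -/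
lemma accumulate {ι : Type} [Fintype ι] {r : ℕ} {κ : ℝ} (hκ : 0 < κ) {y y' : ι → X → ℝ}
    {dg : ι → X → ℕ} (h : ∀ j x, (r : ℝ) * y j x = dg j x + y' j x) (hy : ∀ j x, 0 ≤ y j x)
    (h0 : ∀ j x, 0 ≤ y' j x) (h1 : ∀ j x, y' j x ≤ 1 - κ) (hd : ∀ j x, dg j x < r)
    {σ : Type} [Fintype σ] {Φ Φ' : σ → X → ℝ} (hΦ : ∀ s x, 0 ≤ Φ s x) (a : σ → ι → ℝ)
    (hΦ' : ∀ s x, Φ' s x = Φ s x + ∑ j, a s j * dg j x) :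
    Net (Fintype.card ι * (2 * (r - 1) + 1) + Fintype.card σ) 1
      (Set.range y ∪ Set.range Φ) (Set.range y' ∪ Set.range Φ') := by
  refine (((iUnion fun j => digit r hκ (h j) (hy j) (h0 j) (h1 j) (hd j)).union
    (pass_range Φ hΦ 1)).mono_left (Set.union_subset ?_ ?_)).mono_right (Set.union_subset ?_ ?_)
  · exact Set.iUnion_subset fun j => Set.singleton_subset_iff.2
      (subset_sp (Or.inl (Set.mem_range_self j)))
  · exact fun f hf => subset_sp (Or.inr hf)
  · rintro _ ⟨j, rfl⟩
    exact subset_sp (Or.inl (Set.mem_iUnion.2 ⟨j, Or.inl rfl⟩))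
  · rintro _ ⟨s, rfl⟩
    have e : Φ' s = fun x => Φ s x + ∑ j, a s j * dg j x := funext (hΦ' s)
    rw [e]
    refine add_mem_sp (subset_sp (Or.inr (Set.mem_range_self s)))
      (sum_mem_sp fun j _ => mul_mem_sp _ ?_)
    refine sp_mono ?_ (cast_digit_mem_sp (hd j))
    exact fun f hf => Or.inl (Set.mem_iUnion.2 ⟨j, Or.inr hf⟩)

/-- One step of a sequential table lookup. -/
lemma lookup_step {n : ℕ} (hn : 0 < n) {J₁ J₂ L : X → ℕ} (hJ₁ : ∀ x, J₁ x < n)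
    (hJ₂ : ∀ x, J₂ x < n) (t : ℕ) {F : ℕ → ℕ → ℝ} (hF : ∀ i j, F i j ∈ Set.Icc (0 : ℝ) 1)
    {a a' : X → ℝ} (ha : ∀ x, 0 ≤ a x)
    (ha' : ∀ x, a' x = a x + if L x = t then F (J₁ x) (J₂ x) else 0) :
    Net (3 * n + 2) 2
      ((ReluNet.code J₁ n ∪ ReluNet.code J₂ n) ∪ {(fun x => (L x : ℝ)), a})
      ((ReluNet.code J₁ n ∪ ReluNet.code J₂ n) ∪ {(fun x => (L x : ℝ)), a'}) := by
  have hc := (pass_code J₁ n 1).union (pass_code J₂ n 1)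
  have n1 := (hc.union (sides L t (A := {(fun x => (L x : ℝ)), a})
    (subset_sp (by simp)))).union (keep (A := {(fun x => (L x : ℝ)), a})
      (subset_sp (by simp)) ha 1)
  have n1' := (n1.mono_width (w' := 3 * n + 2) (by omega)).mono_left
    (A' := (ReluNet.code J₁ n ∪ ReluNet.code J₂ n) ∪ {(fun x => (L x : ℝ)), a})
    (Set.union_subset subset_sp (fun f hf => subset_sp (Or.inr hf)))
  refine n1'.trans (k' := 1) ?_
  set C := ReluNet.code J₁ n ∪ ReluNet.code J₂ n with hC
  set M := (C ∪ ReluNet.sides L t) ∪ {a} with hM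
  let u : Fin n → X → ℝ := fun i x =>
    F (J₁ x) i - (1 - if J₂ x = i then 1 else 0) - |(L x : ℝ) - t|
  have hu : ∀ i, u i ∈ sp M := by
    intro i
    refine sub_mem_sp (sub_mem_sp ?_ (sub_mem_sp (const_mem_sp _) ?_)) ?_
    · exact sp_mono (fun f hf => Or.inl (Or.inl (Or.inl hf)))
        (comp_mem_sp_code hJ₁ fun j => F j i)
    · exact sp_mono (fun f hf => Or.inl (Or.inl (Or.inr hf)))
        (comp_mem_sp_code hJ₂ fun j => if j = i then 1 else 0)
    · exact sp_mono (fun f hf => Or.inl (Or.inr hf)) (abs_sub_mem_sp_sides L t)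
  have hsum : ∀ x, ∑ i, act (u i) x = if L x = t then F (J₁ x) (J₂ x) else 0 := by
    intro x
    by_cases hL : L x = t
    · rw [if_pos hL, Finset.sum_eq_single ⟨J₂ x, hJ₂ x⟩]
      · simp only [act, u, hL]
        rw [relu_of_nonneg] <;> simp [(hF (J₁ x) (J₂ x)).1]
      · intro i _ hi
        have hi' : J₂ x ≠ i := fun h => hi (Fin.ext h.symm)
        simp only [act, u, hL, if_neg hi']
        apply relu_of_nonpos
        simp [(hF (J₁ x) i).2]
      · simp
    · rw [if_neg hL]
      refine Finset.sum_eq_zero fun i _ => relu_of_nonpos ?_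
      have := one_le_abs_sub_of_ne hL
      have h2 := (hF (J₁ x) i).2
      simp only [u]
      split_ifs <;> linarith
  have m1 := hc.mono_left (A' := M) (fun f hf => subset_sp (Or.inl (Or.inl hf)))
  have m2 : Net n 1 M (Set.range fun i => act (u i)) := of_family u (by simp) hu subset_sp
  have m3 : Net 1 1 M {fun x => (L x : ℝ)} := keep
    (sp_mono (fun f hf => Or.inl (Or.inr hf)) (cast_mem_sp_sides L t)) (fun x => by positivity) 1
  have m4 : Net 1 1 M {a} := keep (subset_sp (Or.inr rfl)) ha 1
  have e : a' = fun x => a x + ∑ i, act (u i) x := funext fun x => by rw [ha', hsum]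
  refine (((m1.union_same m2).union_same (m3.union_same m4)).mono_width (by omega)).mono_right
    (Set.union_subset ?_ ?_)
  · exact fun f hf => subset_sp (Or.inl (Or.inl hf))
  · rintro _ (rfl | rfl)
    · exact subset_sp (Or.inr (Or.inl rfl))
    · rw [e]
      exact add_mem_sp (subset_sp (Or.inr (Or.inr rfl)))
        (sum_mem_sp fun i _ => subset_sp (Or.inl (Or.inr ⟨i, rfl⟩)))

/-- One step of the extraction of a block of bits from a real number. -/
lemma decode_step {κ : ℝ} (hκ : 0 < κ) {y y' : X → ℝ} {b : X → ℕ}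
    (h : ∀ x, 2 * y x = b x + y' x) (hy : ∀ x, 0 ≤ y x) (h0 : ∀ x, 0 ≤ y' x)
    (h1 : ∀ x, y' x ≤ 1 - κ) (hb : ∀ x, b x < 2) (L : X → ℕ) (t : ℕ) (c : ℝ)
    {a a' : X → ℝ} (ha : ∀ x, 0 ≤ a x)
    (ha' : ∀ x, a' x = a x + c * if L x = t then (b x : ℝ) else 0) :
    Net 6 2 {y, (fun x => (L x : ℝ)), a} {y', (fun x => (L x : ℝ)), a'} := by
  set S : Set (X → ℝ) := {y, (fun x => (L x : ℝ)), a} with hS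
  have n1 : Net 3 1 S _ := (digit 2 hκ (by simpa using h) hy h0 h1 hb).mono_left
    (Set.singleton_subset_iff.2 (subset_sp (by simp [hS])))
  have n2 : Net 2 1 S _ := sides L t (subset_sp (by simp [hS]))
  have n3 : Net 1 1 S {a} := keep (subset_sp (by simp [hS])) ha 1
  refine ((n1.union_same n2).union_same n3).trans (k' := 1) ?_
  set M : Set (X → ℝ) := (({y'} ∪ Set.range (thermo 2 b)) ∪ ReluNet.sides L t) ∪ {a} with hM
  let u : X → ℝ := fun x => b x - |(L x : ℝ) - t|
  have hu : u ∈ sp M := sub_mem_sp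
    (sp_mono (fun f hf => Or.inl (Or.inl (Or.inr hf))) (cast_digit_mem_sp hb))
    (sp_mono (fun f hf => Or.inl (Or.inr hf)) (abs_sub_mem_sp_sides L t))
  have hact : ∀ x, act u x = if L x = t then (b x : ℝ) else 0 := by
    intro x
    split_ifs with hL
    · simp only [act, u, hL]
      rw [relu_of_nonneg] <;> simp
    · apply relu_of_nonpos
      have := one_le_abs_sub_of_ne hL
      have h2 : (b x : ℝ) ≤ 1 := by exact_mod_cast Nat.lt_succ_iff.1 (hb x)
      simp only [u]
      linarith
  have m1 : Net 1 1 M {y'} := keep (subset_sp (Or.inl (Or.inl (Or.inl rfl)))) h0 1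
  have m2 : Net 1 1 M {act u} := of_family (fun _ : Unit => u) (by simp) (fun _ => hu)
    (Set.singleton_subset_iff.2 (subset_sp ⟨(), rfl⟩))
  have m3 : Net 1 1 M {fun x => (L x : ℝ)} := keep
    (sp_mono (fun f hf => Or.inl (Or.inr hf)) (cast_mem_sp_sides L t)) (fun x => by positivity) 1
  have m4 : Net 1 1 M {a} := keep (subset_sp (Or.inr rfl)) ha 1
  have e : a' = fun x => a x + c * act u x := funext fun x => by rw [ha', hact]
  refine (((m1.union_same m2).union_same (m3.union_same m4)).mono_width (by omega)).mono_right ?_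
  rintro _ (rfl | rfl | rfl)
  · exact subset_sp (Or.inl (Or.inl rfl))
  · exact subset_sp (Or.inr (Or.inl rfl))
  · rw [e]
    exact add_mem_sp (subset_sp (Or.inr (Or.inr rfl)))
      (mul_mem_sp _ (subset_sp (Or.inl (Or.inr rfl))))

/-- One step of the long multiplication of `c` with the digits of `y`. -/
lemma mul_step {r : ℕ} {κ : ℝ} (hκ : 0 < κ) {y y' : X → ℝ} {dg : X → ℕ}
    (h : ∀ x, (r : ℝ) * y x = dg x + y' x) (hy : ∀ x, 0 ≤ y x) (h0 : ∀ x, 0 ≤ y' x)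
    (h1 : ∀ x, y' x ≤ 1 - κ) (hd : ∀ x, dg x < r) {c : X → ℝ}
    (hc : ∀ x, c x ∈ Set.Icc (0 : ℝ) 1) (q : ℝ) {a a' : X → ℝ} (ha : ∀ x, 0 ≤ a x)
    (ha' : ∀ x, a' x = a x + q * (c x * dg x)) :
    Net (2 * (r - 1) + 3) 2 {y, c, a} {y', c, a'} := by
  set S : Set (X → ℝ) := {y, c, a} with hS
  have hc0 : ∀ x, 0 ≤ c x := fun x => (hc x).1
  have n1 : Net _ 1 S _ := (digit r hκ h hy h0 h1 hd).mono_left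
    (Set.singleton_subset_iff.2 (subset_sp (by simp [hS])))
  have n2 : Net 1 1 S {c} := keep (subset_sp (by simp [hS])) hc0 1
  have n3 : Net 1 1 S {a} := keep (subset_sp (by simp [hS])) ha 1
  refine (((n1.union_same n2).union_same n3).mono_width (w' := 2 * (r - 1) + 3)
    (by omega)).trans (k' := 1) ?_
  set M : Set (X → ℝ) := (({y'} ∪ Set.range (thermo r dg)) ∪ {c}) ∪ {a} with hM
  let u : Fin (r - 1) → X → ℝ := fun i x => c x - (1 - thermo r dg i x)
  have hu : ∀ i, u i ∈ sp M := fun i => sub_mem_sp (subset_sp (Or.inl (Or.inr rfl)))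
    (sub_mem_sp (const_mem_sp 1) (subset_sp (Or.inl (Or.inl (Or.inr ⟨i, rfl⟩)))))
  have hact : ∀ x, ∑ i, act (u i) x = c x * dg x := by
    intro x
    rw [← sum_thermo (hd x), Finset.mul_sum]
    refine Finset.sum_congr rfl fun i _ => ?_
    simp only [act, u, thermo]
    split_ifs
    · rw [relu_of_nonneg] <;> simp [hc0 x]
    · rw [relu_of_nonpos] <;> simp [(hc x).2]
  have m1 : Net 1 1 M {y'} := keep (subset_sp (Or.inl (Or.inl (Or.inl rfl)))) h0 1
  have m2 : Net (r - 1) 1 M (Set.range fun i => act (u i)) := of_family u (by simp) hu subset_sp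
  have m3 : Net 1 1 M {c} := keep (subset_sp (Or.inl (Or.inr rfl))) hc0 1
  have m4 : Net 1 1 M {a} := keep (subset_sp (Or.inr rfl)) ha 1
  have e : a' = fun x => a x + q * ∑ i, act (u i) x := funext fun x => by rw [ha', hact]
  refine (((m1.union_same m2).union_same (m3.union_same m4)).mono_width (by omega)).mono_right ?_
  rintro _ (rfl | rfl | rfl)
  · exact subset_sp (Or.inl (Or.inl rfl))
  · exact subset_sp (Or.inr (Or.inl rfl))
  · rw [e]
    exact add_mem_sp (subset_sp (Or.inr (Or.inr rfl)))
      (mul_mem_sp _ (sum_mem_sp fun i _ => subset_sp (Or.inl (Or.inr ⟨i, rfl⟩))))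

end Net

end Selection

section Expansion

variable {X ι : Type}

/-- Simultaneous mixed radix expansions: `dg n j` is the `n`-th digit of the `j`-th function
and `y n j` the scaled remainder before this digit is extracted. -/
structure IsExpansion (N : ℕ) (r : ℕ → ℕ) (κ : ℝ) (y : ℕ → ι → X → ℝ) (dg : ℕ → ι → X → ℕ) :
    Prop where
  pos : 0 < κ
  step : ∀ n j x, (r n : ℝ) * y n j x = dg n j x + y (n + 1) j x
  nonneg : ∀ n j x, 0 ≤ y n j x
  le : ∀ n < N, ∀ j x, y (n + 1) j x ≤ 1 - κ
  lt : ∀ n j x, dg n j x < r n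

/-- The truncation to `D` digits of the `N`-th remainder. -/
noncomputable def trunc (r : ℕ → ℕ) (dg : ℕ → ι → X → ℕ) (N D : ℕ) (j : ι) (x : X) : ℝ :=
  ∑ t ∈ Finset.range D, (∏ i ∈ Finset.range (t + 1), (r (N + i) : ℝ))⁻¹ * dg (N + t) j x

namespace IsExpansion

variable {N : ℕ} {r : ℕ → ℕ} {κ : ℝ} {y : ℕ → ι → X → ℝ} {dg : ℕ → ι → X → ℕ}

lemma trunc_add (h : IsExpansion N r κ y dg) (n D : ℕ) (j : ι) (x : X) :
    trunc r dg n D j x + (∏ i ∈ Finset.range D, (r (n + i) : ℝ))⁻¹ * y (n + D) j x = y n j x := by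
  induction D with
  | zero => simp [trunc]
  | succ D ih =>
    rw [← ih, trunc, Finset.sum_range_succ, ← trunc, add_assoc, ← mul_add, ← add_assoc,
      ← h.step, Finset.prod_range_succ]
    have : (r (n + D) : ℝ) ≠ 0 := by exact_mod_cast ((h.lt (n + D) j x).pos).ne'
    rw [mul_inv, mul_assoc, inv_mul_cancel_left₀ this]

lemma trunc_nonneg (r : ℕ → ℕ) (dg : ℕ → ι → X → ℕ) (n D : ℕ) (j : ι) (x : X) :
    0 ≤ trunc r dg n D j x := Finset.sum_nonneg fun _ _ => by positivity

lemma trunc_le (h : IsExpansion N r κ y dg) (n D : ℕ) (j : ι) (x : X) :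
    trunc r dg n D j x ≤ y n j x := by
  rw [← h.trunc_add n D j x]
  have := h.nonneg (n + D) j x
  have : 0 ≤ (∏ i ∈ Finset.range D, (r (n + i) : ℝ))⁻¹ * y (n + D) j x := by positivity
  linarith

lemma trunc_mem (h : IsExpansion N r κ y dg) {n : ℕ} (hn : n < N) (D : ℕ) (j : ι) (x : X) :
    trunc r dg (n + 1) D j x ∈ Set.Icc (0 : ℝ) 1 :=
  ⟨trunc_nonneg r dg _ _ j x, (h.trunc_le _ _ j x).trans ((h.le n hn j x).trans
    (by linarith [h.pos]))⟩

variable [Fintype ι]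

/-- Linear statistics of the first `n` digits. -/
def stat {σ : Type} (dg : ℕ → ι → X → ℕ) (a : ℕ → σ → ι → ℕ) (n : ℕ) (s : σ) (x : X) : ℕ :=
  ∑ k ∈ Finset.range n, ∑ j, a k s j * dg k j x

lemma net_stat (h : IsExpansion N r κ y dg) {R : ℕ} (hR : ∀ n, r n ≤ R) {σ : Type} [Fintype σ]
    (a : ℕ → σ → ι → ℕ) {n : ℕ} (hn : n ≤ N) :
    Net (Fintype.card ι * (2 * (R - 1) + 1) + Fintype.card σ) n (Set.range (y 0))
      (Set.range (y n) ∪ Set.range fun s x => (stat dg a n s x : ℝ)) := by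
  have := Net.loop (k := 1) (w := Fintype.card ι * (2 * (R - 1) + 1) + Fintype.card σ)
    (fun n => Set.range (y n) ∪ Set.range fun s x => (stat dg a n s x : ℝ)) n ?_
  · rw [one_mul] at this
    refine this.mono_left (Set.union_subset subset_sp ?_)
    rintro _ ⟨s, rfl⟩
    simpa [stat] using const_mem_sp 0
  · intro t ht
    refine (Net.accumulate (r := r t) (σ := σ) h.pos (h.step t) (h.nonneg t) (h.nonneg (t + 1))
      (h.le t (by omega)) (h.lt t) (fun _ _ => by positivity) (fun s j => (a t s j : ℝ))
      ?_).mono_width ?_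
    · intro s x
      rw [stat, Finset.sum_range_succ, ← stat]
      push_cast
      rfl
    · have := hR t
      gcongr

/-- Multiplication with the truncation of a remainder. -/
lemma net_mul (h : IsExpansion N r κ y dg) {R : ℕ} (hR : ∀ n, r n ≤ R) {n D : ℕ}
    (hD : n + 1 + D ≤ N) (j : ι) {c : X → ℝ} (hc : ∀ x, c x ∈ Set.Icc (0 : ℝ) 1) :
    Net (Fintype.card ι + (2 * (R - 1) + 3)) (2 * D) (Set.range (y (n + 1)) ∪ {c})
      (Set.range (y (n + 1)) ∪ {fun x => c x * trunc r dg (n + 1) D j x}) := by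
  have key := Net.loop (k := 2) (w := Fintype.card ι + (2 * (R - 1) + 3))
    (fun t => Set.range (y (n + 1)) ∪
      {y (n + 1 + t) j, c, fun x => c x * trunc r dg (n + 1) t j x}) D ?_
  · refine (key.mono_left ?_).mono_right ?_
    · refine Set.union_subset (fun f hf => subset_sp (Or.inl hf)) ?_
      rintro _ (rfl | rfl | rfl)
      · exact subset_sp (Or.inl ⟨j, rfl⟩)
      · exact subset_sp (Or.inr rfl)
      · simpa [trunc] using const_mem_sp 0
    · exact (Set.union_subset_union_right _ (by simp)).trans subset_sp
  · intro t ht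
    refine ((Net.pass_range (y (n + 1)) (h.nonneg _) 2).union
      (Net.mul_step (r := r (n + 1 + t)) h.pos (h.step _ j) (h.nonneg _ j) (h.nonneg _ j)
        (h.le _ (by omega) j) (h.lt _ j) hc
        (∏ i ∈ Finset.range (t + 1), (r (n + 1 + i) : ℝ))⁻¹ ?_ ?_)).mono_width ?_
    · exact fun x => mul_nonneg (hc x).1 (trunc_nonneg r dg _ _ j x)
    · intro x
      rw [trunc, Finset.sum_range_succ, ← trunc]
      ring
    · have := hR (n + 1 + t)
      gcongr

lemma net_mul_list (h : IsExpansion N r κ y dg) {R : ℕ} (hR : ∀ n, r n ≤ R) {n D : ℕ}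
    (hn : n < N) (hD : n + 1 + D ≤ N) (js : List ι) {c : X → ℝ}
    (hc : ∀ x, c x ∈ Set.Icc (0 : ℝ) 1) :
    Net (Fintype.card ι + (2 * (R - 1) + 3)) (2 * D * js.length) (Set.range (y (n + 1)) ∪ {c})
      {fun x => c x * (js.map fun j => trunc r dg (n + 1) D j x).prod} := by
  induction js generalizing c with
  | nil =>
    refine .nil ?_
    rintro _ rfl
    simpa using subset_sp (A := Set.range (y (n + 1)) ∪ {c}) (Or.inr rfl)
  | cons j js ih =>
    rw [List.length_cons, mul_add, mul_one, add_comm (2 * D * _)]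
    have hm : ∀ x, c x * trunc r dg (n + 1) D j x ∈ Set.Icc (0 : ℝ) 1 := fun x =>
      unitInterval.mul_mem (hc x) (h.trunc_mem hn D j x)
    have := (h.net_mul hR hD j hc).trans (ih hm)
    have e : (fun x => c x * ((j :: js).map fun j => trunc r dg (n + 1) D j x).prod) =
        fun x => c x * trunc r dg (n + 1) D j x *
          (js.map fun j => trunc r dg (n + 1) D j x).prod := by
      ext x
      rw [List.map_cons, List.prod_cons, mul_assoc]
    rwa [e]

end IsExpansion

/-- Binary expansion with the bits `b n, …, b (N - 1)`. -/
noncomputable def binary (b : ℕ → ℕ) (N n : ℕ) : ℝ :=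
  ∑ i ∈ Finset.range (N - n), (2 : ℝ)⁻¹ ^ (i + 1) * b (n + i)

lemma binary_nonneg (b : ℕ → ℕ) (N n : ℕ) : 0 ≤ binary b N n :=
  Finset.sum_nonneg fun _ _ => by positivity

lemma two_mul_binary (b : ℕ → ℕ) {N n : ℕ} (h : n < N) :
    2 * binary b N n = b n + binary b N (n + 1) := by
  obtain ⟨k, hk⟩ : ∃ k, N - n = k + 1 := ⟨N - n - 1, by omega⟩
  have hk' : N - (n + 1) = k := by omega
  rw [binary, hk, Finset.sum_range_succ', binary, hk', mul_add, Finset.mul_sum, add_comm]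
  congr 1
  · simp
  · refine Finset.sum_congr rfl fun i _ => ?_
    rw [show n + (i + 1) = n + 1 + i by ring]
    ring

lemma binary_le (b : ℕ → ℕ) (hb : ∀ n, b n < 2) (N n : ℕ) :
    binary b N n ≤ 1 - (2 : ℝ)⁻¹ ^ N := by
  have h1 : ∀ k, ∑ i ∈ Finset.range k, (2 : ℝ)⁻¹ ^ (i + 1) * b (n + i) ≤ 1 - (2 : ℝ)⁻¹ ^ k := by
    intro k
    induction k with
    | zero => simp
    | succ k ih =>
      rw [Finset.sum_range_succ]
      have : (b (n + k) : ℝ) ≤ 1 := by exact_mod_cast Nat.lt_succ_iff.1 (hb _)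
      have h2 : (2 : ℝ)⁻¹ ^ (k + 1) * b (n + k) ≤ (2 : ℝ)⁻¹ ^ (k + 1) :=
        mul_le_of_le_one_right (by positivity) this
      have h3 : (2 : ℝ)⁻¹ ^ k = 2 * (2 : ℝ)⁻¹ ^ (k + 1) := by rw [pow_succ]; ring
      linarith
  refine (h1 _).trans (sub_le_sub_left ?_ _)
  exact pow_le_pow_of_le_one (by norm_num) (by norm_num) (by omega)

lemma sum_range_mul_ite (g : ℕ → ℕ → ℝ) (n q : ℕ) (hq : 0 < q) (l : ℕ) :
    ∑ t ∈ Finset.range (n * q), (if l = t / q then g (t / q) (t % q) else 0)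
      = if l < n then ∑ s ∈ Finset.range q, g l s else 0 := by
  induction n with
  | zero => simp
  | succ n ih =>
    rw [add_mul, one_mul, Finset.sum_range_add, ih]
    have : ∀ s ∈ Finset.range q, (if l = (n * q + s) / q then
        g ((n * q + s) / q) ((n * q + s) % q) else 0) = if l = n then g n s else 0 := by
      intro s hs
      have hs' := Finset.mem_range.1 hs
      rw [show (n * q + s) / q = n by
        rw [mul_comm, Nat.mul_add_div hq, Nat.div_eq_of_lt hs', add_zero],
        show (n * q + s) % q = s by rw [mul_comm, Nat.mul_add_mod, Nat.mod_eq_of_lt hs']]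
    rw [Finset.sum_congr rfl this]
    rcases lt_trichotomy l n with h | h | h
    · simp [h, h.ne, Nat.lt_succ_of_lt h]
    · simp [h]
    · simp [h.ne', Nat.not_lt.2 h.le, Nat.not_lt.2 (Nat.succ_le_of_lt h)]

namespace Net

variable {A : Set (X → ℝ)}

/-- Sequential table lookup with real valued entries. -/
lemma lookup {n : ℕ} (hn : 0 < n) {J₁ J₂ L : X → ℕ} (hJ₁ : ∀ x, J₁ x < n)
    (hJ₂ : ∀ x, J₂ x < n) (N : ℕ) (hL : ∀ x, L x < N) {F : ℕ → ℕ → ℕ → ℝ}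
    (hF : ∀ i j l, F i j l ∈ Set.Icc (0 : ℝ) 1) :
    Net (3 * n + 2) (2 * N)
      ((ReluNet.code J₁ n ∪ ReluNet.code J₂ n) ∪ {(fun x => (L x : ℝ))})
      {fun x => F (J₁ x) (J₂ x) (L x)} := by
  have key := Net.loop (k := 2) (w := 3 * n + 2)
    (fun t => (ReluNet.code J₁ n ∪ ReluNet.code J₂ n) ∪
      {(fun x => (L x : ℝ)), fun x => if L x < t then F (J₁ x) (J₂ x) (L x) else 0}) N ?_
  · refine (key.mono_left ?_).mono_right ?_
    · refine Set.union_subset (fun f hf => subset_sp (Or.inl hf)) ?_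
      rintro _ (rfl | rfl)
      · exact subset_sp (Or.inr rfl)
      · simpa using const_mem_sp 0
    · rintro _ rfl
      refine subset_sp (Or.inr (Or.inr ?_))
      ext x
      simp [hL x]
  · intro t _
    refine lookup_step hn hJ₁ hJ₂ t (fun i j => hF i j t) (fun x => ?_) (fun x => ?_)
    · split_ifs
      exacts [(hF _ _ _).1, le_rfl]
    · rcases lt_trichotomy (L x) t with h | h | h
      · simp [h, h.ne, Nat.lt_succ_of_lt h]
      · simp [h]
      · simp [h.ne', Nat.not_lt.2 h.le, Nat.not_lt.2 (Nat.succ_le_of_lt h)]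

/-- Extraction of the block with index `L` from a binary expansion with `n * q` bits. -/
lemma decode {b : X → ℕ → ℕ} (hb : ∀ x t, b x t < 2) (n q : ℕ) (hq : 0 < q) {L : X → ℕ}
    (hL : ∀ x, L x < n) :
    Net 6 (2 * (n * q)) {(fun x => binary (b x) (n * q) 0), fun x => (L x : ℝ)}
      {fun x => ∑ s ∈ Finset.range q, (2 : ℝ)⁻¹ ^ (s + 1) * b x (L x * q + s)} := by
  have hterm : ∀ x t, 0 ≤ (2 : ℝ)⁻¹ ^ (t % q + 1) * if L x = t / q then (b x t : ℝ) else 0 := by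
    intro x t; split_ifs <;> positivity
  have key := Net.loop (k := 2) (w := 6)
    (fun t => {(fun x => binary (b x) (n * q) t), (fun x => (L x : ℝ)),
      fun x => ∑ i ∈ Finset.range t,
        (2 : ℝ)⁻¹ ^ (i % q + 1) * if L x = i / q then (b x i : ℝ) else 0}) (n * q) ?_
  · refine (key.mono_left ?_).mono_right ?_
    · rintro _ (rfl | rfl | rfl)
      · exact subset_sp (by simp)
      · exact subset_sp (by simp)
      · simpa using const_mem_sp 0
    · rintro _ rfl
      refine subset_sp (Or.inr (Or.inr ?_))
      ext x
      have := sum_range_mul_ite (fun l s => (2 : ℝ)⁻¹ ^ (s + 1) * b x (l * q + s)) n q hq (L x)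
      rw [if_pos (hL x)] at this
      rw [← this]
      refine Finset.sum_congr rfl fun t _ => ?_
      rw [Nat.div_add_mod']
      split_ifs <;> simp
  · intro t ht
    refine decode_step (κ := (2 : ℝ)⁻¹ ^ (n * q)) (by positivity)
      (fun x => two_mul_binary (b x) ht) (fun x => binary_nonneg _ _ _)
      (fun x => binary_nonneg _ _ _) (fun x => binary_le _ (hb x) _ _) (fun x => hb x t) L (t / q)
      ((2 : ℝ)⁻¹ ^ (t % q + 1)) (fun x => Finset.sum_nonneg fun i _ => hterm x i) (fun x => ?_)
    rw [Finset.sum_range_succ]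

end Net

open IsExpansion in
/-- The building block: a table of `q`-bit numbers, addressed by the leading digits, times a
product of truncated remainders. -/
lemma IsExpansion.net_unit [Fintype ι] {N : ℕ} {r : ℕ → ℕ} {κ : ℝ} {y : ℕ → ι → X → ℝ}
    {dg : ℕ → ι → X → ℕ} (h : IsExpansion N r κ y dg) {R : ℕ} (hR : ∀ n, r n ≤ R) {m D : ℕ}
    (hm : m < N) (hD : m + 1 + D ≤ N) {n n₁ n₂ q : ℕ} (hn : 0 < n) (hq : 0 < q)
    (a : ℕ → Fin 4 → ι → ℕ) (ha₀ : ∀ x, stat dg a (m + 1) 0 x < n)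
    (ha₁ : ∀ x, stat dg a (m + 1) 1 x < n) (ha₂ : ∀ x, stat dg a (m + 1) 2 x < n₁)
    (ha₃ : ∀ x, stat dg a (m + 1) 3 x < n₂) (b : ℕ → ℕ → ℕ → ℕ → ℕ)
    (hb : ∀ i j k l, b i j k l < 2) (js : List ι) {k : ℕ} (hk : js.length ≤ k) {W : ℕ}
    (hW₁ : Fintype.card ι * (2 * (R - 1) + 1) + 4 ≤ W) (hW₂ : Fintype.card ι + 3 * n + 3 ≤ W)
    (hW₃ : Fintype.card ι + 6 ≤ W) (hW₄ : Fintype.card ι + (2 * (R - 1) + 3) ≤ W) :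
    Net W (m + 1 + 1 + 2 * n₁ + 2 * (n₂ * q) + 2 * D * k) (Set.range (y 0))
      {fun x => (∑ s ∈ Finset.range q, (2 : ℝ)⁻¹ ^ (s + 1) *
          b (stat dg a (m + 1) 0 x) (stat dg a (m + 1) 1 x) (stat dg a (m + 1) 2 x)
            (stat dg a (m + 1) 3 x * q + s)) *
        (js.map fun j => trunc r dg (m + 1) D j x).prod} := by
  set J₁ := stat dg a (m + 1) 0 with hJ₁
  set J₂ := stat dg a (m + 1) 1 with hJ₂
  set L₁ := stat dg a (m + 1) 2 with hL₁
  set L₂ := stat dg a (m + 1) 3 with hL₂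
  set Y := Set.range (y (m + 1)) with hY
  have pY : ∀ k, Net (Fintype.card ι) k Y Y := Net.pass_range _ (h.nonneg _)
  have pL : ∀ (L : X → ℕ) k, Net 1 k {fun x => (L x : ℝ)} {fun x => (L x : ℝ)} :=
    fun L k => Net.pass (fun x => by positivity) k
  have A₁ : Net W (m + 1) (Set.range (y 0)) (Y ∪ {(fun x => (J₁ x : ℝ)), (fun x => (J₂ x : ℝ)),
      (fun x => (L₁ x : ℝ)), (fun x => (L₂ x : ℝ))}) := by
    refine ((h.net_stat hR a (Nat.succ_le_of_lt hm)).mono_width (by simpa using hW₁)).mono_right ?_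
    refine Set.union_subset (fun f hf => subset_sp (Or.inl hf)) ?_
    rintro _ (rfl | rfl | rfl | rfl)
    exacts [subset_sp (Or.inr ⟨0, rfl⟩), subset_sp (Or.inr ⟨1, rfl⟩),
      subset_sp (Or.inr ⟨2, rfl⟩), subset_sp (Or.inr ⟨3, rfl⟩)]
  have A₂ : Net W 1 (Y ∪ {(fun x => (J₁ x : ℝ)), (fun x => (J₂ x : ℝ)),
      (fun x => (L₁ x : ℝ)), (fun x => (L₂ x : ℝ))})
      ((Y ∪ {fun x => (L₂ x : ℝ)}) ∪
        ((code J₁ n ∪ code J₂ n) ∪ {(fun x => (L₁ x : ℝ))})) := by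
    have c₁ := Net.code (J := J₁) n (A := {fun x => (J₁ x : ℝ)}) (subset_sp rfl)
    have c₂ := Net.code (J := J₂) n (A := {fun x => (J₂ x : ℝ)}) (subset_sp rfl)
    refine ((((pY 1).union (pL L₂ 1)).union ((c₁.union c₂).union (pL L₁ 1))).mono_width
      (by omega)).mono_left (subset_trans ?_ subset_sp)
    rintro f ((hf | rfl) | ((rfl | rfl) | rfl))
    exacts [Or.inl hf, Or.inr (by simp), Or.inr (by simp), Or.inr (by simp), Or.inr (by simp)]
  have A₃ := (((pY (2 * n₁)).union (pL L₂ _)).union (Net.lookup hn ha₀ ha₁ n₁ ha₂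
    (F := fun i j l => binary (b i j l) (n₂ * q) 0) fun i j l => ⟨binary_nonneg _ _ _,
      (binary_le _ (hb i j l) _ _).trans (by simp)⟩)).mono_width (w' := W) (by omega)
  have A₄ : Net W _ _ _ := (((pY (2 * (n₂ * q))).union (Net.decode
    (b := fun x => b (J₁ x) (J₂ x) (L₁ x)) (fun x t => hb _ _ _ t) n₂ q hq ha₃))).mono_width hW₃
  have A₅ : Net W _ _ _ := ((h.net_mul_list hR hm hD js (c := fun x => ∑ s ∈ Finset.range q,
    (2 : ℝ)⁻¹ ^ (s + 1) * b (J₁ x) (J₂ x) (L₁ x) (L₂ x * q + s)) ?_).mono_width hW₄)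
  · have A₆ := A₅.trans ((Net.pass (k := 2 * D * (k - js.length)) ?_).mono_width
      (w' := W) (by omega))
    · have A₇ := ((((A₁.trans A₂).trans A₃).trans_of_subset ?_ A₄).trans A₆)
      · rwa [← mul_add, Nat.add_sub_cancel' hk] at A₇
      · rintro f (hf | rfl | rfl)
        exacts [subset_sp (Or.inl (Or.inl hf)), subset_sp (Or.inr rfl),
          subset_sp (Or.inl (Or.inr rfl))]
    · intro x
      refine mul_nonneg (Finset.sum_nonneg fun _ _ => by positivity) (List.prod_nonneg ?_)
      intro v hv
      obtain ⟨j, -, rfl⟩ := List.mem_map.1 hv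
      exact trunc_nonneg r dg _ _ j x
  · intro x
    refine ⟨Finset.sum_nonneg fun _ _ => by positivity, ?_⟩
    have := binary_le (fun s => b (J₁ x) (J₂ x) (L₁ x) (L₂ x * q + s)) (fun s => hb _ _ _ _) q 0
    refine (le_trans (le_of_eq ?_) this).trans (by simp)
    rw [binary]
    simp

end Expansion

section Lookup

lemma sum_digits (B : ℕ) (hB : 0 < B) (q v : ℕ) (hv : v < B ^ q) :
    ∑ s ∈ Finset.range q, (B : ℝ)⁻¹ ^ (s + 1) * ((v / B ^ (q - 1 - s) % B : ℕ) : ℝ)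
      = v / (B : ℝ) ^ q := by
  induction q generalizing v with
  | zero => simp [Nat.lt_one_iff.1 (by simpa using hv : v < 1)]
  | succ q ih =>
    have hB' : (B : ℝ) ≠ 0 := by exact_mod_cast hB.ne'
    have h1 : v / B < B ^ q := Nat.div_lt_of_lt_mul (by rwa [pow_succ, mul_comm] at hv)
    have h2 : ∀ s ∈ Finset.range q, (B : ℝ)⁻¹ ^ (s + 1) * ((v / B ^ (q + 1 - 1 - s) % B : ℕ) : ℝ)
        = (B : ℝ)⁻¹ ^ (s + 1) * ((v / B / B ^ (q - 1 - s) % B : ℕ) : ℝ) := by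
      intro s hs
      have hs' := Finset.mem_range.1 hs
      rw [Nat.div_div_eq_div_mul, ← pow_succ', show q + 1 - 1 - s = q - 1 - s + 1 by omega]
    rw [Finset.sum_range_succ, Finset.sum_congr rfl h2, ih _ h1]
    have h3 : (v : ℝ) = B * (v / B : ℕ) + (v % B : ℕ) := by
      exact_mod_cast (Nat.div_add_mod v B).symm
    have h4 : q + 1 - 1 - q = 0 := by omega
    rw [h4, pow_zero, Nat.div_one, h3, inv_pow, pow_succ]
    field_simp

section Address

variable {X : Type}

/-- The leading `m + 2` digits of `p` expansions, two in base `R` and `m` in base two, are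
encoded by four linear statistics. -/
lemma exists_address (p R m h₁ h₂ : ℕ) (h : h₁ + h₂ = m * p) :
    ∃ a : ℕ → Fin 4 → Fin p → ℕ, ∀ dg : ℕ → Fin p → X → ℕ, (∀ j x, dg 0 j x < R) →
      (∀ j x, dg 1 j x < R) → (∀ t < m, ∀ j x, dg (t + 2) j x < 2) →
      (∀ x, IsExpansion.stat dg a (m + 2) 0 x < R ^ p) ∧
      (∀ x, IsExpansion.stat dg a (m + 2) 1 x < R ^ p) ∧
      (∀ x, IsExpansion.stat dg a (m + 2) 2 x < 2 ^ h₁) ∧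
      (∀ x, IsExpansion.stat dg a (m + 2) 3 x < 2 ^ h₂) ∧
      ∀ x x', (∀ s, IsExpansion.stat dg a (m + 2) s x = IsExpansion.stat dg a (m + 2) s x') →
        ∀ t < m + 2, ∀ j, dg t j x = dg t j x' := by
  have hcard : Fintype.card (Fin m × Fin p) = Fintype.card (Fin h₁ ⊕ Fin h₂) := by simp [h]
  let E : Fin m × Fin p ≃ Fin h₁ ⊕ Fin h₂ := Fintype.equivOfCardEq hcard
  let wt : Fin 4 → Fin h₁ ⊕ Fin h₂ → ℕ := fun s e =>
    if s = 2 then Sum.elim (fun i : Fin h₁ => 2 ^ (i : ℕ)) (fun _ => 0) e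
    else if s = 3 then Sum.elim (fun _ => 0) (fun i : Fin h₂ => 2 ^ (i : ℕ)) e else 0
  let a : ℕ → Fin 4 → Fin p → ℕ := fun t s j =>
    if t = 0 then if s = 0 then R ^ (j : ℕ) else 0
    else if t = 1 then if s = 1 then R ^ (j : ℕ) else 0
    else if ht : t - 2 < m then wt s (E (⟨t - 2, ht⟩, j)) else 0
  refine ⟨a, fun dg h0 h1 h2 => ?_⟩
  let u₀ : X → Fin p → Fin R := fun x j => ⟨dg 0 j x, h0 j x⟩
  let u₁ : X → Fin p → Fin R := fun x j => ⟨dg 1 j x, h1 j x⟩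
  let v : X → Fin h₁ ⊕ Fin h₂ → Fin 2 := fun x e =>
    ⟨dg ((E.symm e).1 + 2) (E.symm e).2 x, h2 _ (E.symm e).1.2 _ _⟩
  have hbase : ∀ x s, IsExpansion.stat dg a (m + 2) s x =
      (∑ e, wt s e * (v x e : ℕ)) + (∑ j, a 1 s j * dg 1 j x) + ∑ j, a 0 s j * dg 0 j x := by
    intro x s
    rw [IsExpansion.stat, Finset.sum_range_succ', Finset.sum_range_succ']
    congr 2
    rw [Finset.sum_range (fun k => ∑ j, a (k + 1 + 1) s j * dg (k + 1 + 1) j x),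
      ← Fintype.sum_prod_type', ← E.sum_comp]
    refine Finset.sum_congr rfl fun ij _ => ?_
    simp [a, v]
  have hfin : ∀ {B n : ℕ} (f : Fin n → Fin B),
      (finFunctionFinEquiv f : ℕ) = ∑ i : Fin n, B ^ (i : ℕ) * (f i : ℕ) := fun f => by
    rw [finFunctionFinEquiv_apply]
    exact Finset.sum_congr rfl fun i _ => mul_comm _ _
  have e0 : ∀ x, IsExpansion.stat dg a (m + 2) 0 x = finFunctionFinEquiv (u₀ x) := by
    intro x
    rw [hbase, hfin]
    simp [wt, a, u₀]
  have e1 : ∀ x, IsExpansion.stat dg a (m + 2) 1 x = finFunctionFinEquiv (u₁ x) := by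
    intro x
    rw [hbase, hfin]
    simp [wt, a, u₁]
  have e2 : ∀ x, IsExpansion.stat dg a (m + 2) 2 x =
      finFunctionFinEquiv (fun i => v x (Sum.inl i)) := by
    intro x
    rw [hbase, hfin]
    simp [wt, a]
  have e3 : ∀ x, IsExpansion.stat dg a (m + 2) 3 x =
      finFunctionFinEquiv (fun i => v x (Sum.inr i)) := by
    intro x
    rw [hbase, hfin]
    simp [wt, a]
  refine ⟨fun x => by rw [e0]; exact Fin.is_lt _, fun x => by rw [e1]; exact Fin.is_lt _,
    fun x => by rw [e2]; exact Fin.is_lt _, fun x => by rw [e3]; exact Fin.is_lt _, ?_⟩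
  intro x x' hs t ht j
  have i0 := hs 0
  have i1 := hs 1
  have i2 := hs 2
  have i3 := hs 3
  rw [e0, e0, Fin.val_inj, finFunctionFinEquiv.injective.eq_iff] at i0
  rw [e1, e1, Fin.val_inj, finFunctionFinEquiv.injective.eq_iff] at i1
  rw [e2, e2, Fin.val_inj, finFunctionFinEquiv.injective.eq_iff] at i2
  rw [e3, e3, Fin.val_inj, finFunctionFinEquiv.injective.eq_iff] at i3
  rcases t with _ | _ | t
  · exact congrArg Fin.val (congrFun i0 j)
  · exact congrArg Fin.val (congrFun i1 j)
  · have hv : v x = v x' := by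
      ext e
      rcases e with e | e
      · exact congrArg Fin.val (congrFun i2 e)
      · exact congrArg Fin.val (congrFun i3 e)
    have := congrArg Fin.val (congrFun hv (E (⟨t, by omega⟩, j)))
    simpa [v] using this

end Address

section Radix

/-- Periodic radices: two digits in base `R` are followed by `m` digits in base two. -/
def radix (R m n : ℕ) : ℕ := if n % (m + 2) < 2 then R else 2

variable {R m : ℕ}

lemma radix_pos (hR : 0 < R) (n : ℕ) : 0 < radix R m n := by
  unfold radix; split_ifs <;> omega

lemma radix_le (n : ℕ) : radix R m n ≤ max R 2 := by
  unfold radix; split_ifs <;> simp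

lemma prod_radix_period (n : ℕ) :
    ∏ i ∈ Finset.range (m + 2), radix R m (n * (m + 2) + i) = R ^ 2 * 2 ^ m := by
  have h : ∀ i < m + 2, radix R m (n * (m + 2) + i) = if i < 2 then R else 2 := by
    intro i hi
    rw [radix, mul_comm, Nat.mul_add_mod, Nat.mod_eq_of_lt hi]
  rw [Finset.prod_congr rfl fun i hi => h i (Finset.mem_range.1 hi), Finset.prod_range_succ',
    Finset.prod_range_succ']
  simp
  ring

lemma prod_radix (n k : ℕ) :
    ∏ i ∈ Finset.range (k * (m + 2)), radix R m (n * (m + 2) + i) = (R ^ 2 * 2 ^ m) ^ k := by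
  induction k with
  | zero => simp
  | succ k ih =>
    rw [add_mul, one_mul, Finset.prod_range_add, ih, pow_succ (_ * _)]
    congr 1
    rw [← prod_radix_period (n + k)]
    refine Finset.prod_congr rfl fun i _ => ?_
    congr 1
    ring

/-- The scaled remainder of `x` after `n` digits. -/
noncomputable def rem (r : ℕ → ℕ) (n : ℕ) (x : ℝ) : ℝ :=
  Int.fract ((∏ i ∈ Finset.range n, r i : ℕ) * x)

/-- The `n`-th digit of `x`. -/
noncomputable def dig (r : ℕ → ℕ) (n : ℕ) (x : ℝ) : ℕ := ⌊(r n : ℝ) * rem r n x⌋₊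

lemma rem_step (r : ℕ → ℕ) (n : ℕ) (x : ℝ) :
    (r n : ℝ) * rem r n x = dig r n x + rem r (n + 1) x := by
  have h0 : 0 ≤ (r n : ℝ) * rem r n x := mul_nonneg (by positivity) (Int.fract_nonneg _)
  have h1 : rem r (n + 1) x = Int.fract ((r n : ℝ) * rem r n x) := by
    rw [rem, rem, Finset.prod_range_succ, Int.fract_eq_fract]
    refine ⟨r n * ⌊((∏ i ∈ Finset.range n, r i : ℕ) : ℝ) * x⌋, ?_⟩
    have := Int.floor_add_fract (((∏ i ∈ Finset.range n, r i : ℕ) : ℝ) * x)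
    rw [Int.fract]
    push_cast
    ring
  rw [h1, dig, natCast_floor_eq_intCast_floor h0, Int.floor_add_fract]

lemma dig_lt {r : ℕ → ℕ} {n : ℕ} (h : 0 < r n) (x : ℝ) : dig r n x < r n := by
  have h0 : 0 ≤ (r n : ℝ) * rem r n x := mul_nonneg (by positivity) (Int.fract_nonneg _)
  rw [dig, Nat.floor_lt h0]
  have : (0 : ℝ) < r n := by exact_mod_cast h
  exact mul_lt_of_lt_one_right this (Int.fract_lt_one _)

lemma le_of_fract_mul_le {z κ M : ℝ} {Q : ℕ} (hκ : 0 < κ) (h1 : z < 1) (hQ : (Q : ℝ) ≤ M)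
    (hM : M * κ ≤ 1) (hQ0 : 0 < Q) (h : Int.fract (Q * z) ≤ 1 - M * κ) : z ≤ 1 - κ := by
  by_contra! hz
  have hQ' : (0 : ℝ) < Q := by exact_mod_cast hQ0
  have h2 : (Q : ℝ) * z < Q := mul_lt_of_lt_one_right hQ' h1
  have h3 : (Q : ℝ) * (1 - κ) < Q * z := mul_lt_mul_of_pos_left hz hQ'
  have h4 : (Q : ℝ) * κ ≤ M * κ := mul_le_mul_of_nonneg_right hQ hκ.le
  have h5 : ⌊(Q : ℝ) * z⌋ = Q - 1 := by
    rw [Int.floor_eq_iff]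
    push_cast
    constructor <;> linarith
  rw [Int.fract, h5] at h
  push_cast at h
  linarith

lemma rem_le {r : ℕ → ℕ} (hr : ∀ n, 0 < r n) {κ : ℝ} (hκ : 0 < κ) {N : ℕ}
    (hM : (∏ i ∈ Finset.range N, r i : ℕ) * κ ≤ 1) {x : ℝ}
    (hx : Int.fract ((∏ i ∈ Finset.range N, r i : ℕ) * x) ≤
      1 - (∏ i ∈ Finset.range N, r i : ℕ) * κ) {n : ℕ} (hn : n ≤ N) : rem r n x ≤ 1 - κ := by
  obtain ⟨k, rfl⟩ := Nat.exists_eq_add_of_le hn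
  have hpos : ∀ s : Finset ℕ, ∀ f : ℕ → ℕ, 0 < ∏ i ∈ s, r (f i) := fun s f =>
    Finset.prod_pos fun i _ => hr _
  rw [Finset.prod_range_add] at hM hx
  refine le_of_fract_mul_le (Q := ∏ i ∈ Finset.range k, r (n + i)) hκ (Int.fract_lt_one _) ?_ hM
    (hpos _ _) ?_
  · exact_mod_cast Nat.le_mul_of_pos_left _ (hpos _ id)
  · refine le_trans (le_of_eq ?_) hx
    rw [Int.fract_eq_fract]
    refine ⟨-(∏ i ∈ Finset.range k, r (n + i) : ℕ) *
      ⌊((∏ i ∈ Finset.range n, r i : ℕ) : ℝ) * x⌋, ?_⟩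
    rw [rem, Int.fract]
    push_cast
    ring

end Radix

end Lookup

section Unit

lemma exists_quantization {B : ℕ} (hB : 0 < B) {c : ℝ} (hc : |c| ≤ 1) :
    ∃ Z < B, |2 * (Z / (B : ℝ)) - 1 - c| ≤ 2 / B := by
  obtain ⟨h1, h2⟩ := abs_le.1 hc
  have hB' : (0 : ℝ) < B := by exact_mod_cast hB
  have h0 : 0 ≤ (c + 1) / 2 * B := by
    have : 0 ≤ c + 1 := by linarith
    positivity
  have key : ∀ Z : ℕ, |(Z : ℝ) - (c + 1) / 2 * B| ≤ 1 → |2 * (Z / (B : ℝ)) - 1 - c| ≤ 2 / B := by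
    intro Z hZ
    have : 2 * (Z / (B : ℝ)) - 1 - c = (2 / B) * (Z - (c + 1) / 2 * B) := by
      field_simp
      ring
    rw [this, abs_mul, abs_of_pos (by positivity : (0 : ℝ) < 2 / B)]
    exact mul_le_of_le_one_right (by positivity) hZ
  by_cases h : ⌊(c + 1) / 2 * B⌋₊ < B
  · refine ⟨_, h, key _ ?_⟩
    have h3 := Nat.floor_le h0
    have h4 := Nat.lt_floor_add_one ((c + 1) / 2 * B)
    rw [abs_le]
    constructor <;> linarith
  · refine ⟨B - 1, by omega, key _ ?_⟩
    have h3 : (B : ℝ) ≤ (c + 1) / 2 * B :=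
      (Nat.cast_le.2 (not_lt.1 h)).trans (Nat.floor_le h0)
    have h4 : (c + 1) / 2 * B ≤ 1 * B := mul_le_mul_of_nonneg_right (by linarith) hB'.le
    rw [Nat.cast_sub (by omega : 1 ≤ B), abs_le]
    push_cast
    constructor <;> linarith

/-- Points whose coordinates stay away from the left sides of the grid of mesh `1 / M`. -/
def good (p M : ℕ) (κ : ℝ) : Set (Fin p → ℝ) :=
  {x | ∀ j, x j ∈ Set.Ico (0 : ℝ) 1 ∧ Int.fract ((M : ℝ) * x j) ≤ 1 - M * κ}

/-- Depth of the building block. -/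
def unitDepth (m β h₁ h₂ : ℕ) : ℕ :=
  m + 3 + 2 * 2 ^ h₁ + 2 * (2 ^ h₂ * (β * (m + 1))) + 2 * ((β - 1) * (m + 2)) * (β - 1)

variable {p R m β : ℕ}

/-- The `n`-th remainder of a coordinate. -/
noncomputable abbrev coordRem (s : Set (Fin p → ℝ)) (R m n : ℕ) (j : Fin p) (x : s) : ℝ :=
  rem (radix R m) n (x.1 j)

/-- The `n`-th digit of a coordinate. -/
noncomputable abbrev coordDig (s : Set (Fin p → ℝ)) (R m n : ℕ) (j : Fin p) (x : s) : ℕ :=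
  dig (radix R m) n (x.1 j)

lemma isExpansion_good (hR : 0 < R) {κ : ℝ} (hκ : 0 < κ)
    (hM : ((R ^ 2 * 2 ^ m) ^ β : ℕ) * κ ≤ 1) :
    IsExpansion (β * (m + 2)) (radix R m) κ (X := good p ((R ^ 2 * 2 ^ m) ^ β) κ)
      (coordRem _ R m) (coordDig _ R m) := by
  have hN : ∏ i ∈ Finset.range (β * (m + 2)), radix R m i = (R ^ 2 * 2 ^ m) ^ β := by
    simpa using prod_radix (R := R) (m := m) 0 β
  refine ⟨hκ, fun n j x => rem_step _ n _, fun n j x => Int.fract_nonneg _, fun n hn j x => ?_,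
    fun n j x => dig_lt (radix_pos hR n) _⟩
  exact rem_le (radix_pos hR) hκ (by rwa [hN]) (by rw [hN]; exact (x.2 j).2) hn

/-- The grid point of mesh `1 / K`, `K = R² 2^m`, below `x`. -/
noncomputable abbrev corner (R m : ℕ) {s : Set (Fin p → ℝ)} (x : s) (j : Fin p) : ℝ :=
  trunc (radix R m) (coordDig s R m) 0 (m + 2) j x

/-- The next `D` digits of `x`. -/
noncomputable abbrev tail (R m D : ℕ) {s : Set (Fin p → ℝ)} (x : s) (j : Fin p) : ℝ :=
  trunc (radix R m) (coordDig s R m) (m + 2) D j x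

variable {h₁ h₂ W : ℕ}

/-- Width bound for the building block. -/
def WidthBound (p R W : ℕ) : Prop :=
  p * (2 * (max R 2 - 1) + 1) + 4 ≤ W ∧ p + 3 * R ^ p + 3 ≤ W ∧ p + 6 ≤ W

lemma net_table (hp : 0 < p) (hR : 0 < R) (hβ : 0 < β) {κ : ℝ} (hκ : 0 < κ)
    (hM : ((R ^ 2 * 2 ^ m) ^ β : ℕ) * κ ≤ 1) (hh : h₁ + h₂ = m * p) (hW : WidthBound p R W)
    (v : (Fin p → ℝ) → ℕ) (hv : ∀ θ, v θ < 2 ^ (β * (m + 1))) (js : List (Fin p))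
    (hjs : js.length < β) :
    Net W (unitDepth m β h₁ h₂)
      (Set.range fun (j : Fin p) (x : good p ((R ^ 2 * 2 ^ m) ^ β) κ) => x.1 j)
      {fun x => (v (corner R m x) : ℝ) / 2 ^ (β * (m + 1)) *
        (js.map (tail R m ((β - 1) * (m + 2)) x)).prod} := by
  classical
  obtain ⟨hW₁, hW₂, hW₃⟩ := hW
  have hE := isExpansion_good (p := p) hR hκ hM
  set X := good p ((R ^ 2 * 2 ^ m) ^ β) κ
  obtain ⟨a, ha⟩ := exists_address (X := X) p R m h₁ h₂ hh
  have hr : ∀ t, t < 2 → radix R m t = R := by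
    intro t ht
    rw [radix, Nat.mod_eq_of_lt (by omega), if_pos ht]
  have hr2 : ∀ t < m, radix R m (t + 2) = 2 := by
    intro t ht
    rw [radix, Nat.mod_eq_of_lt (by omega), if_neg (by omega)]
  obtain ⟨ha₀, ha₁, ha₂, ha₃, hinj⟩ := ha (coordDig X R m)
    (fun j x => (hE.lt 0 j x).trans_eq (hr 0 (by omega)))
    (fun j x => (hE.lt 1 j x).trans_eq (hr 1 (by omega)))
    (fun t ht j x => (hE.lt (t + 2) j x).trans_eq (hr2 t ht))
  set st := IsExpansion.stat (X := X) (coordDig X R m) a (m + 2) with hst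
  let V : ℕ → ℕ → ℕ → ℕ → ℕ := fun i j k l =>
    if h : ∃ x : X, st 0 x = i ∧ st 1 x = j ∧ st 2 x = k ∧ st 3 x = l then
      v (corner R m h.choose) else 0
  have hV : ∀ x : X, V (st 0 x) (st 1 x) (st 2 x) (st 3 x) = v (corner R m x) := by
    intro x
    have h : ∃ x' : X, st 0 x' = st 0 x ∧ st 1 x' = st 1 x ∧ st 2 x' = st 2 x ∧
        st 3 x' = st 3 x := ⟨x, rfl, rfl, rfl, rfl⟩
    simp only [V]
    rw [dif_pos h]
    have hs := h.choose_spec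
    congr 1
    ext j
    have := hinj h.choose x (by
      intro s
      fin_cases s
      exacts [hs.1, hs.2.1, hs.2.2.1, hs.2.2.2])
    refine Finset.sum_congr rfl fun t ht => ?_
    rw [zero_add, this t (Finset.mem_range.1 ht) j]
  have hVlt : ∀ i j k l, V i j k l < 2 ^ (β * (m + 1)) := by
    intro i j k l
    simp only [V]
    split_ifs
    exacts [hv _, by positivity]
  set q := β * (m + 1) with hq
  have hq0 : 0 < q := by positivity
  have hβ' : m + 1 + 1 + (β - 1) * (m + 2) ≤ β * (m + 2) := by
    obtain ⟨b, rfl⟩ := Nat.exists_eq_add_of_lt hβ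
    simp only [zero_add, Nat.add_sub_cancel]
    linarith
  have := hE.net_unit (radix_le (R := R) (m := m)) (m := m + 1) (D := (β - 1) * (m + 2))
    (by omega) hβ' (n := R ^ p) (n₁ := 2 ^ h₁) (n₂ := 2 ^ h₂) (q := q)
    (by positivity) hq0 a ha₀ ha₁ ha₂ ha₃
    (fun i j k t => V i j k (t / q) / 2 ^ (q - 1 - t % q) % 2) (fun _ _ _ _ => Nat.mod_lt _ two_pos)
    js (k := β - 1) (by omega) (W := W) (by simpa using hW₁) (by simpa using hW₂)
    (by simpa using hW₃) (by
      rw [Fintype.card_fin]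
      have : 2 ≤ max R 2 := le_max_right _ _
      have := Nat.le_mul_of_pos_left (2 * (max R 2 - 1)) hp
      rw [mul_add, mul_one] at hW₁
      omega)
  have e0 : (coordRem X R m 0 : Fin p → X → ℝ) = fun j x => x.1 j := by
    ext j x
    simp only [coordRem, rem, Finset.range_zero, Finset.prod_empty, Nat.cast_one, one_mul]
    exact Int.fract_eq_self.2 (x.2 j).1
  have e1 : (fun x : X => (v (corner R m x) : ℝ) / 2 ^ q *
        (js.map (tail R m ((β - 1) * (m + 2)) x)).prod) = fun x =>
      (∑ s ∈ Finset.range q, (2 : ℝ)⁻¹ ^ (s + 1) *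
          ((V (st 0 x) (st 1 x) (st 2 x) ((st 3 x * q + s) / q) /
            2 ^ (q - 1 - (st 3 x * q + s) % q) % 2 : ℕ) : ℝ)) *
        (js.map fun j =>
          trunc (radix R m) (coordDig X R m) (m + 1 + 1) ((β - 1) * (m + 2)) j x).prod := by
    ext x
    congr 1
    have h := sum_digits 2 two_pos q (v (corner R m x)) (hv _)
    rw [Nat.cast_ofNat] at h
    rw [← h]
    refine Finset.sum_congr rfl fun s hs => ?_
    have hs' := Finset.mem_range.1 hs
    rw [show (st 3 x * q + s) / q = st 3 x by
        rw [mul_comm, Nat.mul_add_div hq0, Nat.div_eq_of_lt hs', add_zero],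
      show (st 3 x * q + s) % q = s by rw [mul_comm, Nat.mul_add_mod, Nat.mod_eq_of_lt hs'], hV]
  rw [e0] at this
  rw [e1]
  exact this


lemma corner_bounds (hR : 0 < R) (hβ : 0 < β) {κ : ℝ} (hκ : 0 < κ)
    (hM : ((R ^ 2 * 2 ^ m) ^ β : ℕ) * κ ≤ 1) (x : good p ((R ^ 2 * 2 ^ m) ^ β) κ) (j : Fin p) :
    0 ≤ corner R m x j ∧ 0 ≤ tail R m ((β - 1) * (m + 2)) x j ∧
      tail R m ((β - 1) * (m + 2)) x j ≤ 1 ∧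
      corner R m x j + (R ^ 2 * 2 ^ m : ℝ)⁻¹ * tail R m ((β - 1) * (m + 2)) x j ≤ x.1 j ∧
      x.1 j ≤ corner R m x j + (R ^ 2 * 2 ^ m : ℝ)⁻¹ * tail R m ((β - 1) * (m + 2)) x j +
        ((R ^ 2 * 2 ^ m : ℝ) ^ β)⁻¹ := by
  have hE := isExpansion_good (p := p) hR hκ hM
  have h1 := hE.trunc_add 0 (m + 2) j x
  have h2 := hE.trunc_add (m + 2) ((β - 1) * (m + 2)) j x
  have p1 : ∏ i ∈ Finset.range (m + 2), (radix R m (0 + i) : ℝ) = R ^ 2 * 2 ^ m := by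
    have := prod_radix_period (R := R) (m := m) 0
    rw [zero_mul] at this
    exact_mod_cast this
  have p2 : ∏ i ∈ Finset.range ((β - 1) * (m + 2)), (radix R m (m + 2 + i) : ℝ) =
      (R ^ 2 * 2 ^ m) ^ (β - 1) := by
    have := prod_radix (R := R) (m := m) 1 (β - 1)
    rw [one_mul] at this
    exact_mod_cast this
  rw [p1] at h1
  rw [p2] at h2
  have e0 : coordRem (good p ((R ^ 2 * 2 ^ m) ^ β) κ) R m 0 j x = x.1 j := by
    simp only [coordRem, rem, Finset.range_zero, Finset.prod_empty, Nat.cast_one, one_mul]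
    exact Int.fract_eq_self.2 (x.2 j).1
  have e1 : (0 : ℝ) ≤ coordRem (good p ((R ^ 2 * 2 ^ m) ^ β) κ) R m
    (m + 2 + (β - 1) * (m + 2)) j x := Int.fract_nonneg _
  have e2 : coordRem (good p ((R ^ 2 * 2 ^ m) ^ β) κ) R m
    (m + 2 + (β - 1) * (m + 2)) j x ≤ 1 := (Int.fract_lt_one _).le
  have e3 : coordRem (good p ((R ^ 2 * 2 ^ m) ^ β) κ) R m (m + 2) j x ≤ 1 :=
    (Int.fract_lt_one _).le
  have hK : (0 : ℝ) < R ^ 2 * 2 ^ m := by positivity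
  have hKβ : ((R ^ 2 * 2 ^ m : ℝ) ^ β)⁻¹ =
      (R ^ 2 * 2 ^ m : ℝ)⁻¹ * ((R ^ 2 * 2 ^ m : ℝ) ^ (β - 1))⁻¹ := by
    rw [← mul_inv, ← pow_succ', Nat.sub_add_cancel hβ]
  rw [e0, zero_add, ← h2] at h1
  have e4 : (0 : ℝ) ≤ (R ^ 2 * 2 ^ m : ℝ)⁻¹ * ((R ^ 2 * 2 ^ m : ℝ) ^ (β - 1))⁻¹ := by positivity
  refine ⟨IsExpansion.trunc_nonneg _ _ _ _ _ _, IsExpansion.trunc_nonneg _ _ _ _ _ _,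
    (hE.trunc_le _ _ j x).trans e3, ?_, ?_⟩
  · rw [← h1]
    have := mul_nonneg e4 e1
    simp only [corner, tail]
    linarith
  · rw [hKβ, ← h1]
    have := mul_le_mul_of_nonneg_left e2 e4
    simp only [corner, tail]
    linarith

/-- A network that evaluates a table of polynomials at a grid approximation of a good point. -/
lemma exists_poly_net (hp : 0 < p) (hR : 0 < R) (hβ : 0 < β) {κ : ℝ} (hκ : 0 < κ)
    (hM : ((R ^ 2 * 2 ^ m) ^ β : ℕ) * κ ≤ 1) (hh : h₁ + h₂ = m * p) (hW : WidthBound p R W)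
    (G : ℕ) {I : Type} [Fintype I] (js : I → List (Fin p)) (hjs : ∀ i, (js i).length < β)
    (c : I → (Fin p → ℝ) → ℝ) (hc : ∀ i θ, |c i θ| ≤ 1) :
    ∃ φ : (Fin p → ℝ) → ℝ, Net (Fintype.card I * ((G + 1) * W)) (unitDepth m β h₁ h₂)
      (Set.range fun (j : Fin p) (x : Fin p → ℝ) => x j) {φ} ∧
      ∀ x ∈ good p ((R ^ 2 * 2 ^ m) ^ β) κ, ∃ θ h : Fin p → ℝ,
        (∀ j, 0 ≤ θ j) ∧ (∀ j, 0 ≤ h j) ∧ (∀ j, h j ≤ (R ^ 2 * 2 ^ m : ℝ)⁻¹) ∧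
        (∀ j, θ j + h j ≤ x j) ∧ (∀ j, x j ≤ θ j + h j + ((R ^ 2 * 2 ^ m : ℝ) ^ β)⁻¹) ∧
        |φ x - ∑ i, c i θ * ((js i).map h).prod| ≤
          Fintype.card I * (2 / 2 ^ (G * (β * (m + 1)))) := by
  classical
  set q := β * (m + 1) with hq
  have hq0 : 0 < q := by positivity
  set X := good p ((R ^ 2 * 2 ^ m) ^ β) κ with hX
  set K : ℝ := R ^ 2 * 2 ^ m with hK
  have hK1 : 1 ≤ K := by
    rw [hK]
    exact_mod_cast Nat.succ_le_of_lt (by positivity : 0 < R ^ 2 * 2 ^ m)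
  have hZ : ∀ i θ, ∃ Z : ℕ, Z < (2 ^ q) ^ G ∧
      |2 * ((Z : ℝ) / (((2 ^ q) ^ G : ℕ) : ℝ)) - 1 - c i θ| ≤
      2 / ((2 ^ q) ^ G : ℕ) := fun i θ => exists_quantization (by positivity) (hc i θ)
  choose Z hZlt hZc using hZ
  let v : I → ℕ → (Fin p → ℝ) → ℕ := fun i g θ =>
    if g = 0 then 2 ^ (q - 1) else Z i θ / (2 ^ q) ^ (G - g) % 2 ^ q
  have hv : ∀ i g θ, v i g θ < 2 ^ q := by
    intro i g θ
    simp only [v]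
    split_ifs
    · exact Nat.pow_lt_pow_right one_lt_two (by omega)
    · exact Nat.mod_lt _ (by positivity)
  let P : I → X → ℝ := fun i x => ((js i).map (tail R m ((β - 1) * (m + 2)) x)).prod
  let co : ℕ → ℝ := fun g => if g = 0 then -2 else 2 * ((2 : ℝ) ^ q)⁻¹ ^ (g - 1)
  have n1 : ∀ i g, Net W (unitDepth m β h₁ h₂) (Set.range fun (j : Fin p) (x : X) => x.1 j)
      {fun x => (v i g (corner R m x) : ℝ) / 2 ^ q * P i x} := fun i g =>
    net_table hp hR hβ hκ hM hh hW (v i g) (hv i g) (js i) (hjs i)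
  have n2 : ∀ i, Net ((G + 1) * W) (unitDepth m β h₁ h₂)
      (Set.range fun (j : Fin p) (x : X) => x.1 j)
      {fun x => (2 * ((Z i (corner R m x) : ℝ) / (((2 ^ q) ^ G : ℕ) : ℝ)) - 1) * P i x} := by
    intro i
    have := Net.sum_mem (Finset.range (G + 1)) co fun g _ => n1 i g
    rw [Finset.card_range] at this
    convert this using 2
    ext x
    rw [Finset.sum_range_succ']
    have h1 : co 0 * ((v i 0 (corner R m x) : ℝ) / 2 ^ q * P i x) = - P i x := by
      simp only [co, v, if_true]
      rw [show q = q - 1 + 1 by omega, pow_succ]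
      push_cast
      field_simp
    have h2 := sum_digits (2 ^ q) (by positivity) G _ (hZlt i (corner R m x))
    push_cast at h2 ⊢
    rw [h1, ← h2, sub_mul, one_mul, sub_eq_add_neg, Finset.mul_sum, Finset.sum_mul]
    congr 1
    refine Finset.sum_congr rfl fun g hg => ?_
    simp only [co, v, if_neg (Nat.succ_ne_zero g), Nat.add_sub_cancel]
    rw [Nat.sub_sub, add_comm 1 g, pow_succ]
    ring
  have n3 := Net.sum_mem (Finset.univ : Finset I) (fun i => K⁻¹ ^ (js i).length) fun i _ => n2 i
  obtain ⟨B, hB, hφ⟩ := n3.lift (σ := fun x : X => x.1)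
    (A := Set.range fun (j : Fin p) (x : Fin p → ℝ) => x j) (by
      rw [← Set.range_comp]; rfl)
  obtain ⟨φ, hφB, hφe⟩ := hφ rfl
  refine ⟨φ, hB.mono_right (Set.singleton_subset_iff.2 (subset_sp hφB)), fun x hx => ?_⟩
  have hb := corner_bounds (p := p) hR hβ hκ hM ⟨x, hx⟩
  refine ⟨corner R m (⟨x, hx⟩ : X), fun j => K⁻¹ * tail R m ((β - 1) * (m + 2)) (⟨x, hx⟩ : X) j,
    fun j => (hb j).1, fun j => mul_nonneg (by positivity) (hb j).2.1,
    fun j => mul_le_of_le_one_right (by positivity) (hb j).2.2.1, fun j => (hb j).2.2.2.1,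
    fun j => (hb j).2.2.2.2, ?_⟩
  have e1 : φ x = _ := congrFun hφe ⟨x, hx⟩
  rw [e1, ← Finset.sum_sub_distrib, ← Finset.card_univ, ← nsmul_eq_mul]
  refine (Finset.abs_sum_le_sum_abs _ _).trans (Finset.sum_le_card_nsmul _ _ _ fun i _ => ?_)
  have e2 : ((js i).map fun j => K⁻¹ * tail R m ((β - 1) * (m + 2)) (⟨x, hx⟩ : X) j).prod =
      K⁻¹ ^ (js i).length * P i ⟨x, hx⟩ := by
    rw [List.prod_map_mul, List.map_const', List.prod_replicate]
  have e3 : |P i ⟨x, hx⟩| ≤ 1 := by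
    have : ∀ l : List (Fin p), |(l.map (tail R m ((β - 1) * (m + 2)) (⟨x, hx⟩ : X))).prod| ≤ 1 := by
      intro l
      induction l with
      | nil => simp
      | cons j l ih =>
        rw [List.map_cons, List.prod_cons, abs_mul, abs_of_nonneg (hb j).2.1]
        exact mul_le_one₀ (hb j).2.2.1 (abs_nonneg _) ih
    exact this _
  have e4 : |K⁻¹ ^ (js i).length| ≤ 1 := by
    rw [abs_of_nonneg (by positivity)]
    exact pow_le_one₀ (by positivity) (inv_le_one_of_one_le₀ hK1)
  rw [e2, show ∀ a b z w : ℝ, a * (b * z) - w * (a * z) = (b - w) * (a * z) by intros; ring,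
    abs_mul,
    abs_mul]
  have e5 := hZc i (corner R m (⟨x, hx⟩ : X))
  have e6 : (2 : ℝ) ^ (G * q) = (2 ^ q) ^ G := by rw [mul_comm, pow_mul]
  rw [e6]
  push_cast at e5 ⊢
  exact (mul_le_of_le_one_right (abs_nonneg _) (mul_le_one₀ e4 (abs_nonneg _) e3)).trans e5

end Unit

section Grid

variable {p : ℕ}

lemma uniqueDiffOn_unitCube : UniqueDiffOn ℝ (unitCube p) := by
  rw [unitCube, ← Set.pi_univ_Icc]
  exact UniqueDiffOn.univ_pi fun _ => uniqueDiffOn_Icc one_pos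

lemma contDiffOn_pderivW {n : ℕ} {F : (Fin p → ℝ) → ℝ}
    (hF : ContDiffOn ℝ (n + 1 : ℕ) F (unitCube p))
    (i : Fin p) : ContDiffOn ℝ n (pderivW p i F) (unitCube p) := by
  have := hF.fderivWithin (m := n) uniqueDiffOn_unitCube (by norm_cast)
  exact this.clm_apply contDiffOn_const

/-- The `k`-th order term of the Taylor expansion, without the factorial. -/
noncomputable def taylorTerm : ℕ → ((Fin p → ℝ) → ℝ) → (Fin p → ℝ) → (Fin p → ℝ) → ℝ
  | 0, F, a, _ => F a
  | k + 1, F, a, h => ∑ i, h i * taylorTerm k (pderivW p i F) a h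

lemma taylorTerm_smul (k : ℕ) (F : (Fin p → ℝ) → ℝ) (a h : Fin p → ℝ) (t : ℝ) :
    taylorTerm k F a (t • h) = t ^ k * taylorTerm k F a h := by
  induction k generalizing F with
  | zero => simp [taylorTerm]
  | succ k ih =>
    simp only [taylorTerm, ih, Finset.mul_sum, Pi.smul_apply, smul_eq_mul]
    exact Finset.sum_congr rfl fun i _ => by ring

lemma taylorTerm_eq_sum (k : ℕ) (F : (Fin p → ℝ) → ℝ) (a h : Fin p → ℝ) :
    taylorTerm k F a h =
      ∑ l : Fin k → Fin p, pderivList p (List.ofFn l) F a * ((List.ofFn l).map h).prod := by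
  induction k generalizing F with
  | zero => simp [taylorTerm, pderivList]
  | succ k ih =>
    rw [← (Fin.consEquiv fun _ => Fin p).sum_comp, Fintype.sum_prod_type]
    simp only [taylorTerm, ih, Finset.mul_sum]
    refine Finset.sum_congr rfl fun i _ => Finset.sum_congr rfl fun l _ => ?_
    simp only [Fin.consEquiv_apply, List.ofFn_succ, Fin.cons_zero, Fin.cons_succ, pderivList,
      List.map_cons, List.prod_cons]
    ring

lemma hasDerivWithinAt_segment {F : (Fin p → ℝ) → ℝ} (hF : ContDiffOn ℝ 1 F (unitCube p))
    {a h : Fin p → ℝ} (ha : a ∈ unitCube p) (hah : a + h ∈ unitCube p) {t : ℝ}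
    (ht : t ∈ Set.Icc (0 : ℝ) 1) :
    HasDerivWithinAt (fun t : ℝ => F (a + t • h)) (∑ i, h i * pderivW p i F (a + t • h))
      (Set.Icc 0 1) t := by
  have hmaps : Set.MapsTo (fun t : ℝ => a + t • h) (Set.Icc 0 1) (unitCube p) := by
    intro s hs
    exact (convex_Icc (0 : Fin p → ℝ) 1).add_smul_mem ha hah hs
  have h1 := (hF.differentiableOn one_ne_zero _ (hmaps ht)).hasFDerivWithinAt
  have h2 : HasDerivWithinAt (fun t : ℝ => a + t • h) h (Set.Icc 0 1) t := by
    simpa using ((hasDerivWithinAt_id t (Set.Icc (0 : ℝ) 1)).smul_const h).const_add a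
  have h3 := h1.comp_hasDerivWithinAt t h2 hmaps
  have key : ∀ A : (Fin p → ℝ) →L[ℝ] ℝ, A h = ∑ i, h i * A (Pi.single i 1) := by
    intro A
    conv_lhs => rw [← Finset.univ_sum_single h]
    rw [map_sum]
    refine Finset.sum_congr rfl fun i _ => ?_
    rw [← smul_eq_mul (h i), ← map_smul, ← Pi.single_smul, smul_eq_mul, mul_one]
  exact h3.congr_deriv (key _)

lemma taylor_bound (n : ℕ) {F : (Fin p → ℝ) → ℝ} (hF : ContDiffOn ℝ n F (unitCube p))
    (hb : ∀ ls : List (Fin p), ls.length = n → ∀ x ∈ unitCube p, |pderivList p ls F x| ≤ 1)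
    {a h : Fin p → ℝ} {η : ℝ} (ha : a ∈ unitCube p) (hah : a + h ∈ unitCube p)
    (hη : 0 ≤ η) (hh : ∀ j, |h j| ≤ η) :
    |F (a + h) - ∑ k ∈ Finset.range n, taylorTerm k F a h / k.factorial| ≤
      (p * η) ^ n / n.factorial := by
  induction n generalizing F h η with
  | zero => simpa [pderivList] using hb [] rfl _ hah
  | succ n ih =>
    have hseg : ∀ t ∈ Set.Icc (0 : ℝ) 1, a + t • h ∈ unitCube p := fun t ht =>
      (convex_Icc (0 : Fin p → ℝ) 1).add_smul_mem ha hah ht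
    let D : ℝ → ℝ := fun t => F (a + t • h) -
      ∑ k ∈ Finset.range (n + 1), t ^ k * (taylorTerm k F a h / k.factorial)
    let D' : ℝ → ℝ := fun t => ∑ i, h i * (pderivW p i F (a + t • h) -
      ∑ k ∈ Finset.range n, taylorTerm k (pderivW p i F) a (t • h) / k.factorial)
    have hD : ∀ t ∈ Set.Icc (0 : ℝ) 1, HasDerivWithinAt D (D' t) (Set.Icc 0 1) t := by
      intro t ht
      have h1 := hasDerivWithinAt_segment (hF.of_le (by norm_cast; omega)) ha hah ht
      have h2 : HasDerivWithinAt
          (fun t : ℝ => ∑ k ∈ Finset.range (n + 1), t ^ k * (taylorTerm k F a h / k.factorial))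
          (∑ k ∈ Finset.range (n + 1), (k * t ^ (k - 1)) * (taylorTerm k F a h / k.factorial))
          (Set.Icc 0 1) t :=
        HasDerivWithinAt.fun_sum fun k _ => (hasDerivWithinAt_pow k t).mul_const _
      refine (h1.sub h2).congr_deriv ?_
      symm
      simp only [D', mul_sub, Finset.sum_sub_distrib]
      congr 1
      rw [Finset.sum_range_succ', Nat.cast_zero, zero_mul, zero_mul, add_zero]
      simp only [Finset.mul_sum]
      rw [Finset.sum_comm]
      refine Finset.sum_congr rfl fun k _ => ?_
      simp only [taylorTerm, taylorTerm_smul, Finset.sum_div, Finset.mul_sum]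
      refine Finset.sum_congr rfl fun i _ => ?_
      rw [Nat.factorial_succ, Nat.add_sub_cancel]
      push_cast
      field_simp
    have hD' : ∀ t ∈ Set.Icc (0 : ℝ) 1, ‖D' t‖ ≤ (p * η) ^ (n + 1) / n.factorial * t ^ n := by
      intro t ht
      have : ∀ i, |h i * (pderivW p i F (a + t • h) -
          ∑ k ∈ Finset.range n, taylorTerm k (pderivW p i F) a (t • h) / k.factorial)| ≤
          η * ((p * (t * η)) ^ n / n.factorial) := by
        intro i
        rw [abs_mul]
        refine mul_le_mul (hh i) (ih (contDiffOn_pderivW hF i) (fun ls hls => ?_) (hseg t ht)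
          (mul_nonneg ht.1 hη) fun j => ?_) (abs_nonneg _) hη
        · exact hb (i :: ls) (by simp [hls])
        · rw [Pi.smul_apply, smul_eq_mul, abs_mul, abs_of_nonneg ht.1]
          exact mul_le_mul_of_nonneg_left (hh j) ht.1
      refine (Finset.abs_sum_le_sum_abs _ _).trans ((Finset.sum_le_sum fun i _ => this i).trans
        (le_of_eq ?_))
      rw [Finset.sum_const, Finset.card_univ, Fintype.card_fin, nsmul_eq_mul]
      ring
    have hB : ∀ t : ℝ, HasDerivAt (fun t : ℝ => (p * η) ^ (n + 1) / (n + 1).factorial * t ^ (n + 1))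
        ((p * η) ^ (n + 1) / n.factorial * t ^ n) t := by
      intro t
      refine ((hasDerivAt_pow (n + 1) t).const_mul
        ((p * η) ^ (n + 1) / (n + 1).factorial)).congr_deriv ?_
      rw [Nat.factorial_succ, Nat.add_sub_cancel]
      push_cast
      field_simp
    have := image_norm_le_of_norm_deriv_right_le_deriv_boundary' (f := D) (f' := D')
      (a := 0) (b := 1)
      (fun t ht => (hD t ht).continuousWithinAt)
      (fun t ht => ((hD t ⟨ht.1, ht.2.le⟩).mono_of_mem_nhdsWithin (Icc_mem_nhdsGE_of_mem ht)))
      (by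
        simp only [D]
        rw [Finset.sum_range_succ']
        simp [taylorTerm])
      (fun t _ => (hB t).continuousAt.continuousWithinAt) (fun t _ => (hB t).hasDerivWithinAt)
      (fun t ht => hD' t ⟨ht.1, ht.2.le⟩) (Set.right_mem_Icc.2 zero_le_one)
    simpa [D] using this

lemma card_ofFn_fiber_le (k : ℕ) (α : Fin p → ℕ) :
    (Finset.univ.filter fun l : Fin k → Fin p =>
      (fun j => (List.ofFn l).count j) = α).card ≤ k.factorial := by
  classical
  rcases (Finset.univ.filter fun l : Fin k → Fin p =>
      (fun j => (List.ofFn l).count j) = α).eq_empty_or_nonempty with h | ⟨l₀, h₀⟩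
  · simp [h]
  · have h₀ := (Finset.mem_filter.1 h₀).2
    calc _ ≤ (List.ofFn l₀).permutations.toFinset.card := by
          refine Finset.card_le_card_of_injOn List.ofFn (fun l hl => ?_)
            List.ofFn_injective.injOn
          have hl := (Finset.mem_filter.1 hl).2
          rw [Finset.mem_coe, List.mem_toFinset, List.mem_permutations, List.perm_iff_count]
          exact fun j => congrFun (hl.trans h₀.symm) j
      _ ≤ k.factorial := by
          refine (List.toFinset_card_le _).trans ?_
          rw [List.length_permutations, List.length_ofFn]

/-- The Taylor polynomial written with one coefficient for each monomial. -/
lemma exists_taylor_coeff {β : ℕ} (hβ : 0 < β) {f : (Fin p → ℝ) → ℝ} (hf : f ∈ Hclass p β) :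
    ∃ (js : (Fin p → Fin β) → List (Fin p)) (c : (Fin p → Fin β) → (Fin p → ℝ) → ℝ),
      (∀ i, (js i).length < β) ∧ (∀ i θ, |c i θ| ≤ 1) ∧ ∀ θ h, θ ∈ unitCube p →
        ∑ i, c i θ * ((js i).map h).prod =
          ∑ k ∈ Finset.range β, taylorTerm k f θ h / k.factorial := by
  classical
  let S := (k : Fin β) × (Fin k → Fin p)
  let cnt : S → Fin p → Fin β := fun s j =>
    ⟨(List.ofFn s.2).count j, (List.count_le_length.trans_eq (List.length_ofFn)).trans_lt s.1.2⟩
  have hlen : ∀ s s' : S, cnt s = cnt s' → (List.ofFn s.2).Perm (List.ofFn s'.2) := by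
    intro s s' h
    exact List.perm_iff_count.2 fun j => congrArg Fin.val (congrFun h j)
  let js : (Fin p → Fin β) → List (Fin p) := fun α =>
    if h : ∃ s, cnt s = α then List.ofFn h.choose.2 else []
  have hjs : ∀ s, (js (cnt s)).Perm (List.ofFn s.2) := by
    intro s
    have h : ∃ s', cnt s' = cnt s := ⟨s, rfl⟩
    simp only [js]
    rw [dif_pos h]
    exact hlen _ _ h.choose_spec
  let c : (Fin p → Fin β) → (Fin p → ℝ) → ℝ := fun α θ =>
    if θ ∈ unitCube p then
      ∑ s with cnt s = α, pderivList p (List.ofFn s.2) f θ / (s.1 : ℕ).factorial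
    else 0
  refine ⟨js, c, fun α => ?_, fun α θ => ?_, fun θ h hθ => ?_⟩
  · simp only [js]
    split_ifs with h
    · rw [List.length_ofFn]; exact h.choose.1.2
    · exact hβ
  · simp only [c]
    split_ifs with hθ
    swap
    · simp
    by_cases h : ∃ s, cnt s = α
    · obtain ⟨⟨k, l₀⟩, h₀⟩ := h
      calc _ ≤ ∑ s with cnt s = α, (1 : ℝ) / (k : ℕ).factorial := by
            refine (Finset.abs_sum_le_sum_abs _ _).trans (Finset.sum_le_sum fun s hs => ?_)
            have hs := (hlen s ⟨k, l₀⟩ ((Finset.mem_filter.1 hs).2.trans h₀.symm)).length_eq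
            rw [List.length_ofFn, List.length_ofFn] at hs
            have hs' : s.1 = k := Fin.ext hs
            rw [abs_div, Nat.abs_cast, ← hs']
            gcongr
            exact hf.2 _ (by rw [List.length_ofFn]; exact s.1.2.le) _ hθ
        _ = ((Finset.univ.filter fun s => cnt s = α).card : ℝ) / (k : ℕ).factorial := by
            rw [Finset.sum_const, nsmul_eq_mul, mul_one_div]
        _ ≤ 1 := by
            rw [div_le_one (by positivity)]
            norm_cast
            refine le_trans ?_ (card_ofFn_fiber_le k fun j => α j)
            refine Finset.card_le_card_of_surjOn (fun l => (⟨k, l⟩ : S)) ?_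
            rintro ⟨k', l⟩ hl
            have hl := (Finset.mem_filter.1 (Finset.mem_coe.1 hl)).2
            have hk := (hlen ⟨k', l⟩ ⟨k, l₀⟩ (hl.trans h₀.symm)).length_eq
            rw [List.length_ofFn, List.length_ofFn] at hk
            obtain rfl := Fin.ext hk
            refine ⟨l, ?_, rfl⟩
            rw [Finset.mem_coe, Finset.mem_filter, ← hl]
            exact ⟨Finset.mem_univ _, rfl⟩
    · rw [Finset.sum_eq_zero]
      · simp
      · intro s hs
        exact absurd ⟨s, (Finset.mem_filter.1 hs).2⟩ h
  · simp only [c, if_pos hθ, Finset.sum_mul]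
    rw [← Fin.sum_univ_eq_sum_range fun k => taylorTerm k f θ h / k.factorial]
    simp only [taylorTerm_eq_sum, Finset.sum_div]
    rw [← Fintype.sum_sigma' (fun (k : Fin β) (l : Fin k → Fin p) =>
      pderivList p (List.ofFn l) f θ * ((List.ofFn l).map h).prod / (k : ℕ).factorial),
      ← Finset.sum_fiberwise _ cnt]
    refine Finset.sum_congr rfl fun α _ => Finset.sum_congr rfl fun s hs => ?_
    rw [← (Finset.mem_filter.1 hs).2, ((hjs s).map h).prod_eq]
    ring

lemma abs_sub_le_of_Hclass {β : ℕ} (hβ : 0 < β) {f : (Fin p → ℝ) → ℝ} (hf : f ∈ Hclass p β)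
    {x y : Fin p → ℝ} {ε : ℝ} (hx : x ∈ unitCube p) (hy : y ∈ unitCube p) (hε : 0 ≤ ε)
    (h : ∀ j, |y j - x j| ≤ ε) : |f y - f x| ≤ p * ε := by
  have := taylor_bound 1 (hf.1.of_le (by norm_cast)) (fun ls hls => hf.2 ls (by omega))
    (a := x) (h := y - x) hx (by simpa using hy) hε (by simpa using h)
  simpa [taylorTerm] using this

lemma pow_le_factorial_mul (p β : ℕ) : p ^ β ≤ β.factorial * (β + 1) ^ p := by
  refine (Nat.pow_le_pow_left (Nat.le_succ p) β).trans ?_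
  refine (Nat.pow_succ_le_ascFactorial _ _).trans ?_
  rw [Nat.ascFactorial_eq_factorial_mul_choose]
  refine Nat.mul_le_mul_left _ ?_
  have h : (β + 1).ascFactorial p ≤ p.factorial * (β + 1) ^ p := by
    induction p with
    | zero => simp
    | succ k ih =>
      rw [Nat.ascFactorial_succ, Nat.factorial_succ, pow_succ]
      calc _ ≤ ((k + 1) * (β + 1)) * (k.factorial * (β + 1) ^ k) :=
            Nat.mul_le_mul (by nlinarith [Nat.zero_le (k * β)]) ih
        _ = _ := by ring
  rw [Nat.ascFactorial_eq_factorial_mul_choose, add_comm β p, Nat.choose_symm_add] at h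
  exact Nat.le_of_mul_le_mul_left h (Nat.factorial_pos p)

variable {β R m h₁ h₂ W : ℕ}

/-- A network that approximates a smooth function at all good points. -/
lemma exists_good_net (hp : 0 < p) (hR : 0 < R) (hβ : 0 < β) {κ : ℝ} (hκ : 0 < κ)
    (hM : ((R ^ 2 * 2 ^ m) ^ β : ℕ) * κ ≤ 1) (hh : h₁ + h₂ = m * p) (hW : WidthBound p R W)
    {G : ℕ} (hG : (R ^ 2 * 2 ^ m) ^ β ≤ 2 ^ (G * (β * (m + 1)))) {f : (Fin p → ℝ) → ℝ}
    (hf : f ∈ Hclass p β) :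
    ∃ φ : (Fin p → ℝ) → ℝ, Net (β ^ p * ((G + 1) * W)) (unitDepth m β h₁ h₂)
      (Set.range fun (j : Fin p) (x : Fin p → ℝ) => x j) {φ} ∧
      ∀ x ∈ good p ((R ^ 2 * 2 ^ m) ^ β) κ,
        |φ x - f x| ≤ 4 * (β + 1) ^ p * ((R ^ 2 * 2 ^ m : ℝ) ^ β)⁻¹ := by
  obtain ⟨js, c, hjs, hc, hT⟩ := exists_taylor_coeff hβ hf
  obtain ⟨φ, hφ, happ⟩ := exists_poly_net hp hR hβ hκ hM hh hW G js hjs c hc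
  have hcard : Fintype.card (Fin p → Fin β) = β ^ p := by simp
  rw [hcard] at hφ happ
  refine ⟨φ, hφ, fun x hx => ?_⟩
  obtain ⟨θ, h, hθ, hh0, hhK, hle, hge, herr⟩ := happ x hx
  set K : ℝ := R ^ 2 * 2 ^ m with hK
  have hK0 : 0 < K := by positivity
  have hx1 : ∀ j, x j ≤ 1 := fun j => (hx j).1.2.le
  have hθ' : θ ∈ unitCube p :=
    ⟨fun j => hθ j, fun j => by have := hle j; have := hh0 j; have := hx1 j; simp; linarith⟩
  have hθh : θ + h ∈ unitCube p :=
    ⟨fun j => add_nonneg (hθ j) (hh0 j), fun j => (hle j).trans (hx1 j)⟩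
  have hx' : x ∈ unitCube p := ⟨fun j => (hx j).1.1, hx1⟩
  have hKb : (K ^ β)⁻¹ ≥ 0 := by positivity
  have e1 : |f (θ + h) - ∑ i, c i θ * ((js i).map h).prod| ≤ (β + 1) ^ p * (K ^ β)⁻¹ := by
    rw [hT θ h hθ']
    refine (taylor_bound β hf.1 (fun ls hls => hf.2 ls hls.le) hθ' hθh (η := K⁻¹) (by positivity)
      fun j => ?_).trans ?_
    · rw [abs_of_nonneg (hh0 j)]; exact hhK j
    · rw [mul_pow, inv_pow, mul_div_right_comm]
      refine mul_le_mul_of_nonneg_right ?_ hKb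
      rw [div_le_iff₀ (by positivity), mul_comm]
      exact_mod_cast pow_le_factorial_mul p β
  have e2 : |f x - f (θ + h)| ≤ (β + 1) ^ p * (K ^ β)⁻¹ := by
    refine (abs_sub_le_of_Hclass hβ hf hθh hx' hKb fun j => ?_).trans
      (mul_le_mul_of_nonneg_right ?_ hKb)
    · rw [Pi.add_apply, abs_of_nonneg (by linarith [hle j])]
      linarith [hge j]
    · have : p ≤ (β + 1) ^ p := (Nat.lt_pow_self (by omega)).le
      exact_mod_cast this
  have e3 : ((β ^ p : ℕ) : ℝ) * (2 / 2 ^ (G * (β * (m + 1)))) ≤ 2 * (β + 1) ^ p * (K ^ β)⁻¹ := by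
    have h1 : K ^ β ≤ 2 ^ (G * (β * (m + 1))) := by
      rw [hK]; exact_mod_cast hG
    have h2 : (2 : ℝ) / 2 ^ (G * (β * (m + 1))) ≤ 2 * (K ^ β)⁻¹ := by
      rw [div_eq_mul_inv]
      gcongr
    have h3 : ((β ^ p : ℕ) : ℝ) ≤ (β + 1) ^ p := by
      push_cast
      gcongr
      linarith
    calc _ ≤ (β + 1 : ℝ) ^ p * (2 * (K ^ β)⁻¹) := mul_le_mul h3 h2 (by positivity) (by positivity)
      _ = _ := by ring
  have e4 := herr.trans e3
  rw [abs_le] at e1 e2 e4 ⊢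
  constructor <;> linarith [e1.1, e1.2, e2.1, e2.2, e4.1, e4.2]

end Grid

section Assembly

/-- The median of three numbers. -/
noncomputable def mid (a b c : ℝ) : ℝ := max (min a b) (min (max a b) c)

lemma abs_mid_sub_le {a b c t E : ℝ}
    (h : (|a - t| ≤ E ∧ |b - t| ≤ E) ∨ (|a - t| ≤ E ∧ |c - t| ≤ E) ∨ (|b - t| ≤ E ∧ |c - t| ≤ E)) :
    |mid a b c - t| ≤ E := by
  simp only [abs_le] at h ⊢
  unfold mid
  rcases le_total a b with h1 | h1 <;>
  simp only [h1, min_eq_left, min_eq_right, max_eq_left, max_eq_right] <;>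
  [rcases le_total b c with h2 | h2; rcases le_total a c with h2 | h2] <;>
  simp only [h2, min_eq_left, min_eq_right]
  · rw [max_eq_right h1]; rcases h with h | h | h <;> constructor <;> linarith
  · rcases le_total a c with h3 | h3 <;> simp only [h3, max_eq_left, max_eq_right] <;>
    rcases h with h | h | h <;> constructor <;> linarith
  · rw [max_eq_right h1]; rcases h with h | h | h <;> constructor <;> linarith
  · rcases le_total b c with h3 | h3 <;> simp only [h3, max_eq_left, max_eq_right] <;>
    rcases h with h | h | h <;> constructor <;> linarith

lemma mid_eq (a b c : ℝ) :
    mid a b c = b - relu (b - a) + relu (a + relu (b - a) - relu (a + relu (b - a) - c) -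
      (b - relu (b - a))) := by
  have hmin : ∀ x y : ℝ, min x y = y - relu (y - x) := fun x y => by
    rcases le_total x y with h | h
    · rw [min_eq_left h, relu_of_nonneg (by linarith)]; ring
    · rw [min_eq_right h, relu_of_nonpos (by linarith)]; ring
  have hmax : ∀ x y : ℝ, max x y = x + relu (y - x) := fun x y => by
    rcases le_total x y with h | h
    · rw [max_eq_right h, relu_of_nonneg (by linarith)]; ring
    · rw [max_eq_left h, relu_of_nonpos (by linarith)]; ring
  rw [mid, hmax, hmax a b, min_comm (a + _) c, hmin a b, hmin c]

section Networks

variable {X : Type} {w k : ℕ} {A : Set (X → ℝ)}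

lemma Net.relu_single {f : X → ℝ} (hf : f ∈ sp A) : Net 1 1 A {act f} := by
  refine Net.of_family (fun _ : Unit => f) (by simp) (fun _ => hf) ?_
  exact Set.singleton_subset_iff.2 (subset_sp ⟨(), rfl⟩)

lemma Net.signed_single {f : X → ℝ} (hf : f ∈ sp A) : Net 2 1 A {f} :=
  (Net.pass_signed f 1).mono_left (Set.singleton_subset_iff.2 hf)

lemma Net.mid {a b c : X → ℝ} (ha : Net w k A {a}) (hb : Net w k A {b}) (hc : Net w k A {c})
    (hw : 3 ≤ w) : Net (3 * w) (k + 3) A {fun x => ReluNet.mid (a x) (b x) (c x)} := by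
  have h0 : Net (3 * w) k A ({a} ∪ {b} ∪ {c}) :=
    ((ha.union_same hb).union_same hc).mono_width (by omega)
  have ma : a ∈ sp ({a} ∪ {b} ∪ {c}) := subset_sp (by simp)
  have mb : b ∈ sp ({a} ∪ {b} ∪ {c}) := subset_sp (by simp)
  have mc : c ∈ sp ({a} ∪ {b} ∪ {c}) := subset_sp (by simp)
  let r : X → ℝ := act fun x => b x - a x
  have h1 : Net (3 * w) 1 ({a} ∪ {b} ∪ {c}) ({a} ∪ {b} ∪ {c} ∪ {r}) :=
    (((Net.signed_single ma).union_same (Net.signed_single mb)).union_same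
      (Net.signed_single mc)).union_same (Net.relu_single (sub_mem_sp mb ma))
      |>.mono_width (by omega)
  set A1 : Set (X → ℝ) := {a} ∪ {b} ∪ {c} ∪ {r} with hA1
  have ma1 : a ∈ sp A1 := subset_sp (by simp [hA1])
  have mb1 : b ∈ sp A1 := subset_sp (by simp [hA1])
  have mc1 : c ∈ sp A1 := subset_sp (by simp [hA1])
  have mr1 : r ∈ sp A1 := subset_sp (by simp [hA1])
  let u : X → ℝ := fun x => a x + r x
  let v : X → ℝ := fun x => b x - r x
  have mu1 : u ∈ sp A1 := add_mem_sp ma1 mr1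
  have mv1 : v ∈ sp A1 := sub_mem_sp mb1 mr1
  let s : X → ℝ := act fun x => u x - c x
  have h2 : Net (3 * w) 1 A1 ({u} ∪ {v} ∪ {s}) :=
    ((Net.signed_single mu1).union_same (Net.signed_single mv1)).union_same
      (Net.relu_single (sub_mem_sp mu1 mc1)) |>.mono_width (by omega)
  set A2 : Set (X → ℝ) := {u} ∪ {v} ∪ {s} with hA2
  have mu2 : u ∈ sp A2 := subset_sp (by simp [hA2])
  have mv2 : v ∈ sp A2 := subset_sp (by simp [hA2])
  have ms2 : s ∈ sp A2 := subset_sp (by simp [hA2])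
  let y : X → ℝ := fun x => u x - s x - v x
  have my2 : y ∈ sp A2 := sub_mem_sp (sub_mem_sp mu2 ms2) mv2
  have h3 : Net (3 * w) 1 A2 ({v} ∪ {act y}) :=
    (Net.signed_single mv2).union_same (Net.relu_single my2) |>.mono_width (by omega)
  refine ((h0.trans h1).trans h2 |>.trans h3).mono_right (Set.singleton_subset_iff.2 ?_)
  have e : (fun x => ReluNet.mid (a x) (b x) (c x)) = fun x => v x + act y x := by
    ext x
    exact mid_eq _ _ _
  rw [e]
  exact add_mem_sp (subset_sp (by simp)) (subset_sp (by simp))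

end Networks

variable {p : ℕ}

/-- Iterated medians over shifts in the first `j` coordinates. -/
noncomputable def midShift (κ : ℝ) (φ : (Fin p → ℝ) → ℝ) : ℕ → (Fin p → ℝ) → ℝ
  | 0, y => φ y
  | j + 1, y => mid (midShift κ φ j y) (midShift κ φ j fun i => y i + if (i : ℕ) = j then κ else 0)
      (midShift κ φ j fun i => y i + if (i : ℕ) = j then 2 * κ else 0)

lemma Net.comp_affine {w k : ℕ} {g : (Fin p → ℝ) → ℝ}
    (h : Net w k (Set.range fun (j : Fin p) (x : Fin p → ℝ) => x j) {g}) (a : ℝ) (b : Fin p → ℝ) :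
    Net w k (Set.range fun (j : Fin p) (x : Fin p → ℝ) => x j)
      {fun x => g fun i => a * x i + b i} := by
  have := h.comp fun (x : Fin p → ℝ) i => a * x i + b i
  rw [Set.image_singleton] at this
  refine this.mono_left ?_
  rintro _ ⟨_, ⟨j, rfl⟩, rfl⟩
  exact add_mem_sp (mul_mem_sp a (subset_sp ⟨j, rfl⟩)) (const_mem_sp (b j))

lemma net_midShift {w k : ℕ} {φ : (Fin p → ℝ) → ℝ} (hw : 3 ≤ w)
    (h : Net w k (Set.range fun (j : Fin p) (x : Fin p → ℝ) => x j) {φ}) (κ : ℝ) (j : ℕ) :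
    Net (3 ^ j * w) (k + 3 * j) (Set.range fun (j : Fin p) (x : Fin p → ℝ) => x j)
      {midShift κ φ j} := by
  induction j with
  | zero => simpa [midShift] using h
  | succ j ih =>
    have h1 := ih.comp_affine 1 fun i => if (i : ℕ) = j then κ else 0
    have h2 := ih.comp_affine 1 fun i => if (i : ℕ) = j then 2 * κ else 0
    simp only [one_mul] at h1 h2
    have := ih.mid h1 h2 (hw.trans (Nat.le_mul_of_pos_left _ (by positivity)))
    rw [pow_succ', mul_assoc]
    exact this

lemma fract_add_le {M κ τ s : ℝ} (hM : 0 ≤ M) (hτ : κ ≤ τ) (hMτ : M * τ + M * κ ≤ 1)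
    (hs : 1 - M * κ < Int.fract (M * s)) : Int.fract (M * (s + τ)) ≤ 1 - M * κ := by
  have h1 : Int.fract (M * (s + τ)) = Int.fract (M * s) + M * τ - 1 := by
    have h2 := mul_le_mul_of_nonneg_left hτ hM
    have h3 := Int.fract_lt_one (M * s)
    have h4 := Int.fract_nonneg (M * s)
    rw [Int.fract_eq_iff]
    refine ⟨by linarith, by nlinarith [mul_nonneg hM (sub_nonneg.2 hτ)], ⌊M * s⌋ + 1, ?_⟩
    push_cast
    rw [Int.fract]
    ring
  have := Int.fract_lt_one (M * s)
  linarith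

lemma abs_midShift_sub_le {M : ℕ} {κ E t : ℝ} (hκ : 0 < κ) (hMκ : M * (3 * κ) ≤ 1)
    {φ : (Fin p → ℝ) → ℝ} {y : Fin p → ℝ} (hy : ∀ i, y i ∈ Set.Icc 0 (1 - 3 * κ))
    (hφ : ∀ z ∈ good p M κ, (∀ i, |z i - y i| ≤ 2 * κ) → |φ z - t| ≤ E) (j : ℕ) (z : Fin p → ℝ)
    (hz₁ : ∀ i : Fin p, (i : ℕ) < j → z i = y i)
    (hz₂ : ∀ i : Fin p, j ≤ i → (z i ∈ Set.Ico (0 : ℝ) 1 ∧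
      Int.fract ((M : ℝ) * z i) ≤ 1 - M * κ) ∧ |z i - y i| ≤ 2 * κ) :
    |midShift κ φ j z - t| ≤ E := by
  induction j generalizing z with
  | zero => exact hφ z (fun i => (hz₂ i (Nat.zero_le _)).1) fun i => (hz₂ i (Nat.zero_le _)).2
  | succ j ih =>
    by_cases hj : j < p
    swap
    · have key : ∀ τ : ℝ, (fun i : Fin p => z i + if (i : ℕ) = j then τ else 0) = z := by
        intro τ
        ext i
        rw [if_neg (by omega), add_zero]
      simp only [midShift, key]
      have := ih z (fun i _ => hz₁ i (by omega)) fun i hi => by omega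
      exact abs_mid_sub_le (Or.inl ⟨this, this⟩)
    have hyj := hy ⟨j, hj⟩
    have key : ∀ τ : ℝ, 0 ≤ τ → τ ≤ 2 * κ →
        Int.fract ((M : ℝ) * (y ⟨j, hj⟩ + τ)) ≤ 1 - M * κ →
        |midShift κ φ j (fun i => z i + if (i : ℕ) = j then τ else 0) - t| ≤ E := by
      intro τ h0 h1 h2
      refine ih _ (fun i hi => ?_) fun i hi => ?_
      · rw [if_neg (by omega), add_zero, hz₁ i (by omega)]
      · rcases hi.eq_or_lt with rfl | hi
        · rw [if_pos rfl, hz₁ i (by omega), add_sub_cancel_left, abs_of_nonneg h0]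
          exact ⟨⟨⟨by linarith [hyj.1], by linarith [hyj.2]⟩, h2⟩, h1⟩
        · rw [if_neg (by omega), add_zero]
          exact hz₂ i hi
    have hM : (0 : ℝ) ≤ M := Nat.cast_nonneg M
    have k0 := key 0 le_rfl (by linarith)
    have k1 := key κ hκ.le (by linarith)
    have k2 := key (2 * κ) (by linarith) le_rfl
    simp only [ite_self, add_zero] at k0
    have p1 := fract_add_le (s := y ⟨j, hj⟩) hM (le_refl κ) (by nlinarith)
    have p2 := fract_add_le (s := y ⟨j, hj⟩) (τ := 2 * κ) hM (by linarith) (by nlinarith)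
    have p3 := fract_add_le (s := y ⟨j, hj⟩ + κ) hM (le_refl κ) (by nlinarith)
    rw [add_assoc, ← two_mul] at p3
    refine abs_mid_sub_le ?_
    by_cases b0 : Int.fract ((M : ℝ) * y ⟨j, hj⟩) ≤ 1 - M * κ
    · by_cases b1 : Int.fract ((M : ℝ) * (y ⟨j, hj⟩ + κ)) ≤ 1 - M * κ
      · exact Or.inl ⟨k0 b0, k1 b1⟩
      · exact Or.inr (Or.inl ⟨k0 b0, k2 (p3 (not_le.1 b1))⟩)
    · exact Or.inr (Or.inr ⟨k1 (p1 (not_le.1 b0)), k2 (p2 (not_le.1 b0))⟩)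

variable {β R m h₁ h₂ W : ℕ}

/-- A network that approximates a smooth function on the whole cube. -/
lemma exists_cube_net (hp : 0 < p) (hR : 0 < R) (hβ : 0 < β) (hh : h₁ + h₂ = m * p)
    (hW : WidthBound p R W) {G : ℕ} (hG : (R ^ 2 * 2 ^ m) ^ β ≤ 2 ^ (G * (β * (m + 1))))
    {f : (Fin p → ℝ) → ℝ} (hf : f ∈ Hclass p β) {ε : ℝ} (hε : 0 < ε) :
    ∃ g : (Fin p → ℝ) → ℝ, Net (3 ^ p * (β ^ p * ((G + 1) * W))) (unitDepth m β h₁ h₂ + 3 * p)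
      (Set.range fun (j : Fin p) (x : Fin p → ℝ) => x j) {g} ∧
      ∀ x ∈ unitCube p,
        |g x - f x| ≤ 4 * (β + 1) ^ p * ((R ^ 2 * 2 ^ m : ℝ) ^ β)⁻¹ + ε := by
  set M := (R ^ 2 * 2 ^ m) ^ β with hM
  have hM0 : (0 : ℝ) < M := by
    have : 0 < M := by positivity
    exact_mod_cast this
  have hM1 : (1 : ℝ) ≤ M := by
    have : 1 ≤ M := Nat.succ_le_of_lt (by positivity)
    exact_mod_cast this
  set κ : ℝ := min (1 / (3 * M)) (ε / (5 * p)) with hκdef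
  have hp' : (0 : ℝ) < p := by exact_mod_cast hp
  have hκ : 0 < κ := lt_min (by positivity) (by positivity)
  have hκ1 : M * (3 * κ) ≤ 1 := by
    have := min_le_left (1 / (3 * (M : ℝ))) (ε / (5 * p))
    rw [← hκdef, le_div_iff₀ (by positivity)] at this
    linarith
  have hκ2 : p * (5 * κ) ≤ ε := by
    have := min_le_right (1 / (3 * (M : ℝ))) (ε / (5 * p))
    rw [← hκdef, le_div_iff₀ (by positivity)] at this
    linarith
  have hκ3 : 3 * κ ≤ 1 := by nlinarith
  obtain ⟨φ, hφ, hφf⟩ := exists_good_net hp hR hβ hκ (by rw [← hM]; nlinarith) hh hW hG hf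
  have h3 : 3 ≤ β ^ p * ((G + 1) * W) := by
    have h1 : 3 ≤ W := by have := hW.2.2; omega
    have h2 : 0 < β ^ p * (G + 1) := by positivity
    rw [← mul_assoc]
    exact h1.trans (Nat.le_mul_of_pos_left _ h2)
  refine ⟨fun x => midShift κ φ p fun i => (1 - 3 * κ) * x i + 0,
    (net_midShift h3 hφ κ p).comp_affine (1 - 3 * κ) fun _ => 0, fun x hx => ?_⟩
  have hx0 : ∀ i, 0 ≤ x i := hx.1
  have hx1 : ∀ i, x i ≤ 1 := hx.2
  simp only [add_zero]
  refine abs_midShift_sub_le (M := M) (y := fun i => (1 - 3 * κ) * x i) hκ hκ1 (fun i =>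
    ⟨mul_nonneg (by linarith) (hx0 i), mul_le_of_le_one_right (by linarith) (hx1 i)⟩)
    (fun z hz hzy => ?_) p _ (fun _ _ => rfl) fun i hi => absurd i.2 (by omega)
  have h1 := hφf z hz
  have h2 : |f z - f x| ≤ p * (5 * κ) := by
    refine abs_sub_le_of_Hclass hβ hf hx ⟨fun j => (hz j).1.1, fun j => (hz j).1.2.le⟩
      (by linarith) fun j => ?_
    have h4 := abs_le.1 (hzy j)
    have h5 := mul_nonneg hκ.le (hx0 j)
    have h6 := mul_le_of_le_one_right hκ.le (hx1 j)
    rw [abs_le]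
    constructor <;> linarith [h4.1, h4.2]
  calc |φ z - f x| = |(φ z - f z) + (f z - f x)| := by ring_nf
    _ ≤ _ := (abs_add_le _ _).trans (add_le_add h1 (h2.trans hκ2))

end Assembly

section Emulation

/-- The vector fed to the matrix after level `ℓ` of a virtual network. -/
noncomputable def levelState (d : ℕ) (Ws : ℕ → Matrix (Fin d) (Fin d) ℝ) (z : Fin d → ℝ) (ℓ : ℕ) :
    Fin d → ℝ :=
  fun k => if ℓ = 0 then vnetOut d relu Ws z ℓ k else relu (vnetOut d relu Ws z ℓ k)

lemma vnetOut_congr {d : ℕ} {act : ℝ → ℝ} {Ws Ws' : ℕ → Matrix (Fin d) (Fin d) ℝ} (z : Fin d → ℝ)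
    (ℓ : ℕ) (h : ∀ i, 1 ≤ i → i ≤ ℓ → Ws i = Ws' i) :
    vnetOut d act Ws z ℓ = vnetOut d act Ws' z ℓ := by
  induction ℓ with
  | zero => rfl
  | succ ℓ ih =>
    simp only [vnetOut]
    rw [ih fun i h1 h2 => h i h1 (by omega), h (ℓ + 1) (by omega) le_rfl]

/-- The functions that are linear in the state at level `ℓ`. -/
noncomputable def levelSpan {X : Type} (d : ℕ) (Ws : ℕ → Matrix (Fin d) (Fin d) ℝ)
    (z : X → Fin d → ℝ) (ℓ : ℕ) : Submodule ℝ (X → ℝ) where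
  carrier := {f | ∃ v : Fin d → ℝ, ∀ x, f x = v ⬝ᵥ levelState d Ws (z x) ℓ}
  add_mem' := by
    rintro f g ⟨v, hv⟩ ⟨v', hv'⟩
    exact ⟨v + v', fun x => by rw [Pi.add_apply, hv, hv', add_dotProduct]⟩
  zero_mem' := ⟨0, fun x => by simp⟩
  smul_mem' := by
    rintro c f ⟨v, hv⟩
    exact ⟨c • v, fun x => by rw [Pi.smul_apply, hv, smul_dotProduct]⟩

lemma Net.exists_matrices {X : Type} {d w k : ℕ} {A B : Set (X → ℝ)} (h : Net w k A B) (hw : w < d)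
    (z : X → Fin d → ℝ) (hA : ∀ Ws, sp A ≤ levelSpan d Ws z 0) :
    ∃ Ws, sp B ≤ levelSpan d Ws z k := by
  induction h with
  | nil h => exact ⟨0, (sp_le h).trans (hA _)⟩
  | @cons k A B C _ hs ih =>
    obtain ⟨Ws, hWs⟩ := ih hA
    obtain ⟨s, hcard, hsub, hC⟩ := hs
    have hl : s.toList.length < d := by
      rw [Finset.length_toList]
      omega
    have hrow : ∀ f ∈ sp B, ∃ v : Fin d → ℝ, ∀ x, f x = v ⬝ᵥ levelState d Ws (z x) k :=
      fun f hf => hWs hf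
    choose! row hrow using hrow
    let W : Matrix (Fin d) (Fin d) ℝ := fun i =>
      if hi : (i : ℕ) < s.toList.length then row (s.toList[(i : ℕ)]) else row 1
    let Ws' := Function.update Ws (k + 1) W
    have hold : ∀ x, levelState d Ws' (z x) k = levelState d Ws (z x) k := by
      intro x
      ext i
      rw [levelState, levelState, vnetOut_congr (Ws := Ws') (Ws' := Ws) (z x) k]
      intro i _ hi
      exact Function.update_of_ne (by omega) _ _
    have hnew : ∀ x i, levelState d Ws' (z x) (k + 1) i =
        relu (W i ⬝ᵥ levelState d Ws (z x) k) := by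
      intro x i
      rw [← hold]
      simp only [levelState, if_neg (Nat.succ_ne_zero k), vnetOut, Ws', Function.update_self]
      rfl
    refine ⟨Ws', (sp_le hC).trans (Submodule.span_le.2 (Set.insert_subset ?_ ?_))⟩
    · refine ⟨Pi.single ⟨s.toList.length, hl⟩ 1, fun x => ?_⟩
      rw [single_one_dotProduct, hnew]
      simp only [W, lt_irrefl, dite_false]
      rw [← hrow 1 one_mem_sp x]
      simp [relu]
    · rintro _ ⟨f, hf, rfl⟩
      obtain ⟨i, hi, rfl⟩ := List.getElem_of_mem (Finset.mem_toList.2 hf)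
      refine ⟨Pi.single ⟨i, hi.trans hl⟩ 1, fun x => ?_⟩
      rw [single_one_dotProduct, hnew]
      simp only [W, dif_pos hi]
      rw [← hrow _ (hsub hf) x]
      rfl

lemma Net.exists_vnet {p d w k : ℕ} {g : (Fin p → ℝ) → ℝ}
    (h : Net w k (Set.range fun (j : Fin p) (x : Fin p → ℝ) => x j) {g}) (hw : w < d)
    (hp : p < d) :
    ∃ Ws, ∀ x, vnetOut d relu Ws (embed d p x) (k + 1) ⟨0, by omega⟩ = g x := by
  obtain ⟨Ws, hWs⟩ := h.exists_matrices hw (embed d p) fun Ws => by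
    refine Submodule.span_le.2 (Set.insert_subset ?_ ?_)
    · refine ⟨Pi.single ⟨p, hp⟩ 1, fun x => ?_⟩
      rw [single_one_dotProduct]
      simp [levelState, vnetOut, embed]
    · rintro _ ⟨j, rfl⟩
      refine ⟨Pi.single ⟨j, by omega⟩ 1, fun x => ?_⟩
      rw [single_one_dotProduct]
      simp [levelState, vnetOut, embed]
  obtain ⟨v, hv⟩ := hWs (subset_sp (Set.mem_singleton g))
  let W : Matrix (Fin d) (Fin d) ℝ := fun _ => v
  refine ⟨Function.update Ws (k + 1) W, fun x => ?_⟩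
  rw [hv x, vnetOut, Function.update_self]
  rw [vnetOut_congr (Ws' := Ws) (embed d p x) k fun i _ hi => Function.update_of_ne (by omega) _ _]
  rfl

section Prompt

variable {d : ℕ}

/-- Layer indices of the prompt that encodes a family of matrices column by column. -/
def promptIndex (d : ℕ) (T : ℕ) (j : Fin T) : ℕ := 2 * ((j : ℕ) / 2 / d) + 1 + (j : ℕ) % 2

/-- Word embeddings of the prompt that encodes a family of matrices column by column. -/
noncomputable def promptEmbedding (hd : 0 < d) (Ws : ℕ → Matrix (Fin d) (Fin d) ℝ) (T : ℕ)
    (j : Fin T) : Fin d → ℝ :=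
  let k : Fin d := ⟨(j : ℕ) / 2 % d, Nat.mod_lt _ hd⟩
  if (j : ℕ) % 2 = 0 then fun i => Ws ((j : ℕ) / 2 / d + 1) i k else Pi.single k 1

lemma WPmat_prompt (hd : 0 < d) (Ws : ℕ → Matrix (Fin d) (Fin d) ℝ) {L ℓ : ℕ} (hℓ : ℓ < L) :
    WPmat (promptEmbedding hd Ws (2 * (d * L))) (promptIndex d _) (ℓ + 1) = Ws (ℓ + 1) := by
  have hle : d * ℓ + d ≤ d * L := by
    rw [← Nat.mul_succ]
    exact Nat.mul_le_mul_left d hℓ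
  let e : Fin d → Fin (2 * (d * L)) := fun k => ⟨2 * (d * ℓ + k), by omega⟩
  have he : Function.Injective e := by
    intro a b h
    have := congrArg Fin.val h
    simp only [e] at this
    exact Fin.ext (by omega)
  have h0 : ∀ k : Fin d, (d * ℓ + k) / d = ℓ := fun k => by
    rw [Nat.mul_add_div hd, Nat.div_eq_of_lt k.2, add_zero]
  have h1 : ∀ k : Fin d, (d * ℓ + k) % d = k := fun k => by
    rw [Nat.mul_add_mod, Nat.mod_eq_of_lt k.2]
  have h2 : ∀ k : ℕ, 2 * k / 2 = k ∧ 2 * k % 2 = 0 ∧ (2 * k + 1) / 2 = k ∧ (2 * k + 1) % 2 = 1 :=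
    fun k => by omega
  rw [WPmat, ← Fintype.sum_of_injective e he
    (fun k => vecMulVec (fun i => Ws (ℓ + 1) i k) (Pi.single k 1))]
  · ext i j
    rw [Matrix.sum_apply]
    simp [vecMulVec_apply, Pi.single_apply]
  · intro j hj
    split_ifs with h3 h4
    · exfalso
      apply hj
      obtain ⟨h4, -⟩ := h4
      simp only [promptIndex] at h4
      have h5 : (j : ℕ) / 2 / d = ℓ := by omega
      refine ⟨⟨(j : ℕ) / 2 % d, Nat.mod_lt _ hd⟩, Fin.ext ?_⟩
      simp only [e]
      have := Nat.div_add_mod ((j : ℕ) / 2) d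
      rw [h5] at this
      omega
    · rfl
    · rfl
  · intro k
    have hk := k.2
    have h3 : 2 * (d * ℓ + k) + 1 < 2 * (d * L) := by omega
    rw [dif_pos h3, if_pos]
    · simp only [promptEmbedding, e, h0, h1, h2]
      simp
    · simp only [promptIndex, e, h0, h2]
      omega

lemma WPfam_prompt (hd : 0 < d) (Ws : ℕ → Matrix (Fin d) (Fin d) ℝ) {L ℓ : ℕ} (h1 : 1 ≤ ℓ)
    (hℓ : ℓ ≤ L) (i : ℕ) :
    WPfam (promptEmbedding hd Ws (2 * (d * L))) (promptIndex d _) i ℓ = Ws ℓ := by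
  obtain ⟨ℓ, rfl⟩ := Nat.exists_eq_add_of_le' h1
  have hT : 0 < d * L := Nat.mul_pos hd (by omega)
  have hcorr : WPcorr (promptEmbedding hd Ws (2 * (d * L))) (promptIndex d _) = 0 := by
    rw [WPcorr, dif_pos (by omega), if_neg]
    simp only [promptIndex]
    omega
  rw [WPfam, WPone, hcorr, ite_self, add_zero]
  split_ifs with h
  · obtain rfl : ℓ = 0 := by omega
    exact WPmat_prompt hd Ws (by omega)
  · exact WPmat_prompt hd Ws (by omega)

end Prompt

lemma exists_prompt {p d w k T : ℕ} {Θ : List (TFLayer (4 * d + 8))}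
    (hΘ : EmulatesWith d (tfForward Θ) relu) {g : (Fin p → ℝ) → ℝ}
    (h : Net w k (Set.range fun (j : Fin p) (x : Fin p → ℝ) => x j) {g}) (hw : w < d)
    (hp : p < d) (hT : 2 * (d * (k + 1)) ≤ T) :
    ∃ (S : ℝ) (T' : ℕ) (u : Fin T' → Fin d → ℝ) (w : Fin T' → ℕ),
      0 < S ∧ 1 ≤ T' ∧ T' ≤ T ∧ ValidPrompt Set.univ T' (k + 1) u w ∧
      ∀ x ∈ unitCube p, fhat (tfForward Θ) u w S (k + 1) p x = g x := by
  obtain ⟨Ws, hWs⟩ := h.exists_vnet hw hp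
  have hd : 0 < d := by omega
  set T' := 2 * (d * (k + 1)) with hT'
  have hT0 : 0 < T' := by positivity
  set u := promptEmbedding hd Ws T' with hu
  set ws := promptIndex d T' with hws
  set B : ℝ := 1 + ∑ j, Real.sqrt (∑ i, u j i ^ 2) with hB
  set S : ℝ := max ((d : ℝ) * B ^ (4 * (k + 1)) * (T' : ℝ) ^ (2 * (k + 1))) (2 * ((k + 1 : ℕ) : ℝ))
    with hS
  have hwv : ∀ j, 1 ≤ ws j ∧ ws j ≤ 2 * (k + 1) := by
    intro j
    simp only [ws, promptIndex]
    have : (j : ℕ) / 2 / d < k + 1 := by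
      rw [Nat.div_lt_iff_lt_mul hd, mul_comm]
      have := j.2
      omega
    omega
  refine ⟨S, T', u, ws, ?_, hT0, hT, ⟨fun _ => Set.mem_univ _, hwv⟩, fun x hx => ?_⟩
  · refine lt_of_lt_of_le ?_ (le_max_right _ _)
    positivity
  · have hu' : ∀ j, u j ∈ eball d B := by
      intro j
      have := Finset.single_le_sum (f := fun j => Real.sqrt (∑ i, u j i ^ 2))
        (fun j _ => Real.sqrt_nonneg _) (Finset.mem_univ j)
      change Real.sqrt _ ≤ B
      linarith
    have hz : ∀ (i : Fin 1) (j : Fin d), embed d p x j ∈ Set.Icc (0 : ℝ) 1 := by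
      intro _ j
      simp only [embed]
      split_ifs with h1 h2
      · exact ⟨hx.1 _, hx.2 _⟩
      · exact ⟨zero_le_one, le_rfl⟩
      · exact ⟨le_rfl, zero_le_one⟩
    have := hΘ B (by rw [hB]; linarith [Finset.sum_nonneg fun j (_ : j ∈ Finset.univ) =>
        Real.sqrt_nonneg (∑ i, u j i ^ 2)]) T' (k + 1) hT0 k.succ_pos (eball d B)
        subset_rfl S le_rfl
      u ws ⟨hu', hwv⟩ 1 one_pos (fun _ => embed d p x) hz 0 (k + 1) (by omega) le_rfl
    rw [fhat, show T' + 1 + (k + 1) = T' + 1 * (k + 1) + ((0 : Fin 1) : ℕ) + 1 by simp; omega, this]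
    simp only [promptToken, dif_pos hd]
    rw [← hWs x, vnetOut_congr (Ws' := Ws) _ _ fun i h1 h2 => WPfam_prompt hd Ws h1 h2 _]

end Emulation

section Rates

lemma one_le_log {x : ℝ} (hx : 4 ≤ x) : 1 ≤ Real.log x := by
  rw [Real.le_log_iff_exp_le (by linarith)]
  linarith [Real.exp_one_lt_three]

lemma exists_width {p β d : ℕ} (hp : 0 < p) (hβ : 0 < β)
    (hd : 17 * β ^ (p + 1) * 3 ^ p * p + 1 ≤ d) :
    ∃ R G W, 0 < R ∧ WidthBound p R W ∧
      (∀ m, (R ^ 2 * 2 ^ m) ^ β ≤ 2 ^ (G * (β * (m + 1)))) ∧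
      3 ^ p * (β ^ p * ((G + 1) * W)) < d ∧
      (((d : ℝ) - 1) / (68 * (β : ℝ) ^ (p + 1) * 3 ^ p * (p : ℝ) * Real.log (8 * (d : ℝ)))) ^
        ((1 : ℝ) / p) ≤ 2 * R := by
  set N : ℝ := ((d : ℝ) - 1) / (68 * (β : ℝ) ^ (p + 1) * 3 ^ p * (p : ℝ) * Real.log (8 * (d : ℝ)))
    with hN
  have hp' : (1 : ℝ) ≤ p := by exact_mod_cast hp
  have hβ' : (1 : ℝ) ≤ β := by exact_mod_cast hβ
  have hd1 : (1 : ℝ) ≤ d := by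
    have : 1 ≤ d := by omega
    exact_mod_cast this
  have hlog := one_le_log (x := 8 * (d : ℝ)) (by linarith)
  have hc : 1 ≤ (β : ℝ) ^ (p + 1) * 3 ^ p * p := by
    have h1 := one_le_pow₀ (n := p + 1) hβ'
    have h2 := one_le_pow₀ (n := p) (by norm_num : (1 : ℝ) ≤ 3)
    exact one_le_mul_of_one_le_of_one_le (one_le_mul_of_one_le_of_one_le h1 h2) hp'
  have hden : 1 ≤ 68 * (β : ℝ) ^ (p + 1) * 3 ^ p * (p : ℝ) * Real.log (8 * (d : ℝ)) := by
    refine one_le_mul_of_one_le_of_one_le ?_ hlog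
    linarith
  have hN0 : 0 ≤ N := div_nonneg (by linarith) (by linarith)
  have hNd : N ≤ d := (div_le_self (by linarith) hden).trans (by linarith)
  by_cases hR : ⌊N ^ ((1 : ℝ) / p)⌋₊ < 2
  · refine ⟨1, 1, 3 * p + 4, one_pos, ⟨?_, ?_, ?_⟩, fun m => ?_, ?_, ?_⟩
    · simp; omega
    · simp; omega
    · omega
    · rw [one_pow, one_mul, one_mul, ← pow_mul]
      exact Nat.pow_le_pow_right two_pos (by nlinarith)
    · have h1 : β ^ p ≤ β ^ (p + 1) := Nat.pow_le_pow_right hβ (Nat.le_succ p)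
      have h2 : (1 + 1) * (3 * p + 4) ≤ 17 * p := by omega
      calc 3 ^ p * (β ^ p * ((1 + 1) * (3 * p + 4))) ≤ 3 ^ p * (β ^ (p + 1) * (17 * p)) := by gcongr
        _ = 17 * β ^ (p + 1) * 3 ^ p * p := by ring
        _ < d := hd
    · have := Nat.lt_of_floor_lt hR
      push_cast at this ⊢
      linarith
  · set R := ⌊N ^ ((1 : ℝ) / p)⌋₊ with hRdef
    have hR2 : 2 ≤ R := by omega
    have hRN : (R : ℝ) ^ p ≤ N := by
      calc (R : ℝ) ^ p ≤ (N ^ ((1 : ℝ) / p)) ^ p :=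
            pow_le_pow_left₀ (Nat.cast_nonneg _) (Nat.floor_le (by positivity)) p
        _ = N := by
            rw [← Real.rpow_natCast, ← Real.rpow_mul hN0, one_div_mul_cancel (by linarith),
              Real.rpow_one]
    have hRp : R ≤ R ^ p := Nat.le_self_pow hp.ne' R
    set c := Nat.log 2 R + 1 with hcdef
    have hc1 : R ≤ 2 ^ c := (Nat.lt_pow_succ_log_self one_lt_two R).le
    have hc2 : 2 ^ (c + 1) ≤ 4 * R := by
      have := Nat.pow_log_le_self 2 (by omega : R ≠ 0)
      rw [hcdef, pow_succ, pow_succ]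
      omega
    have hc3 : ((c : ℝ) + 1) * Real.log 2 ≤ Real.log (8 * d) := by
      have h1 : (R : ℝ) ≤ d := by
        have : (R : ℝ) ≤ (R : ℝ) ^ p := by exact_mod_cast hRp
        linarith
      have h2 : (2 : ℝ) ^ (c + 1) ≤ 8 * d := by
        have : (2 : ℝ) ^ (c + 1) ≤ 4 * R := by exact_mod_cast hc2
        linarith
      have h3 := Real.log_le_log (by positivity) h2
      rw [Real.log_pow] at h3
      push_cast at h3
      exact h3
    have hc4 : (c : ℝ) + 1 ≤ 2 * Real.log (8 * d) := by
      nlinarith [Real.log_two_gt_d9, (Nat.cast_nonneg c : (0 : ℝ) ≤ c)]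
    have hRp2 : 2 ≤ R ^ p := hR2.trans hRp
    refine ⟨R, 1 + 2 * c, 6 * p * R ^ p, by omega, ⟨?_, ?_, ?_⟩, fun m => ?_, ?_, ?_⟩
    · rw [max_eq_left hR2]
      have : 2 * (R - 1) + 1 ≤ 2 * R ^ p := by omega
      have := Nat.mul_le_mul_left p this
      have := Nat.mul_le_mul hp hRp2
      nlinarith
    · nlinarith
    · nlinarith
    · rw [mul_pow, ← pow_mul, ← pow_mul]
      calc R ^ (2 * β) * 2 ^ (m * β) ≤ (2 ^ c) ^ (2 * β) * 2 ^ (m * β) := by gcongr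
        _ = 2 ^ (c * (2 * β) + m * β) := by rw [← pow_mul, ← pow_add]
        _ ≤ 2 ^ ((1 + 2 * c) * (β * (m + 1))) :=
            Nat.pow_le_pow_right two_pos (by nlinarith [Nat.zero_le (c * β * m)])
    · have h1 : N * (68 * (β : ℝ) ^ (p + 1) * 3 ^ p * (p : ℝ) * Real.log (8 * (d : ℝ))) = d - 1 :=
        div_mul_cancel₀ _ (by linarith)
      have h2 : (β : ℝ) ^ p ≤ (β : ℝ) ^ (p + 1) := pow_le_pow_right₀ hβ' (Nat.le_succ p)
      have h3 : ((3 ^ p * (β ^ p * ((1 + 2 * c + 1) * (6 * p * R ^ p))) : ℕ) : ℝ) ≤ d - 1 := by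
        push_cast
        calc (3 : ℝ) ^ p * ((β : ℝ) ^ p * ((1 + 2 * c + 1) * (6 * p * (R : ℝ) ^ p)))
            = 3 ^ p * ((β : ℝ) ^ p * ((12 * (c + 1)) * (p * (R : ℝ) ^ p))) := by ring
          _ ≤ 3 ^ p * ((β : ℝ) ^ (p + 1) * ((68 * Real.log (8 * d)) * (p * N))) := by
              have h4 : 12 * ((c : ℝ) + 1) ≤ 68 * Real.log (8 * d) := by linarith
              have h5 : 0 ≤ 12 * ((c : ℝ) + 1) := by positivity
              generalize 12 * ((c : ℝ) + 1) = u at h4 h5 ⊢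
              generalize 68 * Real.log (8 * (d : ℝ)) = v at h4 ⊢
              have h6 := h5.trans h4
              gcongr
          _ = d - 1 := by rw [← h1]; ring
      have h4 : ((3 ^ p * (β ^ p * ((1 + 2 * c + 1) * (6 * p * R ^ p))) : ℕ) : ℝ) < d := by linarith
      exact_mod_cast h4
    · have := (Nat.lt_floor_add_one (N ^ ((1 : ℝ) / p))).le
      rw [← hRdef] at this
      have : (2 : ℝ) ≤ R := by exact_mod_cast hR2
      linarith

lemma exists_depth {p β L : ℕ} (hp : 0 < p) (hβ : 0 < β) (hL : 108 * β ^ 2 + 3 * p ≤ L) :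
    ∃ m h₁ h₂, h₁ + h₂ = m * p ∧ unitDepth m β h₁ h₂ + 3 * p < L ∧
      (((L : ℝ) - 3 * (p : ℝ)) / (72 * (β : ℝ) ^ 2 * Real.log (4 * (L : ℝ)))) ^ ((2 : ℝ) / p) ≤
        2 * 2 ^ m := by
  have hβ' : (1 : ℝ) ≤ β := by exact_mod_cast hβ
  have hp' : (1 : ℝ) ≤ p := by exact_mod_cast hp
  have hL' : 108 * (β : ℝ) ^ 2 + 3 * p ≤ L := by exact_mod_cast hL
  have hβ2 : (1 : ℝ) ≤ (β : ℝ) ^ 2 := one_le_pow₀ hβ'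
  have hlog := one_le_log (x := 4 * (L : ℝ)) (by linarith)
  set lam := Real.log (4 * (L : ℝ)) with hlam
  set a : ℝ := ((L : ℝ) - 3 * (p : ℝ)) / (72 * (β : ℝ) ^ 2 * lam) with ha
  have ha0 : 0 ≤ a := div_nonneg (by nlinarith) (by positivity)
  rcases lt_or_ge a 1 with ha1 | ha1
  · refine ⟨0, 0, 0, by simp, ?_, ?_⟩
    · obtain ⟨b, rfl⟩ := Nat.exists_eq_add_of_lt hβ
      simp only [unitDepth, zero_add, Nat.add_sub_cancel]
      nlinarith
    · have := Real.rpow_le_one ha0 ha1.le (by positivity : 0 ≤ (2 : ℝ) / p)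
      linarith
  · have hx : 1 ≤ a ^ ((2 : ℝ) / p) := Real.one_le_rpow ha1 (by positivity)
    obtain ⟨m, hm1, hm2⟩ := exists_nat_pow_near hx one_lt_two
    have hmp : (2 : ℝ) ^ (m * p) ≤ a ^ 2 := by
      calc (2 : ℝ) ^ (m * p) = (2 ^ m) ^ p := pow_mul _ _ _
        _ ≤ (a ^ ((2 : ℝ) / p)) ^ p := pow_le_pow_left₀ (by positivity) hm1 p
        _ = a ^ 2 := by
            rw [← Real.rpow_natCast, ← Real.rpow_mul ha0, div_mul_cancel₀ _ (by linarith)]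
            exact_mod_cast Real.rpow_natCast a 2
    have haL : a ≤ L := by
      refine (div_le_self (by nlinarith) ?_).trans (by linarith)
      exact one_le_mul_of_one_le_of_one_le (by linarith) hlog
    have hmlam : (m : ℝ) ≤ 3 * lam := by
      have h1 : (2 : ℝ) ^ m ≤ (4 * L) ^ 2 := by
        calc (2 : ℝ) ^ m ≤ 2 ^ (m * p) :=
              pow_le_pow_right₀ one_le_two (Nat.le_mul_of_pos_right m hp)
          _ ≤ a ^ 2 := hmp
          _ ≤ (4 * L) ^ 2 := pow_le_pow_left₀ ha0 (by linarith) 2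
      have h2 := Real.log_le_log (by positivity) h1
      rw [Real.log_pow, Real.log_pow, ← hlam] at h2
      push_cast at h2
      nlinarith [Real.log_two_gt_d9, (Nat.cast_nonneg m : (0 : ℝ) ≤ m)]
    have hh₂ : (2 : ℝ) ^ (m * p / 2) ≤ a := by
      refine le_of_sq_le_sq ?_ ha0
      rw [← pow_mul]
      exact (pow_le_pow_right₀ one_le_two (Nat.div_mul_le_self _ _)).trans hmp
    have hh₁ : (2 : ℝ) ^ (m * p - m * p / 2) ≤ 2 * a := by
      calc (2 : ℝ) ^ (m * p - m * p / 2) ≤ 2 ^ (m * p / 2 + 1) :=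
            pow_le_pow_right₀ one_le_two (by omega)
        _ ≤ 2 * a := by rw [pow_succ]; linarith
    refine ⟨m, m * p - m * p / 2, m * p / 2, by omega, ?_, ?_⟩
    · have key : a * (72 * (β : ℝ) ^ 2 * lam) = L - 3 * p := div_mul_cancel₀ _ (by positivity)
      have hb : ((β - 1 : ℕ) : ℝ) ≤ β := by exact_mod_cast Nat.sub_le _ _
      have h1 : ((unitDepth m β (m * p - m * p / 2) (m * p / 2) + 3 * p + 1 : ℕ) : ℝ) ≤ L := by
        unfold unitDepth
        push_cast
        have t0 : 1 ≤ a * lam := one_le_mul_of_one_le_of_one_le ha1 hlog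
        have t0' : lam ≤ a * lam := le_mul_of_one_le_left (by linarith) ha1
        have t1 : 2 * (2 : ℝ) ^ (m * p - m * p / 2) ≤ 4 * (a * lam) := by nlinarith
        have t2 : (2 : ℝ) * (2 ^ (m * p / 2) * (β * (m + 1))) ≤ 8 * β ^ 2 * (a * lam) := by
          have : (2 : ℝ) ^ (m * p / 2) * (β * (m + 1)) ≤ a * (β ^ 2 * (4 * lam)) := by
            gcongr
            · nlinarith
            · linarith
          linarith
        have t3 : 2 * (((β - 1 : ℕ) : ℝ) * (m + 2)) * ((β - 1 : ℕ) : ℝ) ≤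
            10 * β ^ 2 * (a * lam) := by
          have : 2 * (((β - 1 : ℕ) : ℝ) * (m + 2)) * ((β - 1 : ℕ) : ℝ) ≤
            2 * (β * (5 * (a * lam))) * β := by
            gcongr
            linarith
          linarith
        have t4 : a * lam ≤ β ^ 2 * (a * lam) := le_mul_of_one_le_left (by linarith) hβ2
        linarith
      exact_mod_cast h1
    · rw [pow_succ] at hm2
      linarith

theorem exists_prompt_approx {p β : ℕ} (hp : 0 < p) (hβ : 0 < β)
    {d : ℕ} (hd : 17 * β ^ (p + 1) * 3 ^ p * p + 1 ≤ d)
    {Θ : List (TFLayer (4 * d + 8))} (hΘ : EmulatesWith d (tfForward Θ) relu)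
    {T : ℕ} (hT : 2 * d * (108 * β ^ 2 + 3 * p) ≤ T) {L : ℕ} (hL : L = T / (2 * d))
    {f : (Fin p → ℝ) → ℝ} (hf : f ∈ Hclass p β) {δ : ℝ} (hδ : 0 < δ) :
      ∃ (S : ℝ) (T' : ℕ) (u : Fin T' → Fin d → ℝ) (w : Fin T' → ℕ),
        0 < S ∧ 1 ≤ T' ∧ T' ≤ T ∧ ValidPrompt Set.univ T' L u w ∧
        supDist p f (fhat (tfForward Θ) u w S L p)
          ≤ (85 * ((β : ℝ) + 1) ^ p * 8 ^ β) *
              ((((d : ℝ) - 1) / (68 * (β : ℝ) ^ (p + 1) * 3 ^ p * (p : ℝ)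
                  * Real.log (8 * (d : ℝ)))) ^ (-(2 * (β : ℝ)) / (p : ℝ))) *
              ((((L : ℝ) - 3 * (p : ℝ)) / (72 * (β : ℝ) ^ 2
                  * Real.log (4 * (L : ℝ)))) ^ (-(2 * (β : ℝ)) / (p : ℝ))) + δ := by
  have hd0 : 0 < d := by omega
  have hL1 : 108 * β ^ 2 + 3 * p ≤ L := by
    rw [hL, Nat.le_div_iff_mul_le (by omega), mul_comm]
    exact hT
  obtain ⟨R, G, W, hR, hW, hG, hw, hNR⟩ := exists_width hp hβ hd
  obtain ⟨m, h₁, h₂, hh, hdepth, hLm⟩ := exists_depth hp hβ hL1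
  obtain ⟨g, hg, hgf⟩ := exists_cube_net hp hR hβ hh hW (hG m) hf hδ
  have hpd : p < d := by
    have : 0 < 17 * β ^ (p + 1) * 3 ^ p := by positivity
    have := Nat.le_mul_of_pos_left p this
    omega
  set w := 3 ^ p * (β ^ p * ((G + 1) * W)) with hwdef
  have hw2 : 2 ≤ w := by
    have h1 : 2 ≤ W := by have := hW.2.2; omega
    have h2 : 0 < 3 ^ p * (β ^ p * (G + 1)) := by positivity
    calc 2 ≤ W := h1
      _ ≤ (3 ^ p * (β ^ p * (G + 1))) * W := Nat.le_mul_of_pos_left _ h2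
      _ = w := by rw [hwdef]; ring
  have hg' := hg.trans ((Net.pass_signed g (L - 1 - (unitDepth m β h₁ h₂ + 3 * p))).mono_width hw2)
  rw [show unitDepth m β h₁ h₂ + 3 * p + (L - 1 - (unitDepth m β h₁ h₂ + 3 * p)) = L - 1 by omega]
    at hg'
  obtain ⟨S, T', u, ws, hS, hT1, hT2, hv, happ⟩ := exists_prompt hΘ (T := T) hg' hw hpd (by
    rw [Nat.sub_add_cancel (by omega), ← mul_assoc, hL]
    exact Nat.mul_div_le _ _)
  rw [Nat.sub_add_cancel (by omega)] at hv happ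
  refine ⟨S, T', u, ws, hS, hT1, hT2, hv, ?_⟩
  have hβ' : (1 : ℝ) ≤ β := by exact_mod_cast hβ
  have hp' : (1 : ℝ) ≤ p := by exact_mod_cast hp
  have hL' : 108 * (β : ℝ) ^ 2 + 3 * p ≤ L := by exact_mod_cast hL1
  have hd' : 17 * (β : ℝ) ^ (p + 1) * 3 ^ p * p + 1 ≤ d := by exact_mod_cast hd
  have hN0 : 0 < ((d : ℝ) - 1) / (68 * (β : ℝ) ^ (p + 1) * 3 ^ p * (p : ℝ) *
      Real.log (8 * (d : ℝ))) := by
    have h1 : 0 < 17 * (β : ℝ) ^ (p + 1) * 3 ^ p * p := by positivity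
    have := one_le_log (x := 8 * (d : ℝ)) (by linarith)
    exact div_pos (by linarith) (by positivity)
  have ha0 : 0 < ((L : ℝ) - 3 * (p : ℝ)) / (72 * (β : ℝ) ^ 2 * Real.log (4 * (L : ℝ))) := by
    have h1 : 1 ≤ (β : ℝ) ^ 2 := one_le_pow₀ hβ'
    have := one_le_log (x := 4 * (L : ℝ)) (by linarith)
    exact div_pos (by linarith) (by positivity)
  set N : ℝ := ((d : ℝ) - 1) / (68 * (β : ℝ) ^ (p + 1) * 3 ^ p * (p : ℝ) * Real.log (8 * (d : ℝ)))
  set a : ℝ := ((L : ℝ) - 3 * (p : ℝ)) / (72 * (β : ℝ) ^ 2 * Real.log (4 * (L : ℝ)))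
  have hpow : ∀ x : ℝ, 0 < x → x ^ (-(2 * (β : ℝ)) / p) = ((x ^ ((2 : ℝ) / p)) ^ β)⁻¹ := by
    intro x hx
    rw [← Real.rpow_natCast, ← Real.rpow_mul hx.le, ← Real.rpow_neg hx.le]
    congr 1
    ring
  have hN2 : N ^ ((2 : ℝ) / p) ≤ 4 * (R : ℝ) ^ 2 := by
    have : N ^ ((2 : ℝ) / p) = (N ^ ((1 : ℝ) / p)) ^ 2 := by
      rw [← Real.rpow_natCast, ← Real.rpow_mul hN0.le]
      congr 1
      push_cast
      ring
    rw [this]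
    calc _ ≤ (2 * (R : ℝ)) ^ 2 := pow_le_pow_left₀ (by positivity) hNR 2
      _ = _ := by ring
  have hK : N ^ ((2 : ℝ) / p) * a ^ ((2 : ℝ) / p) ≤ 8 * ((R : ℝ) ^ 2 * 2 ^ m) := by
    calc _ ≤ (4 * (R : ℝ) ^ 2) * (2 * 2 ^ m) :=
          mul_le_mul hN2 hLm (by positivity) (by positivity)
      _ = _ := by ring
  have hKβ : (((R : ℝ) ^ 2 * 2 ^ m) ^ β)⁻¹ ≤ 8 ^ β * (N ^ (-(2 * (β : ℝ)) / p) *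
      a ^ (-(2 * (β : ℝ)) / p)) := by
    rw [hpow N hN0, hpow a ha0, ← mul_inv, ← mul_pow, ← div_eq_mul_inv,
      le_div_iff₀ (by positivity), inv_mul_le_iff₀ (by positivity), ← mul_pow, mul_comm _ (8 : ℝ)]
    exact pow_le_pow_left₀ (by positivity) hK β
  have hmain : 4 * ((β : ℝ) + 1) ^ p * (((R : ℝ) ^ 2 * 2 ^ m) ^ β)⁻¹ ≤
      85 * ((β : ℝ) + 1) ^ p * 8 ^ β * N ^ (-(2 * (β : ℝ)) / p) * a ^ (-(2 * (β : ℝ)) / p) := by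
    calc _ ≤ 85 * ((β : ℝ) + 1) ^ p * (8 ^ β * (N ^ (-(2 * (β : ℝ)) / p) *
          a ^ (-(2 * (β : ℝ)) / p))) := by gcongr; norm_num
      _ = _ := by ring
  refine Real.iSup_le (fun x => ?_) (by positivity)
  rw [happ x.1 x.2, abs_sub_comm]
  exact (hgf x.1 x.2).trans (by linarith)

end Rates

end ReluNet

/-- Approximation error in terms of prompt length: for `T ≥ 2d(108β²+3p)`
and `L = ⌊T/(2d)⌋`,
`sup_f inf_{S>0, H^P ∈ Q_{ℝ^d}(T,L,S)} ‖f̂ − f‖_∞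
  ≤ C₁·((d−1)/(C₂·log(8d)))^{−2β/p}·((L−3p)/(C₃·log(4L)))^{−2β/p}`. -/
theorem statement_11 (p β : ℕ) (hp : 0 < p) (hβ : 0 < β)
    (d : ℕ) (hd : 17 * β ^ (p + 1) * 3 ^ p * p + 1 ≤ d)
    (Θ : List (TFLayer (4 * d + 8))) (hΘ : EmulatesWith d (tfForward Θ) relu)
    (T : ℕ) (hT : 2 * d * (108 * β ^ 2 + 3 * p) ≤ T) :
    ∀ L : ℕ, L = T / (2 * d) →
    ∀ f ∈ Hclass p β, ∀ δ : ℝ, 0 < δ →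
      ∃ (S : ℝ) (T' : ℕ) (u : Fin T' → Fin d → ℝ) (w : Fin T' → ℕ),
        0 < S ∧ 1 ≤ T' ∧ T' ≤ T ∧ ValidPrompt Set.univ T' L u w ∧
        supDist p f (fhat (tfForward Θ) u w S L p)
          ≤ (85 * ((β : ℝ) + 1) ^ p * 8 ^ β) *
              ((((d : ℝ) - 1) / (68 * (β : ℝ) ^ (p + 1) * 3 ^ p * (p : ℝ)
                  * Real.log (8 * (d : ℝ)))) ^ (-(2 * (β : ℝ)) / (p : ℝ))) *
              ((((L : ℝ) - 3 * (p : ℝ)) / (72 * (β : ℝ) ^ 2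
                  * Real.log (4 * (L : ℝ)))) ^ (-(2 * (β : ℝ)) / (p : ℝ))) + δ := by
  intro L hL f hf δ hδ
  exact ReluNet.exists_prompt_approx hp hβ hd hΘ hT hL hf hδ
end

section
/- Let Θ be any transformer parameters with the emulation property. Fix d∈ℕ+ and p,r,L∈ℕ+ with p ≤ r ≤ d−1. Then for every ReLU network φ̄∈N(r,p,L) there exists a threshold S* > 0 such that for every S ≥ S* there exists a prompt H^P∈P_{U_{d,r+1}}(2(r+1)L, L, S) with f̂_{Θ,H^P,L,p}(x) = φ̄(x) for all x∈[0,1]^p; that is, every width-r depth-L ReLU network (with biases) is exactly realized on [0,1]^p by prompting with at most 2(r+1)L tokens whose word embeddings lie in the span of the first r+1 standard basis vectors. -/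
open scoped BigOperators
open Matrix

open PromptTF Matrix

namespace PromptTF

lemma embed_dotProduct {d q : ℕ} (hq : q < d) (x : Fin q → ℝ) (g : Fin d → ℝ) :
    g ⬝ᵥ embed d q x = ∑ j : Fin q, g (Fin.castLE hq.le j) * x j + g ⟨q, hq⟩ := by
  obtain ⟨m, rfl⟩ : ∃ m, d = q + 1 + m := ⟨d - (q + 1), by omega⟩
  simp only [dotProduct, Fin.sum_univ_add, Fin.sum_univ_castSucc (n := q)]
  have h0 : ∀ i : Fin m, embed (q + 1 + m) q x (Fin.natAdd (q + 1) i) = 0 := by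
    intro i
    have h1 : ¬ (q + 1 + (i : ℕ) < q) := by omega
    have h2 : ¬ (q + 1 + (i : ℕ) = q) := by omega
    simp [embed, h1, h2]
  have h1 : ∀ i : Fin q, embed (q + 1 + m) q x (Fin.castAdd m i.castSucc) = x i := by
    intro i
    simp [embed]
  have h2 : embed (q + 1 + m) q x (Fin.castAdd m (Fin.last q)) = 1 := by
    simp [embed]
  simp only [h0, h1, h2, mul_zero, Finset.sum_const_zero, add_zero, mul_one]
  rfl

lemma relu_embed (d q : ℕ) (x : Fin q → ℝ) :
    (fun k => relu (embed d q x k)) = embed d q fun j => relu (x j) := by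
  funext k
  simp only [embed]
  split_ifs <;> simp [relu]

/-- The row vector `(v, c, 0) ∈ ℝ^d`. -/
def homRow (d : ℕ) {q : ℕ} (v : Fin q → ℝ) (c : ℝ) : Fin d → ℝ :=
  fun j => if hj : (j : ℕ) < q then v ⟨j, hj⟩ else if (j : ℕ) = q then c else 0

/-- The linear map on `ℝ^d` acting on homogeneous coordinates `(x, 1, 0)` as the
affine map `x ↦ W x + b`. -/
def affineMat (d : ℕ) {q r : ℕ} (W : Matrix (Fin r) (Fin q) ℝ) (b : Fin r → ℝ) :
    Matrix (Fin d) (Fin d) ℝ :=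
  Matrix.of fun i => if hi : (i : ℕ) < r then homRow d (W ⟨i, hi⟩) (b ⟨i, hi⟩)
    else if (i : ℕ) = r then homRow d (0 : Fin q → ℝ) 1 else 0

lemma affineMat_mulVec_embed {d q r : ℕ} (hq : q < d) (W : Matrix (Fin r) (Fin q) ℝ)
    (b : Fin r → ℝ) (x : Fin q → ℝ) :
    (affineMat d W b).mulVec (embed d q x) = embed d r fun i => W.mulVec x i + b i := by
  have key : ∀ (v : Fin q → ℝ) (c : ℝ),
      homRow d v c ⬝ᵥ embed d q x = v ⬝ᵥ x + c := by
    intro v c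
    rw [embed_dotProduct hq]
    simp [homRow, dotProduct]
  funext i
  simp only [mulVec, affineMat, Matrix.of_apply, embed]
  split_ifs with h1 h2
  · exact key _ _
  · simpa using key 0 1
  · simp

lemma affineMat_eq_zero_of_row {d q r : ℕ} (W : Matrix (Fin r) (Fin q) ℝ) (b : Fin r → ℝ)
    {i j : Fin d} (hi : r + 1 ≤ (i : ℕ)) : affineMat d W b i j = 0 := by
  simp [affineMat, show ¬ (i : ℕ) < r by omega, show ¬ (i : ℕ) = r by omega]

lemma affineMat_eq_zero_of_col {d q r : ℕ} (W : Matrix (Fin r) (Fin q) ℝ) (b : Fin r → ℝ)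
    {i j : Fin d} (hj : q + 1 ≤ (j : ℕ)) : affineMat d W b i j = 0 := by
  have h1 : ¬ (j : ℕ) < q := by omega
  have h2 : ¬ (j : ℕ) = q := by omega
  simp only [affineMat, Matrix.of_apply]
  split_ifs <;> simp [homRow, h1, h2]

lemma vnetOut_congr {d L : ℕ} (act : ℝ → ℝ) {A A' : ℕ → Matrix (Fin d) (Fin d) ℝ}
    (h : ∀ ℓ, 1 ≤ ℓ → ℓ ≤ L → A ℓ = A' ℓ) (z : Fin d → ℝ) :
    ∀ ℓ ≤ L, vnetOut d act A z ℓ = vnetOut d act A' z ℓ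
  | 0, _ => rfl
  | ℓ + 1, hℓ => by
      simp only [vnetOut, h (ℓ + 1) (by omega) hℓ, vnetOut_congr act h z ℓ (by omega)]

lemma vnetOut_one {d : ℕ} (act : ℝ → ℝ) (A : ℕ → Matrix (Fin d) (Fin d) ℝ)
    (z : Fin d → ℝ) : vnetOut d act A z 1 = (A 1).mulVec z := rfl

lemma vnetOut_add_two {d : ℕ} (act : ℝ → ℝ) (A : ℕ → Matrix (Fin d) (Fin d) ℝ)
    (z : Fin d → ℝ) (k : ℕ) :
    vnetOut d act A z (k + 2) =
      (A (k + 2)).mulVec fun i => act (vnetOut d act A z (k + 1) i) := by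
  rw [vnetOut]
  simp

/-- Word embeddings of the prompt listing, for each layer, the rank-one
decomposition `∑ k < n, e_k (A ℓ)_k`. -/
def promptWords (d n : ℕ) (A : ℕ → Matrix (Fin d) (Fin d) ℝ) (j : ℕ) : Fin d → ℝ :=
  if j % 2 = 0 then fun i => if (i : ℕ) = j / 2 % n then 1 else 0
  else fun i => if h : j / 2 % n < d then A (j / 2 / n + 1) ⟨j / 2 % n, h⟩ i else 0

/-- Layer indices of the prompt with `n` pairs of tokens per layer. -/
def promptLayers (n : ℕ) (j : ℕ) : ℕ := 2 * (j / 2 / n) + 1 + j % 2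

lemma WPmat_promptWords {d n L : ℕ} (hn : 0 < n) (hnd : n ≤ d)
    (A : ℕ → Matrix (Fin d) (Fin d) ℝ)
    (hA : ∀ ℓ (i j : Fin d), n ≤ (i : ℕ) → A ℓ i j = 0)
    {ℓ : ℕ} (h1 : 1 ≤ ℓ) (h2 : ℓ ≤ L) :
    WPmat (fun j : Fin (2 * n * L) => promptWords d n A j)
      (fun j => promptLayers n j) ℓ = A ℓ := by
  obtain ⟨m, rfl⟩ : ∃ m, ℓ = m + 1 := ⟨ℓ - 1, by omega⟩
  have hmL : n * m + n ≤ n * L := by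
    have := Nat.mul_le_mul_left n h2
    rwa [Nat.mul_succ] at this
  have hT : 2 * n * L = 2 * (n * L) := by ring
  have hlt : ∀ k : Fin n, 2 * (n * m + k) < 2 * n * L := by
    intro k
    have := k.2
    omega
  let e : Fin n → Fin (2 * n * L) := fun k => ⟨2 * (n * m + k), hlt k⟩
  have hdiv : ∀ k : Fin n, (n * m + k) / n = m := by
    intro k
    rw [Nat.mul_add_div hn, Nat.div_eq_of_lt k.2, add_zero]
  have hmod : ∀ k : Fin n, (n * m + k) % n = k := by
    intro k
    rw [Nat.mul_add_mod, Nat.mod_eq_of_lt k.2]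
  have hsum : WPmat (fun j : Fin (2 * n * L) => promptWords d n A j)
      (fun j => promptLayers n j) (m + 1) =
      ∑ k : Fin n, vecMulVec (fun i : Fin d => if (i : ℕ) = k then (1 : ℝ) else 0)
        (A (m + 1) (Fin.castLE hnd k)) := by
    unfold WPmat
    symm
    refine Finset.sum_of_injOn e ?_ (fun _ _ => Finset.mem_coe.2 (Finset.mem_univ _)) ?_ ?_
    · intro a _ b _ hab
      have : 2 * (n * m + (a : ℕ)) = 2 * (n * m + (b : ℕ)) := congrArg Fin.val hab
      exact Fin.ext (by omega)
    · intro j _ hj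
      split_ifs with h3 h4
      · exfalso
        obtain ⟨h4, -⟩ := h4
        apply hj
        simp only [promptLayers] at h4
        have hd2 : (j : ℕ) / 2 / n = m := by omega
        have hdm := Nat.div_add_mod ((j : ℕ) / 2) n
        rw [hd2] at hdm
        refine ⟨⟨(j : ℕ) / 2 % n, Nat.mod_lt _ hn⟩, by simp, ?_⟩
        apply Fin.ext
        change 2 * (n * m + (j : ℕ) / 2 % n) = j
        omega
      · rfl
      · rfl
    · intro k _
      have hk := k.2
      have e0 : (2 * (n * m + (k : ℕ))) / 2 = n * m + k := by omega
      have e1 : (2 * (n * m + (k : ℕ)) + 1) / 2 = n * m + k := by omega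
      have e2 : (2 * (n * m + (k : ℕ))) % 2 = 0 := by omega
      have e3 : (2 * (n * m + (k : ℕ)) + 1) % 2 = 1 := by omega
      have hlt' : 2 * (n * m + (k : ℕ)) + 1 < 2 * n * L := by omega
      have hkd : (k : ℕ) < d := by omega
      have hl : 2 * m + 1 = 2 * (m + 1) - 1 := by omega
      simp only [e, promptLayers, promptWords, e0, e1, e2, e3, hdiv, hmod, hlt', hkd,
        dif_pos, if_pos, add_zero, one_ne_zero, if_false, hl]
      rw [if_pos ⟨trivial, by omega⟩]
      rfl
  rw [hsum]
  ext i j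
  simp only [Matrix.sum_apply, vecMulVec_apply, ite_mul, one_mul, zero_mul]
  by_cases hi : (i : ℕ) < n
  · rw [Finset.sum_eq_single ⟨i, hi⟩]
    · simp
    · intro b _ hb
      rw [if_neg]
      intro h
      exact hb (Fin.ext h.symm)
    · simp
  · rw [hA _ _ _ (by omega)]
    refine Finset.sum_eq_zero fun k _ => if_neg ?_
    have := k.2
    omega

lemma promptWords_mem_spanFirst {d n : ℕ} (hn : 0 < n)
    {A : ℕ → Matrix (Fin d) (Fin d) ℝ}
    (hA : ∀ ℓ (i j : Fin d), n ≤ (j : ℕ) → A ℓ i j = 0) (j : ℕ) :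
    promptWords d n A j ∈ spanFirst d n := by
  intro k hk
  have := Nat.mod_lt (j / 2) hn
  unfold promptWords
  split_ifs with h
  · exact if_neg (by omega)
  · exact hA _ _ _ hk
  · rfl

lemma promptLayers_bounds {n L j : ℕ} (hj : j < 2 * n * L) :
    1 ≤ promptLayers n j ∧ promptLayers n j ≤ 2 * L := by
  have : j / 2 / n < L := by
    rw [Nat.div_div_eq_div_mul]
    exact Nat.div_lt_of_lt_mul hj
  unfold promptLayers
  omega

lemma WPfam_promptWords {d n L : ℕ} (hn : 0 < n) (hnd : n ≤ d)
    (A : ℕ → Matrix (Fin d) (Fin d) ℝ)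
    (hA : ∀ ℓ (i j : Fin d), n ≤ (i : ℕ) → A ℓ i j = 0) (i : ℕ)
    {ℓ : ℕ} (h1 : 1 ≤ ℓ) (h2 : ℓ ≤ L) :
    WPfam (fun j : Fin (2 * n * L) => promptWords d n A j)
      (fun j => promptLayers n j) i ℓ = A ℓ := by
  have hcorr : WPcorr (fun j : Fin (2 * n * L) => promptWords d n A j)
      (fun j => promptLayers n j) = 0 := by
    have hT : 2 * n * L = 2 * (n * L) := by ring
    have hpos : 0 < n * L := Nat.mul_pos hn (by omega)
    unfold WPcorr
    rw [dif_pos (by omega), if_neg]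
    unfold promptLayers
    simp only
    omega
  unfold WPfam
  split_ifs with h
  · subst h
    simp only [WPone, hcorr, ite_self, add_zero]
    exact WPmat_promptWords hn hnd A hA h1 h2
  · exact WPmat_promptWords hn hnd A hA h1 h2

/-- Any network whose weight matrices are supported on the first `n` coordinates is
realized by a prompt. -/
lemma exists_prompt_fhat_eq {d : ℕ} {Θ : List (TFLayer (4 * d + 8))}
    (hΘ : EmulatesWith d (tfForward Θ) relu) {n L : ℕ} (hn : 0 < n) (hnd : n ≤ d)
    (hL : 0 < L) (A : ℕ → Matrix (Fin d) (Fin d) ℝ)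
    (hrow : ∀ ℓ (i j : Fin d), n ≤ (i : ℕ) → A ℓ i j = 0)
    (hcol : ∀ ℓ (i j : Fin d), n ≤ (j : ℕ) → A ℓ i j = 0) (p : ℕ) :
    ∃ Sstar : ℝ, 0 < Sstar ∧ ∀ S : ℝ, Sstar ≤ S →
      ∃ (u : Fin (2 * n * L) → Fin d → ℝ) (w : Fin (2 * n * L) → ℕ),
        ValidPrompt (spanFirst d n) (2 * n * L) L u w ∧
        ∀ x ∈ unitCube p, fhat (tfForward Θ) u w S L p x =
          vnetOut d relu A (embed d p x) L ⟨0, by omega⟩ := by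
  set u : Fin (2 * n * L) → Fin d → ℝ := fun j => promptWords d n A j with hu
  set w : Fin (2 * n * L) → ℕ := fun j => promptLayers n j with hw
  let B : ℝ := 1 + ∑ j, Real.sqrt (∑ k, u j k ^ 2)
  have hB : 1 ≤ B :=
    le_add_of_nonneg_right (Finset.sum_nonneg fun _ _ => Real.sqrt_nonneg _)
  have huB : ∀ j, u j ∈ eball d B := by
    intro j
    have := Finset.single_le_sum (f := fun j => Real.sqrt (∑ k, u j k ^ 2))
      (fun _ _ => Real.sqrt_nonneg _) (Finset.mem_univ j)
    simp only [eball, Set.mem_ofPred_eq, B]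
    linarith
  have hwb : ∀ j, 1 ≤ w j ∧ w j ≤ 2 * L := fun j => promptLayers_bounds j.2
  have hLpos : (0 : ℝ) < 2 * L := by positivity
  refine ⟨_, lt_of_lt_of_le hLpos (le_max_right
    ((d : ℝ) * B ^ (4 * L) * ((2 * n * L : ℕ) : ℝ) ^ (2 * L)) _), fun S hS => ?_⟩
  refine ⟨u, w, ⟨fun j => promptWords_mem_spanFirst hn hcol j, hwb⟩, fun x hx => ?_⟩
  have hz : ∀ (_ : Fin 1) k, embed d p x k ∈ Set.Icc (0 : ℝ) 1 := by
    intro _ k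
    unfold embed
    split_ifs with h
    · exact ⟨hx.1 ⟨k, h⟩, hx.2 ⟨k, h⟩⟩
    · simp
    · simp
  have key := hΘ B hB (2 * n * L) L (by positivity) hL (eball d B) subset_rfl S hS u w
    ⟨huB, hwb⟩ 1 one_pos (fun _ => embed d p x) hz 0 L hL le_rfl
  have hpos : 2 * n * L + 1 + L = 2 * n * L + 1 * L + ((0 : Fin 1) : ℕ) + 1 := by
    simp only [Fin.val_zero]
    ring
  unfold fhat
  rw [hpos, key, promptToken, dif_pos (by simp; omega)]
  exact congrFun (vnetOut_congr relu
    (fun ℓ h1 h2 => WPfam_promptWords hn hnd A hrow _ h1 h2) _ L le_rfl) _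

/-- Homogeneous weight matrices of the network with first layer `(W0, b0)`, inner layers
`(Wm k, bm k)` and scalar output layer `(wL, bL)` at depth `L`. -/
def netMats (d L : ℕ) {p r : ℕ} (W0 : Matrix (Fin r) (Fin p) ℝ) (b0 : Fin r → ℝ)
    (Wm : ℕ → Matrix (Fin r) (Fin r) ℝ) (bm : ℕ → Fin r → ℝ) (wL : Fin r → ℝ) (bL : ℝ) :
    ℕ → Matrix (Fin d) (Fin d) ℝ
  | 0 => 0
  | 1 => affineMat d W0 b0
  | k + 2 => if k + 2 = L then affineMat d (Matrix.of fun _ : Fin r => wL) fun _ => bL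
      else affineMat d (Wm k) (bm k)

lemma vnetOut_netMats_hidden {d L p r : ℕ} (hp : p < d) (hr : r < d)
    (W0 : Matrix (Fin r) (Fin p) ℝ) (b0 : Fin r → ℝ)
    (Wm : ℕ → Matrix (Fin r) (Fin r) ℝ) (bm : ℕ → Fin r → ℝ) (wL : Fin r → ℝ) (bL : ℝ)
    (x : Fin p → ℝ) :
    ∀ k, k + 1 < L →
      vnetOut d relu (netMats d L W0 b0 Wm bm wL bL) (embed d p x) (k + 1) =
        embed d r (nnHidden W0 b0 Wm bm x k)
  | 0, _ => affineMat_mulVec_embed hp W0 b0 x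
  | k + 1, hk => by
      rw [vnetOut_add_two, vnetOut_netMats_hidden hp hr W0 b0 Wm bm wL bL x k (by omega),
        relu_embed, netMats, if_neg (by omega), affineMat_mulVec_embed hr]
      rfl

end PromptTF

/-- Every width-`r` depth-`L` ReLU network (with biases) is exactly realized
on `[0,1]^p` by a prompt of `2(r+1)L` tokens whose word embeddings lie in
`U_{d,r+1} = span{e_1,…,e_{r+1}}`, for any sufficiently large scale `S`. -/
theorem statement_19 (d : ℕ) (hd : 0 < d)
    (Θ : List (TFLayer (4 * d + 8))) (hΘ : EmulatesWith d (tfForward Θ) relu)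
    (p r L : ℕ) (hp : 0 < p) (hL : 0 < L) (hpr : p ≤ r) (hrd : r + 1 ≤ d) :
    ∀ φ ∈ NNclass r p L,
      ∃ Sstar : ℝ, 0 < Sstar ∧
        ∀ S : ℝ, Sstar ≤ S →
          ∃ (u : Fin (2 * (r + 1) * L) → Fin d → ℝ) (w : Fin (2 * (r + 1) * L) → ℕ),
            ValidPrompt (spanFirst d (r + 1)) (2 * (r + 1) * L) L u w ∧
            ∀ x ∈ unitCube p, fhat (tfForward Θ) u w S L p x = φ x := by
  intro φ hφ
  by_cases hL1 : L = 1
  · subst hL1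
    simp only [NNclass, Set.mem_ofPred_eq, if_true] at hφ
    obtain ⟨a, b, rfl⟩ := hφ
    obtain ⟨Sstar, hS, h⟩ := exists_prompt_fhat_eq hΘ (Nat.succ_pos r) hrd one_pos
      (fun _ => affineMat d (Matrix.of fun _ : Fin r => a) fun _ => b)
      (fun _ _ _ hi => affineMat_eq_zero_of_row _ _ hi)
      (fun _ _ _ hj => affineMat_eq_zero_of_col _ _ (by omega)) p
    refine ⟨Sstar, hS, fun S hSS => ?_⟩
    obtain ⟨u, w, hv, hx⟩ := h S hSS
    refine ⟨u, w, hv, fun x hxc => ?_⟩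
    rw [hx x hxc, vnetOut_one, affineMat_mulVec_embed (by omega), embed, dif_pos (by simp; omega)]
    rfl
  · simp only [NNclass, Set.mem_ofPred_eq, if_neg hL1] at hφ
    obtain ⟨W0, b0, Wm, bm, wL, bL, rfl⟩ := hφ
    obtain ⟨m, rfl⟩ : ∃ m, L = m + 2 := ⟨L - 2, by omega⟩
    obtain ⟨Sstar, hS, h⟩ := exists_prompt_fhat_eq hΘ (Nat.succ_pos r) hrd hL
      (netMats d (m + 2) W0 b0 Wm bm wL bL)
      (fun ℓ i j hi => by
        unfold netMats
        split
        · rfl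
        · exact affineMat_eq_zero_of_row _ _ hi
        · split_ifs <;> exact affineMat_eq_zero_of_row _ _ hi)
      (fun ℓ i j hj => by
        unfold netMats
        split
        · rfl
        · exact affineMat_eq_zero_of_col _ _ (by omega)
        · split_ifs <;> exact affineMat_eq_zero_of_col _ _ (by omega)) p
    refine ⟨Sstar, hS, fun S hSS => ?_⟩
    obtain ⟨u, w, hv, hx⟩ := h S hSS
    refine ⟨u, w, hv, fun x hxc => ?_⟩
    rw [hx x hxc, vnetOut_add_two, vnetOut_netMats_hidden (show p < d by omega)
      (show r < d by omega) W0 b0 Wm bm wL bL x m (by omega), relu_embed, netMats, if_pos rfl, affineMat_mulVec_embed (by omega), embed,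
      dif_pos (by simp; omega)]
    rfl
end
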